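/- arXiv:1509.07296 — 2 statements merged into one kernel-verified Lean document; each statement's English description precedes it below -/
import Mathlib

section
/- (Parametric representation.) Let G be a Feynman graph with edges labelled 1,…,E (E ≥ 1) which is ultraviolet convergent and infrared convergent, such that M_G > 0, every edge weight satisfies ν_e > 0, every connected component of G contains an external vertex, and some two external vertices lie in the same connected component. Then for pairwise distinct external positions x the integral below converges absolutely and f_G(x) = (Γ(M_G) / ∏_e Γ(λν_e)) · ∫_{(0,∞)^{E−1}} [ (∏_e α_e^{d/2 − λν_e − 1}) · Φ_G(α,x)^{−M_G} · Ψ_G(α)^{−(d/2 − M_G)} ] restricted to α_1 = 1, integrated with respect to dα_2 ⋯ dα_E, where Ψ_G^p(α) = Σ_{F ∈ F_G^p} ∏_{e ∉ F} α_e, Ψ_G = Ψ_G^p for p the partition of V_ext into singletons, and Φ_G(α,x) = Σ_{i<j} ‖x_i − x_j‖²·Ψ_G^{p(i,j)}. -/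
open scoped Classical ENNReal
open MeasureTheory

noncomputable section

/-- A Feynman graph with vertices `Fin nV`, edges `Fin nE` (each edge has two
distinct endpoints, multiple edges allowed), a set of external vertices and
real edge weights. -/
structure FeynmanGraph (nV nE : ℕ) where
  ends : Fin nE → Fin nV × Fin nV
  ends_ne : ∀ e, (ends e).1 ≠ (ends e).2
  ext : Finset (Fin nV)
  ν : Fin nE → ℝ

/-- `λ = d/2 - 1`. -/
def lam (d : ℕ) : ℝ := (d : ℝ) / 2 - 1

namespace FeynmanGraph

variable {nV nE : ℕ} (G : FeynmanGraph nV nE)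

/-- The edge `e` is incident to the vertex `v`. -/
def Incident (e : Fin nE) (v : Fin nV) : Prop :=
  (G.ends e).1 = v ∨ (G.ends e).2 = v

/-- The edge `e` joins the vertices `u` and `v`. -/
def Joins (e : Fin nE) (u v : Fin nV) : Prop :=
  G.ends e = (u, v) ∨ G.ends e = (v, u)

/-- The internal vertices of `G`. -/
def intVerts : Finset (Fin nV) := Finset.univ.filter (fun v => v ∉ G.ext)

/-- The simple graph on the vertices of `G` induced by a subset `F` of the edges. -/
def edgeGraph (F : Finset (Fin nE)) : SimpleGraph (Fin nV) :=
  SimpleGraph.fromRel (fun u v => ∃ e ∈ F, G.Joins e u v)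

/-- `F` is a spanning forest of `G` compatible with the collection `p` of pairwise
disjoint vertex sets: `F` is acyclic (as a set of multigraph edges), the graph
`(V, F)` has exactly `p.card` connected components, and distinct parts of `p` lie in
distinct components.  (Acyclicity together with the component count is expressed by
the edge count `F.card + p.card = nV`.) -/
def IsForest (p : Finset (Finset (Fin nV))) (F : Finset (Fin nE)) : Prop :=
  F.card + p.card = nV ∧
  Nat.card (G.edgeGraph F).ConnectedComponent = p.card ∧
  (∀ P ∈ p, ∀ u ∈ P, ∀ v ∈ P, (G.edgeGraph F).Reachable u v) ∧
  (∀ P ∈ p, ∀ Q ∈ p, P ≠ Q → ∀ u ∈ P, ∀ v ∈ Q, ¬ (G.edgeGraph F).Reachable u v)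

/-- The set `𝓕_G^p` of spanning forests compatible with `p`. -/
def forests (p : Finset (Finset (Fin nV))) : Finset (Finset (Fin nE)) :=
  Finset.univ.filter (fun F => G.IsForest p F)

/-- The dual spanning forest polynomial `Ψ̃_G^p`, evaluated at `α`. -/
def dualForestPoly (p : Finset (Finset (Fin nV))) (α : Fin nE → ℝ) : ℝ :=
  ∑ F ∈ G.forests p, ∏ e ∈ F, α e

/-- The spanning forest polynomial `Ψ_G^p`, evaluated at `α`. -/
def forestPoly (p : Finset (Finset (Fin nV))) (α : Fin nE → ℝ) : ℝ :=
  ∑ F ∈ G.forests p, ∏ e ∈ Finset.univ \ F, α e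

/-- The partition of the external vertices into singletons. -/
def singlePart : Finset (Finset (Fin nV)) := G.ext.image (fun v => {v})

/-- The collection `p(i,j)` consisting of `{i, j}` together with the singletons of the
remaining external vertices. -/
def pairPart (i j : Fin nV) : Finset (Finset (Fin nV)) :=
  insert ({i, j} : Finset (Fin nV)) (((G.ext.erase i).erase j).image (fun v => {v}))

/-- `Ψ̃_G`, evaluated at `α`. -/
def psiTilde (α : Fin nE → ℝ) : ℝ := G.dualForestPoly G.singlePart α

/-- `Φ̃_G(α, x) = Σ_{i<j external} ‖x_i - x_j‖² Ψ̃_G^{p(i,j)}(α)`. -/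
def phiTilde {d : ℕ} (x : Fin nV → EuclideanSpace ℝ (Fin d)) (α : Fin nE → ℝ) : ℝ :=
  ∑ i ∈ G.ext, ∑ j ∈ G.ext.filter (fun j => i < j),
    ‖x i - x j‖ ^ 2 * G.dualForestPoly (G.pairPart i j) α

/-- Positions of all vertices: external vertices are placed according to `x`,
internal vertices according to `y`. -/
def assemble {E : Type*} (x : Fin nV → E) (y : {v : Fin nV // v ∉ G.ext} → E) :
    Fin nV → E :=
  fun v => if h : v ∉ G.ext then y ⟨v, h⟩ else x v

/-- The position space Feynman integral
`f_G(x) = ∫ ∏_{v internal} d^d x_v/π^{d/2} ∏_e ‖x_{u(e)} - x_{w(e)}‖^{-2λν_e}`,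
a Lebesgue integral of a nonnegative function, with values in `[0,∞]`.  Only the
external components of `x` matter. -/
def posIntegral (d : ℕ) (x : Fin nV → EuclideanSpace ℝ (Fin d)) : ℝ≥0∞ :=
  (∫⁻ y : {v : Fin nV // v ∉ G.ext} → EuclideanSpace ℝ (Fin d),
      ENNReal.ofReal (∏ e,
        ‖G.assemble x y (G.ends e).1 - G.assemble x y (G.ends e).2‖ ^ (-(2 * lam d * G.ν e)))) /
    ENNReal.ofReal (Real.pi ^ ((d : ℝ) / 2 * (G.intVerts.card : ℝ)))

/-- The standard positions of the three external vertices `0`, `1`, `z`. -/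
def extPos (d : ℕ) (v0 v1 vz : Fin nV) (z : ℂ) : Fin nV → EuclideanSpace ℝ (Fin d) :=
  fun v =>
    if v = v0 then 0
    else if v = v1 then WithLp.toLp 2 (fun i : Fin d => if (i : ℕ) = 0 then 1 else 0)
    else if v = vz then
      WithLp.toLp 2 (fun i : Fin d => if (i : ℕ) = 0 then z.re else if (i : ℕ) = 1 then z.im else 0)
    else 0

/-- The graphical function `f_G(z)` of a graph with the three external vertices
`v0`, `v1`, `vz`. -/
def graphicalFn (d : ℕ) (v0 v1 vz : Fin nV) (z : ℂ) : ℝ≥0∞ :=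
  G.posIntegral d (extPos d v0 v1 vz z)

/-- The edges of `G` having both endpoints in `Vg`. -/
def edgesWithin (Vg : Finset (Fin nV)) : Finset (Fin nE) :=
  Finset.univ.filter (fun e => (G.ends e).1 ∈ Vg ∧ (G.ends e).2 ∈ Vg)

/-- Ultraviolet convergence. -/
def UVConvergent (d : ℕ) : Prop :=
  ∀ Vg : Finset (Fin nV), 2 ≤ Vg.card → (Vg ∩ G.ext).card ≤ 1 →
    lam d * ∑ e ∈ G.edgesWithin Vg, G.ν e < (d : ℝ) / 2 * ((Vg.card : ℝ) - 1)

/-- `(Vg, Eg)` is a subgraph of `G`. -/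
def IsSubgraph (Vg : Finset (Fin nV)) (Eg : Finset (Fin nE)) : Prop :=
  ∀ e ∈ Eg, (G.ends e).1 ∈ Vg ∧ (G.ends e).2 ∈ Vg

/-- `v` is a `g`-internal vertex of the subgraph `g = (Vg, Eg)`. -/
def GInternal (Vg : Finset (Fin nV)) (Eg : Finset (Fin nE)) (v : Fin nV) : Prop :=
  v ∉ G.ext ∧ v ∈ Vg ∧ ∀ e, G.Incident e v → e ∈ Eg

/-- The set of `g`-internal vertices of the subgraph `g = (Vg, Eg)`. -/
def gInternalSet (Vg : Finset (Fin nV)) (Eg : Finset (Fin nE)) : Finset (Fin nV) :=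
  Finset.univ.filter (fun v => G.GInternal Vg Eg v)

/-- Infrared convergence. -/
def IRConvergent (d : ℕ) : Prop :=
  ∀ Vg : Finset (Fin nV), ∀ Eg : Finset (Fin nE), G.IsSubgraph Vg Eg →
    0 < (G.gInternalSet Vg Eg).card →
    (∀ e ∈ Eg, G.GInternal Vg Eg (G.ends e).1 ∨ G.GInternal Vg Eg (G.ends e).2) →
    (d : ℝ) / 2 * ((G.gInternalSet Vg Eg).card : ℝ) < lam d * ∑ e ∈ Eg, G.ν e

/-- The superficial degree of divergence `M_G = λ ν_G - (d/2)·V_int`. -/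
def Mdeg (d : ℕ) : ℝ := lam d * ∑ e, G.ν e - (d : ℝ) / 2 * (G.intVerts.card : ℝ)

end FeynmanGraph

/-- The affine chart `α_1 = 1`: the first Schwinger parameter (edge `0`) is set to `1`,
the remaining ones are given by `β`. -/
def chart {m : ℕ} (β : {e : Fin (m + 1) // e ≠ 0} → ℝ) : Fin (m + 1) → ℝ :=
  fun e => if h : e = 0 then 1 else β ⟨e, h⟩


namespace FeynmanGraph

/-- `Ψ_G`, evaluated at `α`. -/
def psiP {nV nE : ℕ} (G : FeynmanGraph nV nE) (α : Fin nE → ℝ) : ℝ :=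
  G.forestPoly G.singlePart α

/-- `Φ_G(α, x) = Σ_{i<j external} ‖x_i - x_j‖² Ψ_G^{p(i,j)}(α)`. -/
def phiP {nV nE d : ℕ} (G : FeynmanGraph nV nE)
    (x : Fin nV → EuclideanSpace ℝ (Fin d)) (α : Fin nE → ℝ) : ℝ :=
  ∑ i ∈ G.ext, ∑ j ∈ G.ext.filter (fun j => i < j),
    ‖x i - x j‖ ^ 2 * G.forestPoly (G.pairPart i j) α

end FeynmanGraph

/-- The integrand of the parametric representation, in the affine chart `α_1 = 1`:
`(∏_e α_e^{d/2 - λν_e - 1}) · Φ_G^{-M_G} · Ψ_G^{-(d/2 - M_G)}`. -/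
def paramIntegrand (d : ℕ) {nV m : ℕ} (G : FeynmanGraph nV (m + 1))
    (x : Fin nV → EuclideanSpace ℝ (Fin d))
    (β : {e : Fin (m + 1) // e ≠ 0} → ℝ) : ℝ :=
  (∏ e, chart β e ^ ((d : ℝ) / 2 - lam d * G.ν e - 1)) *
    (G.phiP x (chart β) ^ (-(G.Mdeg d)) *
      G.psiP (chart β) ^ (-((d : ℝ) / 2 - G.Mdeg d)))

/-- Tonelli for products of functions of the single coordinates, over `Fin n`. -/
theorem lintegral_fin_prod_eq_prod {n : ℕ} {E : Type*} [MeasurableSpace E]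
    (μ : Measure E) [SigmaFinite μ] (f : Fin n → E → ℝ≥0∞) (hf : ∀ i, Measurable (f i)) :
    ∫⁻ x : Fin n → E, ∏ i, f i (x i) ∂(Measure.pi fun _ => μ) = ∏ i, ∫⁻ x, f i x ∂μ := by
  induction n with
  | zero => simp
  | succ n ih =>
    have h := (measurePreserving_piFinSuccAbove (fun _ : Fin (n + 1) => μ) 0).symm
    rw [← h.lintegral_comp_emb (MeasurableEquiv.measurableEmbedding _)]
    simp only [MeasurableEquiv.piFinSuccAbove_symm_apply, Fin.insertNthEquiv,
      Fin.prod_univ_succ, Fin.insertNth_zero, Equiv.coe_fn_mk, Fin.cons_succ, Fin.cons_zero]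
    rw [← ih (fun i => f i.succ) fun i => hf _]
    have hm : Measurable fun x : Fin n → E => ∏ i : Fin n, f i.succ (x i) :=
      Finset.measurable_fun_prod _ fun i _ => (hf i.succ).comp (measurable_pi_apply i)
    exact lintegral_prod_mul (hf 0).aemeasurable hm.aemeasurable

/-- Tonelli for products of functions of the single coordinates. -/
theorem lintegral_pi_prod_eq_prod {ι E : Type*} [Fintype ι] [MeasurableSpace E]
    (μ : Measure E) [SigmaFinite μ] (f : ι → E → ℝ≥0∞) (hf : ∀ i, Measurable (f i)) :
    ∫⁻ x : ι → E, ∏ i, f i (x i) ∂(Measure.pi fun _ => μ) = ∏ i, ∫⁻ x, f i x ∂μ := by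
  let e := (Fintype.equivFin ι).symm
  rw [← (measurePreserving_piCongrLeft (fun _ : ι => μ) e).lintegral_comp_emb
    (MeasurableEquiv.measurableEmbedding _)]
  simp_rw [← e.prod_comp, MeasurableEquiv.coe_piCongrLeft]
  rw [← lintegral_fin_prod_eq_prod μ (fun i => f (e i)) fun i => hf _]
  refine lintegral_congr fun x => Finset.prod_congr rfl fun i _ => ?_
  rw [Equiv.piCongrLeft_apply_apply]

/-- Exchanging the two arguments preserves Lebesgue measure on `ι → κ → ℝ`. -/
theorem volume_preserving_swap_args (ι κ : Type*) [Fintype ι] [Fintype κ] :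
    MeasurePreserving (fun (y : ι → κ → ℝ) (k : κ) (i : ι) => y i k) := by
  have h1 : MeasurePreserving (fun (y : ι → κ → ℝ) (p : ι × κ) => y p.1 p.2) := by
    refine ⟨by fun_prop, Eq.symm (Measure.pi_eq fun s hs => ?_)⟩
    rw [Measure.map_apply (by fun_prop) (MeasurableSet.univ_pi hs)]
    have : (fun (y : ι → κ → ℝ) (p : ι × κ) => y p.1 p.2) ⁻¹' Set.univ.pi s =
        Set.univ.pi fun i => Set.univ.pi fun k => s (i, k) := by
      ext y; simp
    rw [this, volume_pi_pi]
    simp_rw [volume_pi_pi]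
    rw [Fintype.prod_prod_type]
  have h2 : MeasurePreserving (fun (y : κ → ι → ℝ) (p : ι × κ) => y p.2 p.1) := by
    refine ⟨by fun_prop, Eq.symm (Measure.pi_eq fun s hs => ?_)⟩
    rw [Measure.map_apply (by fun_prop) (MeasurableSet.univ_pi hs)]
    have : (fun (y : κ → ι → ℝ) (p : ι × κ) => y p.2 p.1) ⁻¹' Set.univ.pi s =
        Set.univ.pi fun k => Set.univ.pi fun i => s (i, k) := by
      ext y
      simp only [Set.mem_preimage, Set.mem_univ_pi, Prod.forall]
      exact forall_comm
    rw [this, volume_pi_pi]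
    simp_rw [volume_pi_pi]
    rw [Fintype.prod_prod_type_right]
  let e : (κ → ι → ℝ) ≃ᵐ (ι × κ → ℝ) :=
    { toFun := fun y p => y p.2 p.1
      invFun := fun z k i => z (i, k)
      left_inv := fun _ => rfl
      right_inv := fun _ => rfl
      measurable_toFun := by
        simp only [Equiv.coe_fn_mk]; fun_prop
      measurable_invFun := by
        simp only [Equiv.coe_fn_symm_mk]; fun_prop }
  have h2' : MeasurePreserving e := h2
  exact h2'.symm.comp h1

/-- Separation of coordinates: a product of functions of the coordinate families of a finite
family of Euclidean vectors integrates to the product of the integrals. -/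
theorem lintegral_euclidean_pi_prod {ι : Type*} [Fintype ι] {d : ℕ}
    (g : Fin d → (ι → ℝ) → ℝ≥0∞) (hg : ∀ c, Measurable (g c)) :
    ∫⁻ y : ι → EuclideanSpace ℝ (Fin d), ∏ c, g c (fun i => y i c) =
      ∏ c, ∫⁻ z : ι → ℝ, g c z := by
  have h1 : MeasurePreserving (fun (y : ι → EuclideanSpace ℝ (Fin d)) (i : ι) =>
      (MeasurableEquiv.toLp 2 (Fin d → ℝ)).symm (y i)) :=
    volume_preserving_pi fun _ =>
      EuclideanSpace.volume_preserving_symm_measurableEquiv_toLp (Fin d)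
  have h2 := (volume_preserving_swap_args ι (Fin d)).comp h1
  have hm : Measurable fun z : Fin d → ι → ℝ => ∏ c, g c (z c) :=
    Finset.measurable_fun_prod _ fun c _ => (hg c).comp (measurable_pi_apply c)
  have h3 := h2.lintegral_comp hm
  rw [← lintegral_pi_prod_eq_prod (volume : Measure (ι → ℝ)) g hg]
  exact h3

theorem lintegral_exp_neg_sum_sq (ι : Type*) [Fintype ι] :
    ∫⁻ y : ι → ℝ, ENNReal.ofReal (Real.exp (-∑ i, y i ^ 2)) =
      ENNReal.ofReal (Real.pi ^ ((Fintype.card ι : ℝ) / 2)) := by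
  have h1 : ∫⁻ t : ℝ, ENNReal.ofReal (Real.exp (-t ^ 2)) = ENNReal.ofReal (√Real.pi) := by
    have hi : Integrable fun t : ℝ => Real.exp (-t ^ 2) := by
      simpa using integrable_exp_neg_mul_sq (b := 1) one_pos
    rw [← ofReal_integral_eq_lintegral_ofReal hi (ae_of_all _ fun _ => (Real.exp_pos _).le)]
    congr 1
    simpa using integral_gaussian 1
  have h2 := lintegral_pi_prod_eq_prod (ι := ι) (volume : Measure ℝ)
    (fun _ t => ENNReal.ofReal (Real.exp (-t ^ 2))) fun _ => by fun_prop
  simp only [h1, Finset.prod_const, Finset.card_univ] at h2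
  rw [← ENNReal.ofReal_pow (Real.sqrt_nonneg _)] at h2
  rw [Real.sqrt_eq_rpow, ← Real.rpow_natCast, ← Real.rpow_mul Real.pi_pos.le] at h2
  rw [show (Fintype.card ι : ℝ) / 2 = 1 / 2 * (Fintype.card ι : ℝ) by ring, ← h2]
  refine lintegral_congr fun y => ?_
  rw [← ENNReal.ofReal_prod_of_nonneg fun _ _ => (Real.exp_pos _).le, ← Real.exp_sum,
    Finset.sum_neg_distrib]

open scoped MatrixOrder in
/-- The Gaussian integral of a positive definite quadratic form. -/
theorem lintegral_exp_neg_posDef {ι : Type*} [Fintype ι] [DecidableEq ι] {L : Matrix ι ι ℝ}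
    (hL : L.PosDef) :
    ∫⁻ y : ι → ℝ, ENNReal.ofReal (Real.exp (-(y ⬝ᵥ L.mulVec y))) =
      ENNReal.ofReal (Real.pi ^ ((Fintype.card ι : ℝ) / 2) * L.det ^ (-(1 / 2) : ℝ)) := by
  obtain ⟨B, hB⟩ : ∃ B : Matrix ι ι ℝ, L = B.conjTranspose * B :=
    CStarAlgebra.nonneg_iff_eq_star_mul_self.mp hL.posSemidef.nonneg
  have hdet : L.det = B.det ^ 2 := by rw [hB, Matrix.det_mul]; simp [sq]
  have hBdet : B.det ≠ 0 := by
    intro h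
    have := hL.det_pos
    rw [hdet, h] at this
    simp at this
  have hmap := Real.map_matrix_volume_pi_eq_smul_volume_pi hBdet
  have hf : Measurable fun y : ι → ℝ => ENNReal.ofReal (Real.exp (-∑ i, y i ^ 2)) := by fun_prop
  have h1 := lintegral_map (μ := volume) hf
    (Matrix.toLin' B).continuous_of_finiteDimensional.measurable
  rw [hmap, lintegral_smul_measure, lintegral_exp_neg_sum_sq] at h1
  have h2 : ∀ y : ι → ℝ, ∑ i, (Matrix.toLin' B y) i ^ 2 = y ⬝ᵥ L.mulVec y := by
    intro y
    rw [hB, ← Matrix.mulVec_mulVec, Matrix.dotProduct_mulVec,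
      Matrix.conjTranspose_eq_transpose_of_trivial, Matrix.vecMul_transpose, Matrix.toLin'_apply]
    simp [dotProduct, sq]
  simp only [h2] at h1
  rw [← h1, smul_eq_mul, ← ENNReal.ofReal_mul (abs_nonneg _), mul_comm, hdet]
  congr 2
  rw [← sq_abs, ← Real.rpow_natCast, ← Real.rpow_mul (abs_nonneg _), abs_inv,
    ← Real.rpow_neg_one]
  norm_num

/-- The Gaussian integral of an inhomogeneous positive definite quadratic polynomial. -/
theorem lintegral_exp_neg_quadratic {ι : Type*} [Fintype ι] [DecidableEq ι]
    {L : Matrix ι ι ℝ} (hL : L.PosDef)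
    (v : ι → ℝ) (q : ℝ) :
    ∫⁻ y : ι → ℝ, ENNReal.ofReal (Real.exp (-(y ⬝ᵥ L.mulVec y + 2 * (v ⬝ᵥ y) + q))) =
      ENNReal.ofReal (Real.pi ^ ((Fintype.card ι : ℝ) / 2) * L.det ^ (-(1 / 2) : ℝ) *
        Real.exp (-(q - v ⬝ᵥ L⁻¹.mulVec v))) := by
  set y₀ := L⁻¹.mulVec v with hy₀
  have hu : IsUnit L.det := hL.det_pos.ne'.isUnit
  have hLy : L.mulVec y₀ = v := by
    rw [hy₀, Matrix.mulVec_mulVec, Matrix.mul_nonsing_inv _ hu, Matrix.one_mulVec]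
  have hsymm : ∀ y : ι → ℝ, y₀ ⬝ᵥ L.mulVec y = v ⬝ᵥ y := by
    intro y
    have ht : L.transpose = L := by
      have := hL.isHermitian.eq
      rwa [Matrix.conjTranspose_eq_transpose_of_trivial] at this
    rw [Matrix.dotProduct_mulVec, ← Matrix.mulVec_transpose, ht, hLy]
  have key : ∀ y : ι → ℝ, y ⬝ᵥ L.mulVec y + 2 * (v ⬝ᵥ y) + q =
      (y + y₀) ⬝ᵥ L.mulVec (y + y₀) + (q - v ⬝ᵥ y₀) := by
    intro y
    rw [Matrix.mulVec_add, hLy, dotProduct_add, add_dotProduct, add_dotProduct, hsymm,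
      dotProduct_comm y v, dotProduct_comm y₀ v]
    ring
  simp_rw [key, neg_add, Real.exp_add, ENNReal.ofReal_mul (Real.exp_pos _).le]
  rw [lintegral_mul_const' _ _ ENNReal.ofReal_ne_top,
    lintegral_add_right_eq_self (fun y => ENNReal.ofReal (Real.exp (-(y ⬝ᵥ L.mulVec y)))) y₀,
    lintegral_exp_neg_posDef hL, ← ENNReal.ofReal_mul
      (mul_nonneg (by positivity) (Real.rpow_nonneg hL.det_pos.le _))]

theorem lintegral_Ioi_comp_inv (g : ℝ → ℝ≥0∞) :
    ∫⁻ t in Set.Ioi (0 : ℝ), g t = ∫⁻ t in Set.Ioi (0 : ℝ), ENNReal.ofReal (t ^ 2)⁻¹ * g t⁻¹ := by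
  have himg : (fun t : ℝ => t⁻¹) '' Set.Ioi 0 = Set.Ioi 0 := by
    ext t
    simp only [Set.mem_image, Set.mem_Ioi]
    exact ⟨by rintro ⟨u, hu, rfl⟩; positivity, fun h => ⟨t⁻¹, by positivity, inv_inv t⟩⟩
  have h := lintegral_image_eq_lintegral_abs_deriv_mul (f := fun t : ℝ => t⁻¹)
    (f' := fun t => -(t ^ 2)⁻¹) (s := Set.Ioi 0) measurableSet_Ioi
    (fun t ht => (hasDerivAt_inv (ne_of_gt ht)).hasDerivWithinAt)
    (fun a _ b _ hab => inv_injective hab) g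
  rw [himg] at h
  rw [h]
  refine setLIntegral_congr_fun measurableSet_Ioi fun t ht => ?_
  simp only [abs_neg]
  rw [abs_of_nonneg (by positivity)]

/-- The inverse Schwinger parametrization of a power. -/
theorem lintegral_rpow_mul_exp_neg_div {s a : ℝ} (hs : 0 < s) (ha : 0 < a) :
    ∫⁻ t in Set.Ioi (0 : ℝ), ENNReal.ofReal (t ^ (-s - 1) * Real.exp (-(a / t))) =
      ENNReal.ofReal (Real.Gamma s * a ^ (-s)) := by
  rw [lintegral_Ioi_comp_inv]
  have h1 : ∀ t ∈ Set.Ioi (0 : ℝ), ENNReal.ofReal (t ^ 2)⁻¹ *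
      ENNReal.ofReal (t⁻¹ ^ (-s - 1) * Real.exp (-(a / t⁻¹))) =
      ENNReal.ofReal (t ^ (s - 1) * Real.exp (-(a * t))) := by
    intro t ht
    have ht : 0 < t := ht
    rw [← ENNReal.ofReal_mul (by positivity), div_inv_eq_mul, ← mul_assoc]
    congr 2
    rw [Real.inv_rpow ht.le, ← Real.rpow_neg ht.le, ← Real.rpow_natCast, ← Real.rpow_neg ht.le,
      ← Real.rpow_add ht]
    congr 1
    push_cast
    ring
  rw [setLIntegral_congr_fun measurableSet_Ioi h1]
  have hInt : IntegrableOn (fun t : ℝ => t ^ (s - 1) * Real.exp (-(a * t))) (Set.Ioi 0) := by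
    have := integrableOn_rpow_mul_exp_neg_mul_rpow (s := s - 1) (p := 1) (b := a)
      (by linarith) one_pos ha
    simpa [neg_mul] using this
  rw [← ofReal_integral_eq_lintegral_ofReal hInt
    ((ae_restrict_iff' measurableSet_Ioi).2 (ae_of_all _ fun t (ht : 0 < t) => by positivity)),
    Real.integral_rpow_mul_exp_neg_mul_Ioi hs ha, one_div, Real.inv_rpow ha.le,
    ← Real.rpow_neg ha.le, mul_comm]

theorem lintegral_inv_mul_exp_neg_abs_log_lt_top {ε : ℝ} (hε : 0 < ε) :
    ∫⁻ t in Set.Ioi (0 : ℝ), ENNReal.ofReal (t⁻¹ * Real.exp (-(ε * |Real.log t|))) < ∞ := by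
  rw [← Set.Ioc_union_Ioi_eq_Ioi (zero_le_one (α := ℝ))]
  refine (lintegral_union_le _ _ _).trans_lt (ENNReal.add_lt_top.2 ⟨?_, ?_⟩)
  · have h : IntegrableOn (fun t : ℝ => t ^ (ε - 1)) (Set.Ioc 0 1) :=
      (intervalIntegrable_iff_integrableOn_Ioc_of_le zero_le_one).1
        (intervalIntegral.intervalIntegrable_rpow' (by linarith))
    refine lt_of_le_of_lt (setLIntegral_mono_ae (by fun_prop) (ae_of_all _ fun t ht => ?_))
      h.lintegral_lt_top
    refine ENNReal.ofReal_le_ofReal (le_of_eq ?_)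
    rw [abs_of_nonpos (Real.log_nonpos ht.1.le ht.2), Real.rpow_def_of_pos ht.1,
      ← Real.exp_log (inv_pos.2 ht.1), Real.log_inv, ← Real.exp_add]
    ring_nf
  · have h : IntegrableOn (fun t : ℝ => t ^ (-ε - 1)) (Set.Ioi 1) :=
      integrableOn_Ioi_rpow_of_lt (by linarith) one_pos
    refine lt_of_le_of_lt (setLIntegral_mono_ae (by fun_prop) (ae_of_all _ fun t ht => ?_))
      h.lintegral_lt_top
    have ht1 : 1 < t := ht
    have ht0 : 0 < t := by linarith
    refine ENNReal.ofReal_le_ofReal (le_of_eq ?_)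
    rw [abs_of_nonneg (Real.log_nonneg ht1.le), Real.rpow_def_of_pos ht0,
      ← Real.exp_log (inv_pos.2 ht0), Real.log_inv, ← Real.exp_add]
    ring_nf

theorem measurable_chart {m : ℕ} : Measurable (chart (m := m)) := by
  refine measurable_pi_lambda _ fun e => ?_
  unfold chart
  by_cases h : e = 0
  · simp [h]
  · simp only [h, dite_false]; fun_prop

/-- Splitting off the coordinate `0` preserves Lebesgue measure. -/
theorem volume_preserving_cons_zero (m : ℕ) :
    MeasurePreserving (fun (p : ℝ × ({e : Fin (m + 1) // e ≠ 0} → ℝ)) (e : Fin (m + 1)) =>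
      if h : e = 0 then p.1 else p.2 ⟨e, h⟩) := by
  have hmeas : Measurable (fun (p : ℝ × ({e : Fin (m + 1) // e ≠ 0} → ℝ)) (e : Fin (m + 1)) =>
      if h : e = 0 then p.1 else p.2 ⟨e, h⟩) := by
    refine measurable_pi_lambda _ fun e => ?_
    by_cases h : e = 0
    · simp only [h, dite_true]; fun_prop
    · simp only [h, dite_false]; fun_prop
  refine ⟨hmeas, Eq.symm (Measure.pi_eq fun s hs => ?_)⟩
  rw [Measure.map_apply hmeas (MeasurableSet.univ_pi hs)]
  have : (fun (p : ℝ × ({e : Fin (m + 1) // e ≠ 0} → ℝ)) (e : Fin (m + 1)) =>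
      if h : e = 0 then p.1 else p.2 ⟨e, h⟩) ⁻¹' Set.univ.pi s =
      s 0 ×ˢ Set.univ.pi fun e : {e : Fin (m + 1) // e ≠ 0} => s e := by
    ext p
    simp only [Set.mem_preimage, Set.mem_univ_pi, Set.mem_prod, Subtype.forall]
    refine ⟨fun h => ⟨by simpa using h 0, fun e he => by simpa [he] using h e⟩, fun h e => ?_⟩
    by_cases he : e = 0
    · subst he; simpa using h.1
    · simpa [he] using h.2 e he
  rw [this, Measure.volume_eq_prod, Measure.prod_prod, volume_pi_pi,
    Fintype.prod_eq_mul_prod_subtype_ne (fun e => volume (s e)) 0]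

/-- Integration over the positive orthant in the affine chart `α_0 = 1`. -/
theorem setLIntegral_pos_eq_chart {m : ℕ} (H : (Fin (m + 1) → ℝ) → ℝ≥0∞) (hH : Measurable H) :
    ∫⁻ α in {α : Fin (m + 1) → ℝ | ∀ e, 0 < α e}, H α =
      ∫⁻ β in {β : {e : Fin (m + 1) // e ≠ 0} → ℝ | ∀ e, 0 < β e},
        ∫⁻ t in Set.Ioi (0 : ℝ), ENNReal.ofReal (t ^ m) * H (t • chart β) := by
  have hpos : ∀ {ι : Type} [Countable ι], MeasurableSet {α : ι → ℝ | ∀ e, 0 < α e} := by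
    intro ι _
    rw [Set.ofPred_forall]
    exact MeasurableSet.iInter fun e => measurableSet_lt measurable_const (measurable_pi_apply e)
  set S := {α : Fin (m + 1) → ℝ | ∀ e, 0 < α e} with hS
  set S' := {β : {e : Fin (m + 1) // e ≠ 0} → ℝ | ∀ e, 0 < β e} with hS'
  have hSm : MeasurableSet S := hpos
  have hSm' : MeasurableSet S' := hpos
  have hHS : Measurable (S.indicator H) := hH.indicator hSm
  rw [← lintegral_indicator hSm, ← (volume_preserving_cons_zero m).lintegral_comp hHS,
    Measure.volume_eq_prod]
  have hHc : Measurable fun p : ℝ × ({e : Fin (m + 1) // e ≠ 0} → ℝ) =>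
      S.indicator H fun e => if h : e = 0 then p.1 else p.2 ⟨e, h⟩ :=
    hHS.comp (volume_preserving_cons_zero m).measurable
  rw [lintegral_prod _ hHc.aemeasurable]
  have hjoint : Measurable fun p : ({e : Fin (m + 1) // e ≠ 0} → ℝ) × ℝ =>
      ENNReal.ofReal (p.2 ^ m) * H (p.2 • chart p.1) := by
    have : Measurable fun p : ({e : Fin (m + 1) // e ≠ 0} → ℝ) × ℝ => p.2 • chart p.1 :=
      measurable_snd.smul (measurable_chart.comp measurable_fst)
    exact (by fun_prop : Measurable fun p : ({e : Fin (m + 1) // e ≠ 0} → ℝ) × ℝ =>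
      ENNReal.ofReal (p.2 ^ m)).mul (hH.comp this)
  have hswap := lintegral_lintegral_swap (μ := volume.restrict S')
    (ν := volume.restrict (Set.Ioi (0 : ℝ)))
    (f := fun β t => ENNReal.ofReal (t ^ m) * H (t • chart β)) hjoint.aemeasurable
  rw [hswap, ← lintegral_indicator measurableSet_Ioi]
  refine lintegral_congr fun t => ?_
  by_cases ht : 0 < t
  swap
  · rw [Set.indicator_of_notMem (by simpa using ht)]
    refine (lintegral_congr fun γ => ?_).trans lintegral_zero
    rw [Set.indicator_of_notMem]
    intro h
    exact ht (by simpa using h 0)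
  rw [Set.indicator_of_mem (by simpa using ht), lintegral_const_mul _ (by
    exact hH.comp (measurable_chart.const_smul t)), ← lintegral_indicator hSm']
  set g : ({e : Fin (m + 1) // e ≠ 0} → ℝ) → ℝ≥0∞ := fun γ =>
    S.indicator H (fun e => if h : e = 0 then t else γ ⟨e, h⟩) with hg
  have hgm : Measurable g :=
    hHS.comp ((volume_preserving_cons_zero m).measurable.comp measurable_prodMk_left)
  have hcomp : ∀ β, S'.indicator (fun β => H (t • chart β)) β = g (t • β) := by
    intro β
    have h1 : (fun e => if h : e = 0 then t else (t • β) ⟨e, h⟩) = t • chart β := by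
      funext e
      by_cases he : e = 0 <;> simp [chart, he]
    have h2 : t • chart β ∈ S ↔ β ∈ S' := by
      simp only [hS, hS', Set.mem_ofPred_eq, Pi.smul_apply, smul_eq_mul, mul_pos_iff_of_pos_left ht]
      refine ⟨fun h e => by simpa [chart, e.2] using h e, fun h e => ?_⟩
      by_cases he : e = 0
      · simp [chart, he]
      · simpa [chart, he] using h ⟨e, he⟩
    simp only [hg, h1]
    by_cases hβ : β ∈ S'
    · rw [Set.indicator_of_mem hβ, Set.indicator_of_mem (h2.2 hβ)]
    · rw [Set.indicator_of_notMem hβ, Set.indicator_of_notMem (mt h2.1 hβ)]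
  simp_rw [hcomp]
  have hmap := Measure.map_addHaar_smul
    (volume : Measure ({e : Fin (m + 1) // e ≠ 0} → ℝ)) ht.ne'
  have hfin : Module.finrank ℝ ({e : Fin (m + 1) // e ≠ 0} → ℝ) = m := by
    simp
  rw [← lintegral_map hgm (measurable_const_smul t), hmap, lintegral_smul_measure, hfin,
    smul_eq_mul, ← mul_assoc, ← ENNReal.ofReal_mul (by positivity), abs_of_pos (by positivity),
    mul_inv_cancel₀ (by positivity), ENNReal.ofReal_one, one_mul]

/-- The weighted Gram matrix `∑_e α_e c_e c_eᵀ` of a finite family of vectors. -/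
def gramMatrix {ε κ : Type*} [Fintype ε] (c : ε → κ → ℝ) (α : ε → ℝ) : Matrix κ κ ℝ :=
  Matrix.of fun i j => ∑ e, α e * (c e i * c e j)

section Gram

variable {ε κ : Type*} [Fintype ε] [Fintype κ] [DecidableEq κ]

theorem det_gramMatrix_eq_sum_fun (c : ε → κ → ℝ) (α : ε → ℝ) :
    (gramMatrix c α).det =
      ∑ φ : κ → ε, (∏ i, α (φ i)) * ((∏ i, c (φ i) i) * (Matrix.of fun i => c (φ i)).det) := by
  have h : gramMatrix c α = fun i => ∑ e, (α e * c e i) • c e := by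
    ext i j
    simp [gramMatrix, Finset.sum_apply, mul_assoc]
  have h2 := (Matrix.detRowAlternating (n := κ) (R := ℝ)).toMultilinearMap.map_sum
    (fun (i : κ) (e : ε) => (α e * c e i) • c e)
  have h3 : (gramMatrix c α).det =
      ∑ φ : κ → ε, (Matrix.of fun i => (α (φ i) * c (φ i) i) • c (φ i)).det := by
    rw [h]; exact h2
  rw [h3]
  refine Finset.sum_congr rfl fun φ _ => ?_
  have h4 := (Matrix.detRowAlternating (n := κ) (R := ℝ)).toMultilinearMap.map_smul_univ
    (fun i => α (φ i) * c (φ i) i) (fun i => c (φ i))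
  refine Eq.trans h4 ?_
  rw [Finset.prod_mul_distrib, smul_eq_mul, mul_assoc]
  rfl

/-- A form of the Cauchy–Binet formula. -/
theorem det_gramMatrix [DecidableEq ε] (c : ε → κ → ℝ) (α : ε → ℝ) :
    (gramMatrix c α).det = ∑ F ∈ Finset.powersetCard (Fintype.card κ) (Finset.univ : Finset ε),
      (∏ e ∈ F, α e) * (gramMatrix c fun e => if e ∈ F then 1 else 0).det := by
  simp_rw [det_gramMatrix_eq_sum_fun, Finset.mul_sum]
  rw [Finset.sum_comm]
  refine Finset.sum_congr rfl fun φ _ => ?_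
  by_cases hφ : Function.Injective φ
  · rw [Finset.sum_eq_single (Finset.univ.image φ)]
    · rw [Finset.prod_image fun _ _ _ _ h => hφ h]
      simp
    · intro F hF hne
      have : ∃ i, φ i ∉ F := by
        by_contra! hall
        apply hne
        symm
        refine Finset.eq_of_subset_of_card_le (fun e he => ?_) ?_
        · obtain ⟨i, -, rfl⟩ := Finset.mem_image.1 he
          exact hall i
        · rw [Finset.card_image_of_injective _ hφ, (Finset.mem_powersetCard.1 hF).2,
            Finset.card_univ]
      obtain ⟨i, hi⟩ := this
      rw [Finset.prod_eq_zero (Finset.mem_univ i) (if_neg hi)]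
      ring
    · intro h
      exfalso
      apply h
      rw [Finset.mem_powersetCard, Finset.card_image_of_injective _ hφ]
      exact ⟨Finset.subset_univ _, Finset.card_univ⟩
  · have hz : (Matrix.of fun i => c (φ i)).det = 0 := by
      simp only [Function.Injective, not_forall] at hφ
      obtain ⟨i, j, hij, hne⟩ := hφ
      exact Matrix.det_zero_of_row_eq hne (by funext k; show c (φ i) k = c (φ j) k; rw [hij])
    simp [hz]

theorem det_gramMatrix_indicator [DecidableEq ε] (c : ε → κ → ℝ) {F : Finset ε} (g : κ ≃ F) :
    (gramMatrix c fun e => if e ∈ F then 1 else 0).det =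
      (Matrix.of fun i => c (g i)).det ^ 2 := by
  have h : gramMatrix c (fun e => if e ∈ F then 1 else 0) =
      (Matrix.of fun i => c (g i)).transpose * Matrix.of fun i => c (g i) := by
    ext i j
    simp only [gramMatrix, Matrix.of_apply, Matrix.mul_apply, Matrix.transpose_apply]
    rw [g.sum_comp (fun e : F => c e i * c e j), Finset.sum_coe_sort F (fun e => c e i * c e j)]
    simp [Finset.sum_ite_mem]
  rw [h, Matrix.det_mul, Matrix.det_transpose, sq]

end Gram

namespace FeynmanGraph

variable {nV nE : ℕ} (G : FeynmanGraph nV nE)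

/-- Every vertex is connected to `W` by the edges in `F`. -/
def Spans (W : Finset (Fin nV)) (F : Finset (Fin nE)) : Prop :=
  ∀ v, ∃ w ∈ W, (G.edgeGraph F).Reachable v w

variable {G}

theorem reachable_ends {F : Finset (Fin nE)} {e : Fin nE} (he : e ∈ F) :
    (G.edgeGraph F).Reachable (G.ends e).1 (G.ends e).2 := by
  refine SimpleGraph.Adj.reachable ?_
  rw [edgeGraph, SimpleGraph.fromRel_adj]
  exact ⟨G.ends_ne e, Or.inl ⟨e, he, Or.inl rfl⟩⟩

/-- A relation that is reflexive and transitive and relates adjacent vertices relates all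
vertices that are reachable from each other. -/
theorem rel_of_reachable {F : Finset (Fin nE)} {r : Fin nV → Fin nV → Prop}
    (hrefl : ∀ v, r v v) (htrans : ∀ u v w, r u v → r v w → r u w)
    (h : ∀ e ∈ F, r (G.ends e).1 (G.ends e).2 ∧ r (G.ends e).2 (G.ends e).1) {u v : Fin nV}
    (huv : (G.edgeGraph F).Reachable u v) : r u v := by
  obtain ⟨p⟩ := huv
  induction p with
  | nil => exact hrefl _
  | cons hadj _ ih =>
    refine htrans _ _ _ ?_ ih
    rw [edgeGraph, SimpleGraph.fromRel_adj] at hadj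
    rcases hadj.2 with ⟨e, he, hj | hj⟩ | ⟨e, he, hj | hj⟩ <;> have h' := h e he <;>
      rw [hj] at h'
    exacts [h'.1, h'.2, h'.2, h'.1]

theorem eq_of_reachable {K : Type*} {F : Finset (Fin nE)} {f : Fin nV → K}
    (h : ∀ e ∈ F, f (G.ends e).1 = f (G.ends e).2) {u v : Fin nV}
    (huv : (G.edgeGraph F).Reachable u v) : f u = f v :=
  rel_of_reachable (r := fun u v => f u = f v) (fun _ => rfl) (fun _ _ _ => Eq.trans)
    (fun e he => ⟨h e he, (h e he).symm⟩) huv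

theorem Spans.eq_zero {K : Type*} [Zero K] {W : Finset (Fin nV)} {F : Finset (Fin nE)}
    (hs : G.Spans W F) {f : Fin nV → K} (hf : ∀ e ∈ F, f (G.ends e).1 = f (G.ends e).2)
    (hW : ∀ w ∈ W, f w = 0) : f = 0 := by
  funext v
  obtain ⟨w, hw, hr⟩ := hs v
  rw [eq_of_reachable hf hr, hW w hw, Pi.zero_apply]

theorem Spans.le_card_add_card {W : Finset (Fin nV)} {F : Finset (Fin nE)}
    (hs : G.Spans W F) : nV ≤ W.card + F.card := by
  let T : (Fin nV → ℝ) →ₗ[ℝ] (W → ℝ) × (F → ℝ) :=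
    { toFun := fun f => (fun w => f w, fun e => f (G.ends e).1 - f (G.ends e).2)
      map_add' := fun f g => by
        ext <;> simp
        ring
      map_smul' := fun a f => by
        ext <;> simp
        ring }
  have hT : Function.Injective T := by
    rw [← LinearMap.ker_eq_bot, LinearMap.ker_eq_bot']
    intro f hf
    have h1 := congrArg Prod.fst hf
    have h2 := congrArg Prod.snd hf
    refine hs.eq_zero (fun e he => ?_) fun w hw => ?_
    · exact sub_eq_zero.1 (congrFun h2 ⟨e, he⟩)
    · exact congrFun h1 ⟨w, hw⟩
  have := LinearMap.finrank_le_finrank_of_injective hT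
  simpa using this

theorem le_card_component_add_card (F : Finset (Fin nE)) :
    nV ≤ Nat.card (G.edgeGraph F).ConnectedComponent + F.card := by
  have hs : G.Spans (Finset.univ.image fun c : (G.edgeGraph F).ConnectedComponent => c.out) F := by
    intro v
    refine ⟨_, Finset.mem_image_of_mem _ (Finset.mem_univ
      ((G.edgeGraph F).connectedComponentMk v)), ?_⟩
    rw [← SimpleGraph.ConnectedComponent.eq]
    exact (Quot.out_eq _).symm
  refine hs.le_card_add_card.trans (Nat.add_le_add_right ?_ _)
  rw [Nat.card_eq_fintype_card]
  exact Finset.card_image_le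

theorem isForest_iff {p : Finset (Finset (Fin nV))} (hp : ∀ P ∈ p, P.Nonempty)
    {F : Finset (Fin nE)} : G.IsForest p F ↔ F.card + p.card = nV ∧
      (∀ P ∈ p, ∀ u ∈ P, ∀ v ∈ P, (G.edgeGraph F).Reachable u v) ∧
      ∀ v, ∃ P ∈ p, ∃ u ∈ P, (G.edgeGraph F).Reachable v u := by
  choose r hr using hp
  let φ : p → (G.edgeGraph F).ConnectedComponent :=
    fun P => (G.edgeGraph F).connectedComponentMk (r P P.2)
  constructor
  · rintro ⟨h1, h2, h3, h4⟩
    refine ⟨h1, h3, fun v => ?_⟩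
    have hinj : Function.Injective φ := by
      intro P Q hPQ
      by_contra hne
      exact h4 P P.2 Q Q.2 (fun h => hne (Subtype.ext h)) _ (hr P P.2) _ (hr Q Q.2)
        (SimpleGraph.ConnectedComponent.eq.1 hPQ)
    have hbij : Function.Bijective φ := by
      rw [Fintype.bijective_iff_injective_and_card]
      refine ⟨hinj, ?_⟩
      rw [← Nat.card_eq_fintype_card (α := SimpleGraph.ConnectedComponent _), h2]
      simp
    obtain ⟨P, hP⟩ := hbij.2 ((G.edgeGraph F).connectedComponentMk v)
    exact ⟨P, P.2, r P P.2, hr P P.2, SimpleGraph.ConnectedComponent.eq.1 hP.symm⟩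
  · rintro ⟨h1, h2, h3⟩
    have hsurj : Function.Surjective φ := by
      intro c
      induction c using SimpleGraph.ConnectedComponent.ind with
      | h v =>
        obtain ⟨P, hP, u, hu, hvu⟩ := h3 v
        refine ⟨⟨P, hP⟩, SimpleGraph.ConnectedComponent.eq.2 ?_⟩
        exact (hvu.trans (h2 P hP u hu _ (hr P hP))).symm
    have hle : Nat.card (G.edgeGraph F).ConnectedComponent ≤ p.card := by
      rw [Nat.card_eq_fintype_card]
      simpa using Fintype.card_le_of_surjective φ hsurj
    have hge := G.le_card_component_add_card F
    have hcard : Nat.card (G.edgeGraph F).ConnectedComponent = p.card := by omega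
    refine ⟨h1, hcard, h2, fun P hP Q hQ hPQ u hu v hv huv => hPQ ?_⟩
    have hbij : Function.Bijective φ := by
      rw [Fintype.bijective_iff_surjective_and_card]
      refine ⟨hsurj, ?_⟩
      rw [← Nat.card_eq_fintype_card (α := SimpleGraph.ConnectedComponent _), hcard]
      simp
    have := @hbij.1 ⟨P, hP⟩ ⟨Q, hQ⟩ (SimpleGraph.ConnectedComponent.eq.2
      (((h2 P hP _ (hr P hP) u hu).trans huv).trans (h2 Q hQ v hv _ (hr Q hQ))))
    exact congrArg Subtype.val this

theorem isForest_singlePart_iff {F : Finset (Fin nE)} :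
    G.IsForest G.singlePart F ↔ F.card + G.ext.card = nV ∧ G.Spans G.ext F := by
  have hc : G.singlePart.card = G.ext.card :=
    Finset.card_image_of_injective _ Finset.singleton_injective
  rw [isForest_iff (by simp [singlePart]), hc]
  simp [singlePart, Spans]

theorem card_pairPart {i j : Fin nV} (hi : i ∈ G.ext) (hj : j ∈ G.ext) (hij : i ≠ j) :
    (G.pairPart i j).card + 1 = G.ext.card := by
  rw [pairPart, Finset.card_insert_of_notMem,
    Finset.card_image_of_injective _ Finset.singleton_injective,
    Finset.card_erase_of_mem (Finset.mem_erase.2 ⟨hij.symm, hj⟩), Finset.card_erase_of_mem hi]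
  · have : ({i, j} : Finset (Fin nV)).card ≤ G.ext.card :=
      Finset.card_le_card (by simp [Finset.insert_subset_iff, hi, hj])
    rw [Finset.card_pair hij] at this
    omega
  · intro h
    obtain ⟨v, -, hv⟩ := Finset.mem_image.1 h
    have := congrArg Finset.card hv
    rw [Finset.card_singleton, Finset.card_pair hij] at this
    omega

theorem isForest_pairPart_iff {i j : Fin nV} (hi : i ∈ G.ext) (hj : j ∈ G.ext) (hij : i ≠ j)
    {F : Finset (Fin nE)} : G.IsForest (G.pairPart i j) F ↔ F.card + G.ext.card = nV + 1 ∧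
      (G.edgeGraph F).Reachable i j ∧ G.Spans G.ext F := by
  have hc := G.card_pairPart hi hj hij
  have hne : ∀ P ∈ G.pairPart i j, P.Nonempty := by
    intro P hP
    simp only [pairPart, Finset.mem_insert, Finset.mem_image] at hP
    rcases hP with rfl | ⟨v, -, rfl⟩ <;> simp
  rw [isForest_iff hne]
  refine and_congr (by omega) (and_congr ?_ (forall_congr' fun v => ?_))
  · rw [pairPart, Finset.forall_mem_insert]
    constructor
    · intro h
      exact h.1 i (by simp) j (by simp)
    · intro h
      refine ⟨?_, ?_⟩
      · intro u hu v hv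
        simp only [Finset.mem_insert, Finset.mem_singleton] at hu hv
        rcases hu with rfl | rfl <;> rcases hv with rfl | rfl
        exacts [SimpleGraph.Reachable.refl _, h, h.symm, SimpleGraph.Reachable.refl _]
      · intro P hP u hu v hv
        obtain ⟨w, -, rfl⟩ := Finset.mem_image.1 hP
        rw [Finset.mem_singleton.1 hu, Finset.mem_singleton.1 hv]
  · constructor
    · rintro ⟨P, hP, u, hu, h⟩
      refine ⟨u, ?_, h⟩
      simp only [pairPart, Finset.mem_insert, Finset.mem_image, Finset.mem_erase] at hP
      rcases hP with rfl | ⟨w, hw, rfl⟩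
      · simp only [Finset.mem_insert, Finset.mem_singleton] at hu
        rcases hu with rfl | rfl <;> assumption
      · rw [Finset.mem_singleton.1 hu]
        exact hw.2.2
    · rintro ⟨u, hu, h⟩
      by_cases h' : u = i ∨ u = j
      · exact ⟨{i, j}, Finset.mem_insert_self _ _, u, by simpa using h', h⟩
      · push Not at h'
        refine ⟨{u}, Finset.mem_insert_of_mem (Finset.mem_image_of_mem _ ?_), u, by simp, h⟩
        simp [h', hu]

/-- The incidence of the edges and vertices selected by `g` and `j`. -/
def incMatrix {κ : Type*} (G : FeynmanGraph nV nE) (R : Type*) [Ring R] (g : κ → Fin nE)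
    (j : κ → Fin nV) : Matrix κ κ R :=
  Matrix.of fun r c => (if (G.ends (g r)).1 = j c then 1 else 0) -
    (if (G.ends (g r)).2 = j c then 1 else 0)

section Inc

variable {κ : Type*} [Fintype κ]

theorem incMatrix_mulVec {R : Type*} [Ring R] (g : κ → Fin nE) {j : κ → Fin nV}
    (hj : Function.Injective j) (f : Fin nV → R) (hf : ∀ v, v ∉ Set.range j → f v = 0) (r : κ) :
    (G.incMatrix R g j).mulVec (f ∘ j) r = f (G.ends (g r)).1 - f (G.ends (g r)).2 := by
  have key : ∀ v : Fin nV, ∑ c, (if v = j c then f (j c) else 0) = f v := by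
    intro v
    by_cases hv : v ∈ Set.range j
    · obtain ⟨c, rfl⟩ := hv
      rw [Finset.sum_eq_single c] <;> simp +contextual [hj.eq_iff, eq_comm]
    · rw [hf v hv]
      refine Finset.sum_eq_zero fun c _ => if_neg ?_
      rintro rfl
      exact hv ⟨c, rfl⟩
  simp only [incMatrix, Matrix.mulVec, dotProduct, Matrix.of_apply, sub_mul, ite_mul, one_mul,
    zero_mul, Finset.sum_sub_distrib, Function.comp, key]

variable [DecidableEq κ]

theorem det_incMatrix_ne_zero {K : Type*} [Field K] {g : κ → Fin nE} {j : κ → Fin nV}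
    (hj : Function.Injective j) {W : Finset (Fin nV)} (hW : ∀ v, v ∈ W ↔ v ∉ Set.range j)
    (hs : G.Spans W (Finset.univ.image g)) : (G.incMatrix K g j).det ≠ 0 := by
  intro h0
  obtain ⟨z, hz, hz0⟩ := Matrix.exists_mulVec_eq_zero_iff.2 h0
  let f : Fin nV → K := Function.extend j z 0
  have hfz : f ∘ j = z := Function.extend_comp hj z 0
  have hf : ∀ v, v ∉ Set.range j → f v = 0 := fun v hv => Function.extend_apply' _ _ _ hv
  have hf0 : f = 0 := by
    refine hs.eq_zero (fun e he => ?_) fun w hw => hf w ((hW w).1 hw)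
    obtain ⟨r, -, rfl⟩ := Finset.mem_image.1 he
    have := G.incMatrix_mulVec g hj f hf r
    rw [hfz, hz0] at this
    exact sub_eq_zero.1 this.symm
  exact hz (by rw [← hfz, hf0]; rfl)

theorem map_incMatrix (R : Type*) [CommRing R] (g : κ → Fin nE) (j : κ → Fin nV) :
    (G.incMatrix R g j).det = (((G.incMatrix ℤ g j).det : ℤ) : R) := by
  have := RingHom.map_det (Int.castRingHom R) (G.incMatrix ℤ g j)
  rw [eq_intCast] at this
  rw [this]
  congr 1
  ext r c
  simp [incMatrix, RingHom.mapMatrix_apply]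

theorem det_incMatrix_sq {g : κ → Fin nE} {j : κ → Fin nV}
    (hj : Function.Injective j) {W : Finset (Fin nV)} (hW : ∀ v, v ∈ W ↔ v ∉ Set.range j) :
    (G.incMatrix ℝ g j).det ^ 2 = if G.Spans W (Finset.univ.image g) then 1 else 0 := by
  split_ifs with hs
  · have hu : (G.incMatrix ℤ g j).det.natAbs = 1 := by
      by_contra h
      obtain ⟨p, hp, hdvd⟩ := Nat.exists_prime_and_dvd h
      have := Fact.mk hp
      refine det_incMatrix_ne_zero (K := ZMod p) hj hW hs ?_
      rw [map_incMatrix, ZMod.intCast_zmod_eq_zero_iff_dvd]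
      exact Int.natCast_dvd.2 hdvd
    rw [map_incMatrix]
    rcases Int.natAbs_eq_iff.1 hu with h | h <;> rw [h] <;> simp
  · rw [Spans] at hs
    push Not at hs
    obtain ⟨v, hv⟩ := hs
    let f : Fin nV → ℝ := fun u =>
      if (G.edgeGraph (Finset.univ.image g)).Reachable v u then 1 else 0
    have hf : ∀ v, v ∉ Set.range j → f v = 0 := fun u hu => if_neg (hv u ((hW u).2 hu))
    have hvj : v ∈ Set.range j := by
      by_contra h
      exact hv v ((hW v).2 h) (SimpleGraph.Reachable.refl _)
    obtain ⟨c, rfl⟩ := hvj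
    rw [Matrix.exists_mulVec_eq_zero_iff.1 ⟨f ∘ j, ?_, ?_⟩]
    · simp
    · intro h
      have := congrFun h c
      simp [f] at this
    · funext r
      rw [incMatrix_mulVec g hj f hf, Pi.zero_apply, sub_eq_zero]
      have hr := reachable_ends (G := G) (Finset.mem_image_of_mem g (Finset.mem_univ r))
      exact if_congr ⟨fun h => h.trans hr, fun h => h.trans hr.symm⟩ rfl rfl

end Inc

end FeynmanGraph

theorem sum_sum_lt_sub_sq_mul {ι : Type*} [LinearOrder ι] (s : Finset ι) (x D : ι → ℝ)
    (hD : ∑ i ∈ s, D i = 0) :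
    ∑ i ∈ s, ∑ j ∈ s.filter (fun j => i < j), (x i - x j) ^ 2 * -(D i * D j) =
      (∑ i ∈ s, x i * D i) ^ 2 := by
  let g : ι → ι → ℝ := fun i j => (x i - x j) ^ 2 * -(D i * D j)
  have hswap : ∑ i ∈ s, ∑ j ∈ s.filter (fun j => i < j), g i j =
      ∑ i ∈ s, ∑ j ∈ s.filter (fun j => j < i), g i j := by
    simp_rw [Finset.sum_filter]
    rw [Finset.sum_comm]
    refine Finset.sum_congr rfl fun i _ => Finset.sum_congr rfl fun j _ => ?_
    have : g j i = g i j := by simp only [g]; ring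
    rw [this]
  have hall : ∑ i ∈ s, ∑ j ∈ s, g i j =
      2 * ∑ i ∈ s, ∑ j ∈ s.filter (fun j => i < j), g i j := by
    rw [two_mul]
    nth_rw 2 [hswap]
    rw [← Finset.sum_add_distrib]
    refine Finset.sum_congr rfl fun i _ => ?_
    rw [Finset.sum_filter, Finset.sum_filter, ← Finset.sum_add_distrib]
    refine Finset.sum_congr rfl fun j _ => ?_
    rcases lt_trichotomy i j with h | h | h
    · simp [h, h.not_gt]
    · simp [h, g]
    · simp [h, h.not_gt]
  have hexp : ∑ i ∈ s, ∑ j ∈ s, g i j = 2 * (∑ i ∈ s, x i * D i) ^ 2 := by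
    have : ∀ i j, g i j = 2 * ((x i * D i) * (x j * D j)) - (x i ^ 2 * D i) * D j -
        D i * (x j ^ 2 * D j) := fun i j => by simp only [g]; ring
    simp_rw [this, Finset.sum_sub_distrib, ← Finset.mul_sum, ← Finset.sum_mul, hD]
    ring
  show ∑ i ∈ s, ∑ j ∈ s.filter (fun j => i < j), g i j = _
  linarith

namespace FeynmanGraph

variable {nV nE : ℕ} (G : FeynmanGraph nV nE)

/-- The row of the incidence matrix belonging to the edge `e`, restricted to the internal
vertices. -/
def intInc (e : Fin nE) (v : {v : Fin nV // v ∉ G.ext}) : ℝ :=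
  (if (G.ends e).1 = v then 1 else 0) - (if (G.ends e).2 = v then 1 else 0)

/-- The difference along the edge `e` of the function that agrees with `x` on the external
vertices and vanishes on the internal ones. -/
def extDiff (x : Fin nV → ℝ) (e : Fin nE) : ℝ :=
  (if (G.ends e).1 ∈ G.ext then x (G.ends e).1 else 0) -
    (if (G.ends e).2 ∈ G.ext then x (G.ends e).2 else 0)

/-- The row `intInc` extended by the entry `extDiff`. -/
def fullInc (x : Fin nV → ℝ) (e : Fin nE) : {v : Fin nV // v ∉ G.ext} ⊕ Unit → ℝ :=
  Sum.elim (G.intInc e) fun _ => G.extDiff x e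

theorem card_int_add_card_ext :
    Fintype.card {v : Fin nV // v ∉ G.ext} + G.ext.card = nV := by
  have h := Fintype.card_subtype_compl (fun v => v ∈ G.ext)
  have h2 := Finset.card_le_univ G.ext
  rw [Fintype.card_coe] at h
  simp only [Fintype.card_fin] at h h2
  omega

theorem card_intVerts : G.intVerts.card = Fintype.card {v : Fin nV // v ∉ G.ext} := by
  rw [intVerts, Fintype.card_subtype]

theorem psiTilde_eq_det (α : Fin nE → ℝ) : G.psiTilde α = (gramMatrix G.intInc α).det := by
  have hn := G.card_int_add_card_ext
  rw [det_gramMatrix, psiTilde, dualForestPoly]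
  have hf : G.forests G.singlePart = (Finset.powersetCard
      (Fintype.card {v : Fin nV // v ∉ G.ext}) Finset.univ).filter (G.Spans G.ext) := by
    ext F
    simp only [forests, Finset.mem_filter, Finset.mem_univ, true_and, isForest_singlePart_iff,
      Finset.mem_powersetCard, Finset.subset_univ]
    exact and_congr_left fun _ => by omega
  rw [hf, Finset.sum_filter]
  refine Finset.sum_congr rfl fun F hF => ?_
  have hFc := (Finset.mem_powersetCard.1 hF).2
  let g : {v : Fin nV // v ∉ G.ext} ≃ F := Fintype.equivOfCardEq (by simp [hFc])
  have him : Finset.univ.image (fun i => (g i : Fin nE)) = F := by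
    ext e
    simp only [Finset.mem_image, Finset.mem_univ, true_and]
    exact ⟨by rintro ⟨i, rfl⟩; exact (g i).2, fun he => ⟨g.symm ⟨e, he⟩, by simp⟩⟩
  have hdet := G.det_incMatrix_sq (g := fun i => (g i : Fin nE)) (j := Subtype.val)
    Subtype.val_injective (W := G.ext) (by simp)
  rw [him] at hdet
  rw [det_gramMatrix_indicator _ g]
  have : (Matrix.of fun i => G.intInc (g i)) =
      G.incMatrix ℝ (fun i => (g i : Fin nE)) Subtype.val := rfl
  rw [this, hdet]
  split_ifs <;> simp

theorem det_fullInc (x : Fin nV → ℝ) (g : {v : Fin nV // v ∉ G.ext} ⊕ Unit → Fin nE) :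
    (Matrix.of fun r => G.fullInc x (g r)).det =
      ∑ k ∈ G.ext, x k * (G.incMatrix ℝ g (Sum.elim Subtype.val fun _ => k)).det := by
  set A := Matrix.of fun r => G.fullInc x (g r) with hA
  have hk : ∀ k, G.incMatrix ℝ g (Sum.elim Subtype.val fun _ => k) =
      A.updateCol (Sum.inr ()) fun r =>
        (if (G.ends (g r)).1 = k then 1 else 0) - (if (G.ends (g r)).2 = k then 1 else 0) := by
    intro k
    ext r c
    rcases c with c | c
    · rw [Matrix.updateCol_ne (by simp)]
      rfl
    · rw [Matrix.updateCol_self]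
      rfl
  have hAA : A = A.updateCol (Sum.inr ()) (∑ k ∈ G.ext, x k • fun r =>
        (if (G.ends (g r)).1 = k then (1 : ℝ) else 0) -
          (if (G.ends (g r)).2 = k then 1 else 0)) := by
    ext r c
    rcases c with c | c
    · rw [Matrix.updateCol_ne (by simp)]
    · simp [hA, fullInc, extDiff, Finset.sum_apply, mul_sub, Finset.sum_sub_distrib]
  conv_lhs => rw [hAA]
  rw [← Matrix.cramer_apply, map_sum, Finset.sum_apply]
  refine Finset.sum_congr rfl fun k _ => ?_
  rw [hk, map_smul, Pi.smul_apply, Matrix.cramer_apply, smul_eq_mul]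

theorem sum_det_incMatrix_eq_zero (g : {v : Fin nV // v ∉ G.ext} ⊕ Unit → Fin nE) :
    ∑ k ∈ G.ext, (G.incMatrix ℝ g (Sum.elim Subtype.val fun _ => k)).det = 0 := by
  have h := G.det_fullInc (fun _ => 1) g
  simp only [one_mul] at h
  rw [← h]
  refine Matrix.exists_mulVec_eq_zero_iff.1 ⟨fun _ => 1, ?_, ?_⟩
  · intro h
    exact one_ne_zero (congrFun h (Sum.inr ()))
  · funext r
    simp only [Matrix.mulVec, dotProduct, Matrix.of_apply, mul_one, Fintype.sum_sum_type,
      fullInc, Sum.elim_inl, Sum.elim_inr, Finset.univ_unique, Finset.sum_singleton, intInc,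
      extDiff, Finset.sum_sub_distrib, Pi.zero_apply]
    have key : ∀ v : Fin nV, ∑ c : {v : Fin nV // v ∉ G.ext}, (if v = c then (1 : ℝ) else 0) +
        (if v ∈ G.ext then 1 else 0) = 1 := by
      intro v
      by_cases hv : v ∈ G.ext
      · rw [Finset.sum_eq_zero]
        · simp [hv]
        · rintro ⟨c, hc⟩ -
          refine if_neg ?_
          rintro rfl
          exact hc hv
      · rw [Finset.sum_eq_single ⟨v, hv⟩]
        · simp [hv]
        · rintro ⟨c, hc⟩ - hne
          refine if_neg fun h => hne (Subtype.ext h.symm)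
        · simp
    linarith [key (G.ends (g r)).1, key (G.ends (g r)).2]

theorem neg_det_mul_det {i j : Fin nV} (hi : i ∈ G.ext) (hj : j ∈ G.ext) (hij : i ≠ j)
    {F : Finset (Fin nE)} (g : {v : Fin nV // v ∉ G.ext} ⊕ Unit ≃ F) :
    -((G.incMatrix ℝ (fun r => (g r : Fin nE)) (Sum.elim Subtype.val fun _ => i)).det *
      (G.incMatrix ℝ (fun r => (g r : Fin nE)) (Sum.elim Subtype.val fun _ => j)).det) =
      if G.IsForest (G.pairPart i j) F then 1 else 0 := by
  let D : Fin nV → ℝ := fun k =>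
    (G.incMatrix ℝ (fun r => (g r : Fin nE)) (Sum.elim Subtype.val fun _ => k)).det
  have hn := G.card_int_add_card_ext
  have hFc : F.card + G.ext.card = nV + 1 := by
    have := Fintype.card_congr g
    simp only [Fintype.card_sum, Fintype.card_unit, Fintype.card_coe] at this
    omega
  have hsum : ∑ k ∈ G.ext, D k = 0 := G.sum_det_incMatrix_eq_zero _
  have him : Finset.univ.image (fun i => (g i : Fin nE)) = F := by
    ext e
    simp only [Finset.mem_image, Finset.mem_univ, true_and]
    exact ⟨by rintro ⟨i, rfl⟩; exact (g i).2, fun he => ⟨g.symm ⟨e, he⟩, by simp⟩⟩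
  have hDsq : ∀ k ∈ G.ext, D k ^ 2 = if G.Spans (G.ext.erase k) F then 1 else 0 := by
    intro k hk
    have := G.det_incMatrix_sq (g := fun i => (g i : Fin nE))
      (j := Sum.elim Subtype.val fun _ : Unit => k) ?_ (W := G.ext.erase k) ?_
    · rwa [him] at this
    · rintro (⟨a, ha⟩ | a) (⟨b, hb⟩ | b) h
      · simpa using h
      · exact absurd hk (by rw [← show a = k from h]; exact ha)
      · exact absurd hk (by rw [show k = b from h]; exact hb)
      · rfl
    · intro v
      rw [Finset.mem_erase]
      constructor
      · rintro ⟨h1, h2⟩ ⟨a | a, h⟩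
        · exact a.2 (by rw [show (a : Fin nV) = v from h]; exact h2)
        · exact h1 h.symm
      · intro h
        refine ⟨fun hv => h ⟨Sum.inr (), hv.symm⟩, ?_⟩
        by_contra hv
        exact h ⟨Sum.inl ⟨v, hv⟩, rfl⟩
  show -(D i * D j) = _
  split_ifs with hF
  · have hF' := (isForest_pairPart_iff hi hj hij).1 hF
    have hi1 : D i ^ 2 = 1 := by
      rw [hDsq i hi, if_pos]
      intro v
      obtain ⟨w, hw, hr⟩ := hF'.2.2 v
      by_cases hwi : w = i
      · subst hwi
        exact ⟨j, Finset.mem_erase.2 ⟨hij.symm, hj⟩, hr.trans hF'.2.1⟩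
      · exact ⟨w, Finset.mem_erase.2 ⟨hwi, hw⟩, hr⟩
    have hk : ∀ k ∈ G.ext, k ≠ i → k ≠ j → D k = 0 := by
      intro k hk hki hkj
      have : D k ^ 2 = 0 := by
        rw [hDsq k hk, if_neg]
        intro hs
        obtain ⟨w, hw, hr⟩ := hs k
        rw [Finset.mem_erase] at hw
        have hkP : ({k} : Finset (Fin nV)) ∈ G.pairPart i j :=
          Finset.mem_insert_of_mem (Finset.mem_image_of_mem _ (by simp [hki, hkj, hk]))
        by_cases hwij : w = i ∨ w = j
        · refine hF.2.2.2 {k} hkP {i, j} (Finset.mem_insert_self _ _) ?_ k (by simp) w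
            (by simpa using hwij) hr
          intro h
          have : i ∈ ({k} : Finset (Fin nV)) := by rw [h]; simp
          exact hki (Finset.mem_singleton.1 this).symm
        · push Not at hwij
          refine hF.2.2.2 {k} hkP {w} (Finset.mem_insert_of_mem (Finset.mem_image_of_mem _
            (by simp [hwij, hw.2]))) ?_ k (by simp) w (by simp) hr
          intro h
          exact hw.1 (Finset.singleton_injective h).symm
      exact pow_eq_zero_iff (two_ne_zero) |>.1 this
    have h2 : D i + D j = 0 := by
      rw [← hsum, ← Finset.sum_pair hij]
      refine Finset.sum_subset (by simp [Finset.insert_subset_iff, hi, hj]) fun k hk' hne => ?_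
      simp only [Finset.mem_insert, Finset.mem_singleton, not_or] at hne
      exact hk k hk' hne.1 hne.2
    have : D j = -D i := by linarith
    rw [this]
    linarith
  · by_contra hne
    have hDi : D i ≠ 0 := fun h => hne (by rw [h]; simp)
    have hDj : D j ≠ 0 := fun h => hne (by rw [h]; simp)
    have hsi : G.Spans (G.ext.erase i) F := by
      by_contra h
      exact hDi (pow_eq_zero_iff two_ne_zero |>.1 ((hDsq i hi).trans (if_neg h)))
    have hsj : G.Spans (G.ext.erase j) F := by
      by_contra h
      exact hDj (pow_eq_zero_iff two_ne_zero |>.1 ((hDsq j hj).trans (if_neg h)))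
    refine hF ((isForest_pairPart_iff hi hj hij).2 ⟨hFc, ?_, ?_⟩)
    · by_contra hnr
      have hs : G.Spans ((G.ext.erase i).erase j) F := by
        intro v
        obtain ⟨w, hw, hr⟩ := hsi v
        by_cases hwj : w = j
        · subst hwj
          obtain ⟨w', hw', hr'⟩ := hsj w
          refine ⟨w', ?_, hr.trans hr'⟩
          rw [Finset.mem_erase] at hw' ⊢
          refine ⟨hw'.1, Finset.mem_erase.2 ⟨?_, hw'.2⟩⟩
          rintro rfl
          exact hnr hr'.symm
        · exact ⟨w, Finset.mem_erase.2 ⟨hwj, hw⟩, hr⟩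
      have h1 := hs.le_card_add_card
      rw [Finset.card_erase_of_mem (Finset.mem_erase.2 ⟨hij.symm, hj⟩),
        Finset.card_erase_of_mem hi] at h1
      have := Finset.one_lt_card.2 ⟨i, hi, j, hj, hij⟩
      omega
    · intro v
      obtain ⟨w, hw, hr⟩ := hsi v
      exact ⟨w, (Finset.mem_erase.1 hw).2, hr⟩

theorem det_gramMatrix_fullInc (x : Fin nV → ℝ) (α : Fin nE → ℝ) :
    (gramMatrix (G.fullInc x) α).det = ∑ i ∈ G.ext, ∑ j ∈ G.ext.filter (fun j => i < j),
      (x i - x j) ^ 2 * G.dualForestPoly (G.pairPart i j) α := by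
  have hn := G.card_int_add_card_ext
  have hforest : ∀ i ∈ G.ext, ∀ j ∈ G.ext, i < j → G.dualForestPoly (G.pairPart i j) α =
      ∑ F ∈ Finset.powersetCard (Fintype.card ({v : Fin nV // v ∉ G.ext} ⊕ Unit)) Finset.univ,
        (∏ e ∈ F, α e) * if G.IsForest (G.pairPart i j) F then 1 else 0 := by
    intro i hi j hj hij
    simp_rw [mul_ite, mul_one, mul_zero, ← Finset.sum_filter]
    refine Finset.sum_congr ?_ fun _ _ => rfl
    ext F
    simp only [forests, Finset.mem_filter, Finset.mem_univ, true_and,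
      Finset.mem_powersetCard, Finset.subset_univ]
    refine ⟨fun h => ⟨?_, h⟩, fun h => h.2⟩
    have := ((isForest_pairPart_iff hi hj hij.ne).1 h).1
    simp only [Fintype.card_sum, Fintype.card_unit]
    omega
  have hF : ∀ F ∈ Finset.powersetCard (Fintype.card ({v : Fin nV // v ∉ G.ext} ⊕ Unit))
      (Finset.univ : Finset (Fin nE)),
      (gramMatrix (G.fullInc x) fun e => if e ∈ F then 1 else 0).det =
      ∑ i ∈ G.ext, ∑ j ∈ G.ext.filter (fun j => i < j),
        (x i - x j) ^ 2 * if G.IsForest (G.pairPart i j) F then 1 else 0 := by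
    intro F hF
    have hFc := (Finset.mem_powersetCard.1 hF).2
    let g : {v : Fin nV // v ∉ G.ext} ⊕ Unit ≃ F := Fintype.equivOfCardEq (by
      rw [Fintype.card_coe, hFc])
    rw [det_gramMatrix_indicator _ g, det_fullInc,
      ← sum_sum_lt_sub_sq_mul _ _ _ (G.sum_det_incMatrix_eq_zero _)]
    refine Finset.sum_congr rfl fun i hi => Finset.sum_congr rfl fun j hj => ?_
    rw [Finset.mem_filter] at hj
    rw [G.neg_det_mul_det hi hj.1 hj.2.ne]
  rw [det_gramMatrix, Finset.sum_congr rfl fun F h => by rw [hF F h]]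
  simp_rw [Finset.mul_sum]
  rw [Finset.sum_comm]
  refine Finset.sum_congr rfl fun i hi => ?_
  rw [Finset.sum_comm]
  refine Finset.sum_congr rfl fun j hj => ?_
  rw [Finset.mem_filter] at hj
  rw [hforest i hi j hj.1 hj.2, Finset.mul_sum]
  refine Finset.sum_congr rfl fun F _ => ?_
  ring

/-- The linear part of the quadratic form. -/
def linVec (x : Fin nV → ℝ) (α : Fin nE → ℝ) (v : {v : Fin nV // v ∉ G.ext}) : ℝ :=
  ∑ e, α e * (G.intInc e v * G.extDiff x e)

theorem det_gramMatrix_fullInc_eq_mul (x : Fin nV → ℝ) (α : Fin nE → ℝ)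
    (h : (gramMatrix G.intInc α).det ≠ 0) :
    (gramMatrix (G.fullInc x) α).det = (gramMatrix G.intInc α).det *
      (∑ e, α e * G.extDiff x e ^ 2 -
        G.linVec x α ⬝ᵥ (gramMatrix G.intInc α)⁻¹.mulVec (G.linVec x α)) := by
  set L := gramMatrix G.intInc α with hL
  have : Invertible L := L.invertibleOfIsUnitDet h.isUnit
  have hb : gramMatrix (G.fullInc x) α = Matrix.fromBlocks L
      (Matrix.of fun v _ => G.linVec x α v) (Matrix.of fun _ v => G.linVec x α v)
      (Matrix.of fun _ _ : Unit => ∑ e, α e * G.extDiff x e ^ 2) := by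
    ext (i | i) (j | j)
    · rfl
    · rfl
    · simp [gramMatrix, fullInc, linVec, mul_comm]
    · simp [gramMatrix, fullInc, sq]
  rw [hb, Matrix.det_fromBlocks₁₁, Matrix.det_unique (n := Unit)]
  congr 1
  simp only [Matrix.sub_apply, Matrix.of_apply, Matrix.mul_apply, Matrix.invOf_eq_nonsing_inv,
    dotProduct, Matrix.mulVec, Finset.sum_mul, Finset.mul_sum]
  rw [Finset.sum_comm]
  simp [mul_assoc]

end FeynmanGraph

namespace FeynmanGraph

variable {nV nE : ℕ} (G : FeynmanGraph nV nE)

theorem assemble_sub_assemble (x : Fin nV → ℝ) (y : {v : Fin nV // v ∉ G.ext} → ℝ)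
    (e : Fin nE) :
    G.assemble x y (G.ends e).1 - G.assemble x y (G.ends e).2 =
      ∑ v, G.intInc e v * y v + G.extDiff x e := by
  have key : ∀ v : Fin nV, G.assemble x y v =
      ∑ c : {v : Fin nV // v ∉ G.ext}, (if v = c then y c else 0) +
        if v ∈ G.ext then x v else 0 := by
    intro v
    by_cases hv : v ∈ G.ext
    · rw [Finset.sum_eq_zero]
      · simp [hv, assemble]
      · rintro ⟨c, hc⟩ -
        refine if_neg ?_
        rintro rfl
        exact hc hv
    · rw [Finset.sum_eq_single ⟨v, hv⟩]
      · simp [hv, assemble]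
      · rintro ⟨c, hc⟩ - hne
        exact if_neg fun h => hne (Subtype.ext h.symm)
      · simp
  rw [key, key]
  simp only [intInc, extDiff, sub_mul, ite_mul, one_mul, zero_mul, Finset.sum_sub_distrib]
  ring

theorem dotProduct_gramMatrix (α : Fin nE → ℝ) (y : {v : Fin nV // v ∉ G.ext} → ℝ) :
    y ⬝ᵥ (gramMatrix G.intInc α).mulVec y = ∑ e, α e * (∑ v, G.intInc e v * y v) ^ 2 := by
  simp only [dotProduct, Matrix.mulVec, gramMatrix, Matrix.of_apply, Finset.mul_sum,
    Finset.sum_mul, sq]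
  rw [Finset.sum_comm]
  simp_rw [Finset.sum_comm (t := (Finset.univ : Finset (Fin nE)))]
  refine Finset.sum_congr rfl fun e _ => Finset.sum_congr rfl fun i _ =>
    Finset.sum_congr rfl fun j _ => ?_
  ring

theorem sum_mul_assemble_sub_sq (x : Fin nV → ℝ) (α : Fin nE → ℝ)
    (y : {v : Fin nV // v ∉ G.ext} → ℝ) :
    ∑ e, α e * (G.assemble x y (G.ends e).1 - G.assemble x y (G.ends e).2) ^ 2 =
      y ⬝ᵥ (gramMatrix G.intInc α).mulVec y + 2 * (G.linVec x α ⬝ᵥ y) +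
        ∑ e, α e * G.extDiff x e ^ 2 := by
  have h : G.linVec x α ⬝ᵥ y = ∑ e, α e * (G.extDiff x e * ∑ v, G.intInc e v * y v) := by
    simp only [dotProduct, linVec, Finset.sum_mul, Finset.mul_sum]
    rw [Finset.sum_comm]
    refine Finset.sum_congr rfl fun e _ => Finset.sum_congr rfl fun v _ => ?_
    ring
  rw [dotProduct_gramMatrix, h, Finset.mul_sum, ← Finset.sum_add_distrib,
    ← Finset.sum_add_distrib]
  refine Finset.sum_congr rfl fun e _ => ?_
  rw [assemble_sub_assemble]
  ring

variable {G} in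
theorem posDef_gramMatrix (hs : G.Spans G.ext Finset.univ) {α : Fin nE → ℝ}
    (hα : ∀ e, 0 < α e) : (gramMatrix G.intInc α).PosDef := by
  refine Matrix.PosDef.of_dotProduct_mulVec_pos ?_ fun y hy => ?_
  · ext i j
    simp [gramMatrix, mul_comm]
  · rw [star_trivial, dotProduct_gramMatrix]
    refine lt_of_le_of_ne (Finset.sum_nonneg fun e _ => by have := hα e; positivity) fun h => hy ?_
    have h0 : ∀ e, ∑ v, G.intInc e v * y v = 0 := by
      intro e
      have := (Finset.sum_eq_zero_iff_of_nonneg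
        (fun e _ => by have := hα e; positivity)).1 h.symm e (Finset.mem_univ e)
      simpa [(hα e).ne'] using this
    have hz : G.assemble (fun _ => 0) y = 0 := by
      refine hs.eq_zero (fun e _ => ?_) fun w hw => by simp [assemble, hw]
      rw [← sub_eq_zero, assemble_sub_assemble, h0]
      simp [extDiff]
    funext v
    have := congrFun hz v
    simpa [assemble, v.2] using this

variable {G} in
theorem psiTilde_pos (hs : G.Spans G.ext Finset.univ) {α : Fin nE → ℝ} (hα : ∀ e, 0 < α e) :
    0 < G.psiTilde α := by
  rw [psiTilde_eq_det]
  exact (posDef_gramMatrix hs hα).det_pos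

theorem assemble_apply {d : ℕ} (x : Fin nV → EuclideanSpace ℝ (Fin d))
    (y : {v : Fin nV // v ∉ G.ext} → EuclideanSpace ℝ (Fin d)) (v : Fin nV) (c : Fin d) :
    G.assemble x y v c = G.assemble (fun v => x v c) (fun v => y v c) v := by
  unfold assemble
  split_ifs <;> rfl

variable {G} in
theorem phiTilde_eq {d : ℕ} (hs : G.Spans G.ext Finset.univ)
    (x : Fin nV → EuclideanSpace ℝ (Fin d)) {α : Fin nE → ℝ} (hα : ∀ e, 0 < α e) :
    G.phiTilde x α = G.psiTilde α * ∑ c, (∑ e, α e * G.extDiff (fun v => x v c) e ^ 2 -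
        G.linVec (fun v => x v c) α ⬝ᵥ
          (gramMatrix G.intInc α)⁻¹.mulVec (G.linVec (fun v => x v c) α)) := by
  have h0 := (posDef_gramMatrix hs hα).det_pos.ne'
  rw [psiTilde_eq_det, Finset.mul_sum]
  simp_rw [← det_gramMatrix_fullInc_eq_mul _ _ _ h0, det_gramMatrix_fullInc]
  rw [Finset.sum_comm, phiTilde]
  refine Finset.sum_congr rfl fun i _ => ?_
  rw [Finset.sum_comm]
  refine Finset.sum_congr rfl fun j _ => ?_
  rw [← Finset.sum_mul, EuclideanSpace.real_norm_sq_eq]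
  rfl

variable {G} in
/-- `Φ̃/Ψ̃` is the energy of some extension of the external positions. -/
theorem exists_phiTilde_eq {d : ℕ} (hs : G.Spans G.ext Finset.univ)
    (x : Fin nV → EuclideanSpace ℝ (Fin d)) {α : Fin nE → ℝ} (hα : ∀ e, 0 < α e) :
    ∃ y, G.phiTilde x α = G.psiTilde α *
      ∑ e, α e * ‖G.assemble x y (G.ends e).1 - G.assemble x y (G.ends e).2‖ ^ 2 := by
  set L := gramMatrix G.intInc α with hL
  have h0 : IsUnit L.det := (posDef_gramMatrix hs hα).det_pos.ne'.isUnit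
  refine ⟨fun v => WithLp.toLp 2 fun c => -(L⁻¹.mulVec (G.linVec (fun v => x v c) α)) v, ?_⟩
  rw [phiTilde_eq hs x hα]
  simp_rw [EuclideanSpace.real_norm_sq_eq, Finset.mul_sum]
  rw [Finset.sum_comm (s := (Finset.univ : Finset (Fin nE)))]
  refine Finset.sum_congr rfl fun c _ => ?_
  simp_rw [← Finset.mul_sum, PiLp.sub_apply, assemble_apply, sum_mul_assemble_sub_sq, ← hL]
  congr 1
  set v := G.linVec (fun v => x v c) α
  have : (fun i => -(L⁻¹.mulVec v) i) = -(L⁻¹.mulVec v) := rfl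
  rw [this, Matrix.mulVec_neg, Matrix.mulVec_mulVec, Matrix.mul_nonsing_inv _ h0,
    Matrix.one_mulVec, neg_dotProduct_neg, dotProduct_neg, dotProduct_comm]
  ring

variable {G} in
theorem lintegral_exp_neg_energy {d : ℕ} (hs : G.Spans G.ext Finset.univ)
    (x : Fin nV → EuclideanSpace ℝ (Fin d)) {α : Fin nE → ℝ} (hα : ∀ e, 0 < α e) :
    ∫⁻ y : {v : Fin nV // v ∉ G.ext} → EuclideanSpace ℝ (Fin d), ENNReal.ofReal (Real.exp
      (-∑ e, α e * ‖G.assemble x y (G.ends e).1 - G.assemble x y (G.ends e).2‖ ^ 2)) =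
    ENNReal.ofReal (Real.pi ^ ((d : ℝ) / 2 * (G.intVerts.card : ℝ)) *
      (G.psiTilde α ^ (-((d : ℝ) / 2)) * Real.exp (-(G.phiTilde x α / G.psiTilde α)))) := by
  set L := gramMatrix G.intInc α with hL
  have hpd : L.PosDef := posDef_gramMatrix hs hα
  have hψ := psiTilde_pos hs hα
  let g : Fin d → ({v : Fin nV // v ∉ G.ext} → ℝ) → ℝ≥0∞ := fun c z =>
    ENNReal.ofReal (Real.exp (-(z ⬝ᵥ L.mulVec z + 2 * (G.linVec (fun v => x v c) α ⬝ᵥ z) +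
      ∑ e, α e * G.extDiff (fun v => x v c) e ^ 2)))
  have hg : ∀ c, Measurable (g c) := fun c => by
    simp only [g, dotProduct, Matrix.mulVec]
    fun_prop
  have h1 : ∀ y : {v : Fin nV // v ∉ G.ext} → EuclideanSpace ℝ (Fin d),
      ENNReal.ofReal (Real.exp (-∑ e, α e *
        ‖G.assemble x y (G.ends e).1 - G.assemble x y (G.ends e).2‖ ^ 2)) =
      ∏ c, g c fun v => y v c := by
    intro y
    rw [← ENNReal.ofReal_prod_of_nonneg fun _ _ => (Real.exp_pos _).le, ← Real.exp_sum]
    simp_rw [EuclideanSpace.real_norm_sq_eq, Finset.mul_sum]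
    rw [Finset.sum_comm, Finset.sum_neg_distrib]
    simp_rw [PiLp.sub_apply, assemble_apply, sum_mul_assemble_sub_sq]
    rfl
  simp_rw [h1]
  rw [lintegral_euclidean_pi_prod g hg]
  simp only [g]
  simp_rw [lintegral_exp_neg_quadratic hpd]
  rw [← ENNReal.ofReal_prod_of_nonneg fun c _ => by
    have := hpd.det_pos
    positivity]
  rw [Finset.prod_mul_distrib, ← Real.exp_sum, Finset.prod_const, phiTilde_eq hs x hα,
    mul_div_cancel_left₀ _ hψ.ne', Finset.sum_neg_distrib, psiTilde_eq_det, mul_pow,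
    Finset.card_univ, Fintype.card_fin, ← Real.rpow_natCast, ← Real.rpow_natCast,
    ← Real.rpow_mul Real.pi_pos.le, ← Real.rpow_mul hpd.det_pos.le, card_intVerts, mul_assoc]
  congr 3
  · ring
  · congr 1
    ring

end FeynmanGraph

namespace FeynmanGraph

variable {nV nE : ℕ} {G : FeynmanGraph nV nE}

theorem ae_assemble_ne {d : ℕ} (hd : 0 < d) {x : Fin nV → EuclideanSpace ℝ (Fin d)}
    (hx : ∀ v ∈ G.ext, ∀ w ∈ G.ext, v ≠ w → x v ≠ x w) {u w : Fin nV} (huw : u ≠ w) :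
    ∀ᵐ y : {v : Fin nV // v ∉ G.ext} → EuclideanSpace ℝ (Fin d),
      G.assemble x y u ≠ G.assemble x y w := by
  by_cases hInt : u ∈ G.ext ∧ w ∈ G.ext
  · refine Filter.Eventually.of_forall fun y => ?_
    simpa [assemble, hInt] using hx u hInt.1 w hInt.2 huw
  let A : AffineSubspace ℝ ({v : Fin nV // v ∉ G.ext} → EuclideanSpace ℝ (Fin d)) :=
    { carrier := {y | G.assemble x y u = G.assemble x y w}
      smul_vsub_vadd_mem' := by
        intro c p₁ p₂ p₃ h₁ h₂ h₃
        simp only [Set.mem_ofPred_eq] at *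
        have key : ∀ v, G.assemble x (c • (p₁ -ᵥ p₂) +ᵥ p₃) v =
            c • (G.assemble x p₁ v - G.assemble x p₂ v) + G.assemble x p₃ v := by
          intro v
          by_cases hv : v ∈ G.ext <;> simp [assemble, hv]
        rw [key, key, h₁, h₂, h₃] }
  have hne : ∀ u w : Fin nV, u ≠ w → u ∉ G.ext →
      ∃ y : {v : Fin nV // v ∉ G.ext} → EuclideanSpace ℝ (Fin d),
        G.assemble x y u ≠ G.assemble x y w := by
    intro u w huw hu
    refine ⟨Function.update 0 ⟨u, hu⟩ (G.assemble x 0 w + EuclideanSpace.single ⟨0, hd⟩ 1), ?_⟩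
    have h1 : ∀ z, G.assemble x (Function.update 0 ⟨u, hu⟩ z) w = G.assemble x 0 w := by
      intro z
      by_cases hw : w ∈ G.ext
      · simp [assemble, hw]
      · have : (⟨w, hw⟩ : {v : Fin nV // v ∉ G.ext}) ≠ ⟨u, hu⟩ :=
          fun h => huw (congrArg Subtype.val h).symm
        simp only [assemble, hw, not_false_eq_true, dite_true, Function.update_of_ne this]
    have h2 : ∀ z, G.assemble x (Function.update 0 ⟨u, hu⟩ z) u = z := by
      intro z
      simp [assemble, hu]
    rw [h1, h2]
    simp
  have hA : A ≠ ⊤ := by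
    intro h
    have hall : ∀ y, G.assemble x y u = G.assemble x y w := by
      intro y
      have : y ∈ A := by rw [h]; exact AffineSubspace.mem_top ℝ _ y
      exact this
    by_cases hu : u ∈ G.ext
    · obtain ⟨y, hy⟩ := hne w u huw.symm fun hw => hInt ⟨hu, hw⟩
      exact hy (hall y).symm
    · obtain ⟨y, hy⟩ := hne u w huw hu
      exact hy (hall y)
  have := Measure.addHaar_affineSubspace volume A hA
  rw [ae_iff]
  simp only [ne_eq, not_not]
  exact this

/-- The integrand of the Schwinger representation, in terms of the inverse parameters. -/
def schwingerIntegrand (G : FeynmanGraph nV nE) {d : ℕ} (x : Fin nV → EuclideanSpace ℝ (Fin d))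
    (α : Fin nE → ℝ) : ℝ :=
  (∏ e, α e ^ (-(lam d * G.ν e) - 1)) * (G.psiTilde α⁻¹ ^ (-((d : ℝ) / 2)) *
    Real.exp (-(G.phiTilde x α⁻¹ / G.psiTilde α⁻¹)))

theorem measurable_dualForestPoly (p : Finset (Finset (Fin nV))) :
    Measurable (G.dualForestPoly p) := by
  unfold dualForestPoly
  fun_prop

theorem measurable_schwingerIntegrand {d : ℕ} (x : Fin nV → EuclideanSpace ℝ (Fin d)) :
    Measurable (G.schwingerIntegrand x) := by
  have h1 : Measurable G.psiTilde := measurable_dualForestPoly _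
  have h2 : Measurable (G.phiTilde x) := by
    unfold phiTilde
    exact Finset.measurable_sum _ fun i _ => Finset.measurable_sum _ fun j _ =>
      (measurable_dualForestPoly _).const_mul _
  unfold schwingerIntegrand
  fun_prop

theorem continuous_assemble {d : ℕ} (x : Fin nV → EuclideanSpace ℝ (Fin d)) (v : Fin nV) :
    Continuous fun y => G.assemble x y v := by
  unfold assemble
  split_ifs <;> fun_prop

theorem posIntegral_mul_prod_Gamma {d : ℕ} (hd : 2 < d) (hν : ∀ e, 0 < G.ν e)
    (hs : G.Spans G.ext Finset.univ) {x : Fin nV → EuclideanSpace ℝ (Fin d)}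
    (hx : ∀ v ∈ G.ext, ∀ w ∈ G.ext, v ≠ w → x v ≠ x w) :
    ENNReal.ofReal (∏ e, Real.Gamma (lam d * G.ν e)) * G.posIntegral d x =
      ∫⁻ α in {α : Fin nE → ℝ | ∀ e, 0 < α e}, ENNReal.ofReal (G.schwingerIntegrand x α) := by
  have hlam : 0 < lam d := by
    have : (2 : ℝ) < d := by exact_mod_cast hd
    unfold lam
    linarith
  have hsp : ∀ e, 0 < lam d * G.ν e := fun e => mul_pos hlam (hν e)
  have hset : {α : Fin nE → ℝ | ∀ e, 0 < α e} = Set.univ.pi fun _ => Set.Ioi 0 := by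
    ext α
    simp
  have hmeas : MeasurableSet {α : Fin nE → ℝ | ∀ e, 0 < α e} := by
    rw [hset]
    exact MeasurableSet.univ_pi fun _ => measurableSet_Ioi
  have hvol : (volume : Measure (Fin nE → ℝ)).restrict {α | ∀ e, 0 < α e} =
      Measure.pi fun _ => (volume : Measure ℝ).restrict (Set.Ioi 0) := by
    rw [hset, volume_pi, Measure.restrict_pi_pi]
  let Z : ({v : Fin nV // v ∉ G.ext} → EuclideanSpace ℝ (Fin d)) → Fin nE → ℝ := fun y e =>
    ‖G.assemble x y (G.ends e).1 - G.assemble x y (G.ends e).2‖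
  have hZ : ∀ e, Measurable fun y => Z y e := fun e =>
    ((continuous_assemble x _).sub (continuous_assemble x _)).norm.measurable
  let K : ({v : Fin nV // v ∉ G.ext} → EuclideanSpace ℝ (Fin d)) → (Fin nE → ℝ) → ℝ≥0∞ :=
    fun y α => ∏ e, ENNReal.ofReal (α e ^ (-(lam d * G.ν e) - 1) *
      Real.exp (-(Z y e ^ 2 / α e)))
  have hK : Measurable (Function.uncurry K) := by
    refine Finset.measurable_prod _ fun e _ => ENNReal.measurable_ofReal.comp ?_
    have h1 : Measurable fun p : ({v : Fin nV // v ∉ G.ext} → EuclideanSpace ℝ (Fin d)) ×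
      (Fin nE → ℝ) => Z p.1 e := (hZ e).comp measurable_fst
    have h2 : Measurable fun p : ({v : Fin nV // v ∉ G.ext} → EuclideanSpace ℝ (Fin d)) ×
      (Fin nE → ℝ) => p.2 e := (measurable_pi_apply e).comp measurable_snd
    exact (h2.pow_const _).mul (((h1.pow_const 2).div h2).neg.exp)
  have hae : ∀ᵐ y : {v : Fin nV // v ∉ G.ext} → EuclideanSpace ℝ (Fin d),
      ENNReal.ofReal (∏ e, Real.Gamma (lam d * G.ν e)) *
        ENNReal.ofReal (∏ e, Z y e ^ (-(2 * lam d * G.ν e))) =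
      ∫⁻ α in {α : Fin nE → ℝ | ∀ e, 0 < α e}, K y α := by
    have hall : ∀ᵐ y : {v : Fin nV // v ∉ G.ext} → EuclideanSpace ℝ (Fin d), ∀ e,
        G.assemble x y (G.ends e).1 ≠ G.assemble x y (G.ends e).2 :=
      ae_all_iff.2 fun e => ae_assemble_ne (by omega) hx (G.ends_ne e)
    filter_upwards [hall] with y hy
    have hZpos : ∀ e, 0 < Z y e := fun e => norm_pos_iff.2 (sub_ne_zero.2 (hy e))
    rw [hvol, lintegral_pi_prod_eq_prod _ (fun e t => ENNReal.ofReal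
      (t ^ (-(lam d * G.ν e) - 1) * Real.exp (-(Z y e ^ 2 / t))))
      (fun e => by fun_prop), ← ENNReal.ofReal_mul
      (Finset.prod_nonneg fun e _ => (Real.Gamma_pos_of_pos (hsp e)).le),
      ← Finset.prod_mul_distrib, ENNReal.ofReal_prod_of_nonneg fun e _ =>
      mul_nonneg (Real.Gamma_pos_of_pos (hsp e)).le (Real.rpow_nonneg (hZpos e).le _)]
    refine Finset.prod_congr rfl fun e _ => ?_
    rw [lintegral_rpow_mul_exp_neg_div (hsp e) (pow_pos (hZpos e) 2), ← Real.rpow_natCast,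
      ← Real.rpow_mul (hZpos e).le]
    congr 3
    push_cast
    ring
  have hpi : 0 < Real.pi ^ ((d : ℝ) / 2 * (G.intVerts.card : ℝ)) := by positivity
  have hinner : ∀ α ∈ {α : Fin nE → ℝ | ∀ e, 0 < α e}, ∫⁻ y, K y α =
      ENNReal.ofReal (Real.pi ^ ((d : ℝ) / 2 * (G.intVerts.card : ℝ))) *
        ENNReal.ofReal (G.schwingerIntegrand x α) := by
    intro α hα
    have h1 : ∀ y, K y α = ENNReal.ofReal (∏ e, α e ^ (-(lam d * G.ν e) - 1)) *
        ENNReal.ofReal (Real.exp (-∑ e, α⁻¹ e *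
          ‖G.assemble x y (G.ends e).1 - G.assemble x y (G.ends e).2‖ ^ 2)) := by
      intro y
      have hnn : ∀ e, 0 ≤ α e ^ (-(lam d * G.ν e) - 1) := fun e => Real.rpow_nonneg (hα e).le _
      rw [← ENNReal.ofReal_mul (Finset.prod_nonneg fun e _ => hnn e), ← Finset.sum_neg_distrib,
        Real.exp_sum, ← Finset.prod_mul_distrib, ENNReal.ofReal_prod_of_nonneg fun e _ =>
          mul_nonneg (hnn e) (Real.exp_pos _).le]
      refine Finset.prod_congr rfl fun e _ => ?_
      rw [Pi.inv_apply, inv_mul_eq_div]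
    simp_rw [h1]
    rw [lintegral_const_mul' _ _ ENNReal.ofReal_ne_top,
      lintegral_exp_neg_energy (α := α⁻¹) hs x fun e => inv_pos.2 (hα e), ← ENNReal.ofReal_mul
      (Finset.prod_nonneg fun e _ => Real.rpow_nonneg (hα e).le _),
      ← ENNReal.ofReal_mul hpi.le, schwingerIntegrand]
    congr 1
    ring
  rw [posIntegral, ← mul_div_assoc, ← lintegral_const_mul' _ _ ENNReal.ofReal_ne_top,
    lintegral_congr_ae hae, lintegral_lintegral_swap hK.aemeasurable,
    setLIntegral_congr_fun hmeas hinner, lintegral_const_mul' _ _ ENNReal.ofReal_ne_top,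
    mul_comm, ENNReal.mul_div_cancel_right (ENNReal.ofReal_pos.2 hpi).ne' ENNReal.ofReal_ne_top]

end FeynmanGraph

theorem exists_pos_forall_le {ι : Type*} [Finite ι] (f : ι → ℝ) (hf : ∀ i, 0 < f i) :
    ∃ δ > 0, ∀ i, δ ≤ f i := by
  have h : ∀ᶠ δ in nhdsWithin (0 : ℝ) (Set.Ioi 0), ∀ i, δ ≤ f i :=
    Filter.eventually_all.2 fun i => (eventually_nhdsWithin_of_eventually_nhds
      (eventually_le_nhds (hf i)))
  obtain ⟨δ, hδ, h0⟩ := (h.and self_mem_nhdsWithin).exists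
  exact ⟨δ, h0, hδ⟩

namespace FeynmanGraph

variable {nV nE : ℕ} {G : FeynmanGraph nV nE}

theorem norm_sub_le_of_reachable {E : Type*} [SeminormedAddCommGroup E] {A : Finset (Fin nE)}
    {X : Fin nV → E} {r : ℝ} (hr : 0 ≤ r) (h : ∀ e ∈ A, ‖X (G.ends e).1 - X (G.ends e).2‖ ≤ r)
    {u v : Fin nV} (huv : (G.edgeGraph A).Reachable u v) : ‖X u - X v‖ ≤ nV * r := by
  have key : ∀ {u v : Fin nV} (p : (G.edgeGraph A).Walk u v), ‖X u - X v‖ ≤ p.length * r := by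
    intro u v p
    induction p with
    | nil => simp
    | @cons u v w hadj p ih =>
      have h1 : ‖X u - X v‖ ≤ r := by
        rw [edgeGraph, SimpleGraph.fromRel_adj] at hadj
        rcases hadj.2 with ⟨e, he, hj | hj⟩ | ⟨e, he, hj | hj⟩ <;> have h' := h e he <;>
          rw [hj] at h' <;> first | exact h' | (rw [norm_sub_rev]; exact h')
      have h2 := norm_sub_le_norm_sub_add_norm_sub (X u) (X v) (X w)
      rw [SimpleGraph.Walk.length_cons]
      push_cast
      linarith
  obtain ⟨p, hp⟩ := huv.exists_isPath
  have hlen := hp.length_lt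
  rw [Fintype.card_fin] at hlen
  exact (key p).trans (mul_le_mul_of_nonneg_right (by exact_mod_cast hlen.le) hr)

/-- The edges in `A` connect two distinct external vertices. -/
def Joining (G : FeynmanGraph nV nE) (A : Finset (Fin nE)) : Prop :=
  ∃ i ∈ G.ext, ∃ j ∈ G.ext, i ≠ j ∧ (G.edgeGraph A).Reachable i j

theorem exists_mul_psiTilde_le_phiTilde {d : ℕ} (hs : G.Spans G.ext Finset.univ)
    {x : Fin nV → EuclideanSpace ℝ (Fin d)}
    (hx : ∀ v ∈ G.ext, ∀ w ∈ G.ext, v ≠ w → x v ≠ x w) :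
    ∃ c > 0, ∀ a : Fin nE → ℝ, (∀ e, 0 < a e) → ∀ A : Finset (Fin nE), ∀ t > 0,
      (∀ e ∈ A, t ≤ a e) → G.Joining A → c * t * G.psiTilde a ≤ G.phiTilde x a := by
  obtain ⟨δ, hδ, hmin⟩ := exists_pos_forall_le
    (fun p : {p : Fin nV × Fin nV // p.1 ∈ G.ext ∧ p.2 ∈ G.ext ∧ p.1 ≠ p.2} =>
      ‖x p.1.1 - x p.1.2‖)
    fun p => norm_pos_iff.2 (sub_ne_zero.2 (hx _ p.2.1 _ p.2.2.1 p.2.2.2))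
  refine ⟨(δ / (nV + 1)) ^ 2, by positivity, fun a ha A t ht hA hJ => ?_⟩
  obtain ⟨i, hi, j, hj, hij, hr⟩ := hJ
  obtain ⟨y, hy⟩ := exists_phiTilde_eq hs x ha
  set S := ∑ e, a e * ‖G.assemble x y (G.ends e).1 - G.assemble x y (G.ends e).2‖ ^ 2 with hS
  have hS0 : 0 ≤ S := Finset.sum_nonneg fun e _ => by have := ha e; positivity
  have he : ∀ e ∈ A, ‖G.assemble x y (G.ends e).1 - G.assemble x y (G.ends e).2‖ ≤
      Real.sqrt (S / t) := by
    intro e he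
    refine Real.le_sqrt_of_sq_le ?_
    rw [le_div_iff₀ ht]
    refine le_trans ?_ (Finset.single_le_sum (f := fun e => a e *
      ‖G.assemble x y (G.ends e).1 - G.assemble x y (G.ends e).2‖ ^ 2)
      (fun e _ => by have := ha e; positivity) (Finset.mem_univ e))
    rw [mul_comm]
    exact mul_le_mul_of_nonneg_right (hA e he) (sq_nonneg _)
  have h1 := norm_sub_le_of_reachable (Real.sqrt_nonneg _) he hr
  have h2 := hmin ⟨(i, j), hi, hj, hij⟩
  simp only [assemble, hi, hj, not_true_eq_false, dite_false] at h1
  have h3 : δ ≤ (nV + 1) * Real.sqrt (S / t) :=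
    (h2.trans h1).trans (mul_le_mul_of_nonneg_right (by linarith) (Real.sqrt_nonneg _))
  have h4 : δ / (nV + 1) ≤ Real.sqrt (S / t) := by
    rw [div_le_iff₀ (by positivity)]
    linarith
  have h5 : (δ / (nV + 1)) ^ 2 ≤ S / t := by
    calc _ ≤ Real.sqrt (S / t) ^ 2 := pow_le_pow_left₀ (by positivity) h4 2
      _ = S / t := Real.sq_sqrt (by positivity)
  rw [le_div_iff₀ ht] at h5
  rw [hy, mul_comm]
  exact mul_le_mul_of_nonneg_left h5 (psiTilde_pos hs ha).le

theorem phiTilde_pos {d : ℕ} (hs : G.Spans G.ext Finset.univ) (hJ : G.Joining Finset.univ)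
    {x : Fin nV → EuclideanSpace ℝ (Fin d)}
    (hx : ∀ v ∈ G.ext, ∀ w ∈ G.ext, v ≠ w → x v ≠ x w) {a : Fin nE → ℝ} (ha : ∀ e, 0 < a e) :
    0 < G.phiTilde x a := by
  obtain ⟨c, hc, h⟩ := exists_mul_psiTilde_le_phiTilde hs hx
  obtain ⟨t, ht, hta⟩ := exists_pos_forall_le a ha
  have := psiTilde_pos hs ha
  exact lt_of_lt_of_le (by positivity) (h a ha Finset.univ t ht (fun e _ => hta e) hJ)

theorem forestPoly_eq (p : Finset (Finset (Fin nV))) {α : Fin nE → ℝ} (hα : ∀ e, 0 < α e) :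
    G.forestPoly p α = (∏ e, α e) * G.dualForestPoly p α⁻¹ := by
  rw [forestPoly, dualForestPoly, Finset.mul_sum]
  refine Finset.sum_congr rfl fun F _ => ?_
  have h : ∏ e ∈ F, α e ≠ 0 := Finset.prod_ne_zero_iff.2 fun e _ => (hα e).ne'
  rw [← Finset.prod_sdiff (Finset.subset_univ F)]
  simp only [Pi.inv_apply, Finset.prod_inv_distrib]
  field_simp

theorem psiP_eq {α : Fin nE → ℝ} (hα : ∀ e, 0 < α e) :
    G.psiP α = (∏ e, α e) * G.psiTilde α⁻¹ := forestPoly_eq _ hα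

theorem phiP_eq {d : ℕ} (x : Fin nV → EuclideanSpace ℝ (Fin d)) {α : Fin nE → ℝ}
    (hα : ∀ e, 0 < α e) : G.phiP x α = (∏ e, α e) * G.phiTilde x α⁻¹ := by
  simp only [phiP, phiTilde, Finset.mul_sum, forestPoly_eq _ hα]
  refine Finset.sum_congr rfl fun i _ => Finset.sum_congr rfl fun j _ => ?_
  ring

theorem dualForestPoly_smul {p : Finset (Finset (Fin nV))} {k : ℕ}
    (hk : k + p.card = nV) (t : ℝ) (α : Fin nE → ℝ) :
    G.dualForestPoly p (t • α) = t ^ k * G.dualForestPoly p α := by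
  rw [dualForestPoly, dualForestPoly, Finset.mul_sum]
  refine Finset.sum_congr rfl fun F hF => ?_
  have hF' : F.card = k := by
    have := (Finset.mem_filter.1 hF).2.1
    omega
  simp [Finset.prod_mul_distrib, hF']

theorem psiTilde_smul (t : ℝ) (α : Fin nE → ℝ) :
    G.psiTilde (t • α) = t ^ G.intVerts.card * G.psiTilde α := by
  refine dualForestPoly_smul ?_ t α
  rw [singlePart, Finset.card_image_of_injective _ Finset.singleton_injective, card_intVerts,
    card_int_add_card_ext]

theorem phiTilde_smul {d : ℕ} (x : Fin nV → EuclideanSpace ℝ (Fin d)) (t : ℝ)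
    (α : Fin nE → ℝ) : G.phiTilde x (t • α) = t ^ (G.intVerts.card + 1) * G.phiTilde x α := by
  simp only [phiTilde, Finset.mul_sum]
  refine Finset.sum_congr rfl fun i hi => Finset.sum_congr rfl fun j hj => ?_
  rw [Finset.mem_filter] at hj
  rw [dualForestPoly_smul (k := G.intVerts.card + 1)]
  · ring
  · have h1 := card_pairPart hi hj.1 hj.2.ne
    have h2 := G.card_int_add_card_ext
    rw [card_intVerts]
    omega

end FeynmanGraph

open FeynmanGraph in
theorem setLIntegral_schwingerIntegrand {d nV m : ℕ} {G : FeynmanGraph nV (m + 1)}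
    (hM : 0 < G.Mdeg d) (hs : G.Spans G.ext Finset.univ) (hJ : G.Joining Finset.univ)
    {x : Fin nV → EuclideanSpace ℝ (Fin d)}
    (hx : ∀ v ∈ G.ext, ∀ w ∈ G.ext, v ≠ w → x v ≠ x w) :
    ∫⁻ α in {α : Fin (m + 1) → ℝ | ∀ e, 0 < α e}, ENNReal.ofReal (G.schwingerIntegrand x α) =
      ENNReal.ofReal (Real.Gamma (G.Mdeg d)) *
        ∫⁻ β in {β : {e : Fin (m + 1) // e ≠ 0} → ℝ | ∀ e, 0 < β e},
          ENNReal.ofReal (paramIntegrand d G x β) := by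
  rw [setLIntegral_pos_eq_chart _ (measurable_schwingerIntegrand x).ennreal_ofReal,
    ← lintegral_const_mul' _ _ ENNReal.ofReal_ne_top]
  have hmeas : MeasurableSet {β : {e : Fin (m + 1) // e ≠ 0} → ℝ | ∀ e, 0 < β e} := by
    rw [Set.ofPred_forall]
    exact MeasurableSet.iInter fun e => measurableSet_lt measurable_const (measurable_pi_apply e)
  refine setLIntegral_congr_fun hmeas fun β hβ => ?_
  have hα : ∀ e, 0 < chart β e := by
    intro e
    unfold chart
    split_ifs with h
    · exact one_pos
    · exact hβ ⟨e, h⟩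
  simp only [paramIntegrand]
  set α := chart β with hαdef
  have hα' : ∀ e, 0 < α⁻¹ e := fun e => inv_pos.2 (hα e)
  have hψ := psiTilde_pos hs hα'
  have hφ := phiTilde_pos hs hJ hx hα'
  set ψ := G.psiTilde α⁻¹
  set φ := G.phiTilde x α⁻¹
  have hP : 0 < ∏ e, α e := Finset.prod_pos fun e _ => hα e
  have hPs : 0 < ∏ e, α e ^ (-(lam d * G.ν e) - 1) :=
    Finset.prod_pos fun e _ => Real.rpow_pos_of_pos (hα e) _
  have hinner : ∀ t ∈ Set.Ioi (0 : ℝ), ENNReal.ofReal (t ^ m) *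
      ENNReal.ofReal (G.schwingerIntegrand x (t • α)) =
      ENNReal.ofReal ((∏ e, α e ^ (-(lam d * G.ν e) - 1)) * ψ ^ (-((d : ℝ) / 2))) *
        ENNReal.ofReal (t ^ (-(G.Mdeg d) - 1) * Real.exp (-(φ / ψ / t))) := by
    intro t ht
    have ht0 : 0 < t := ht
    have hinv : (t • α)⁻¹ = t⁻¹ • α⁻¹ := by
      funext e
      simp [mul_comm]
    rw [← ENNReal.ofReal_mul (by positivity), ← ENNReal.ofReal_mul (by positivity),
      schwingerIntegrand, hinv, psiTilde_smul, phiTilde_smul]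
    have h1 : t⁻¹ ^ (G.intVerts.card + 1) * φ / (t⁻¹ ^ G.intVerts.card * ψ) = φ / ψ / t := by
      rw [pow_succ]
      field_simp
    have h2 : ∏ e, (t • α) e ^ (-(lam d * G.ν e) - 1) =
        t ^ (-(lam d * ∑ e, G.ν e) - (m + 1)) * ∏ e, α e ^ (-(lam d * G.ν e) - 1) := by
      have : -(lam d * ∑ e, G.ν e) - (m + 1) = ∑ e, (-(lam d * G.ν e) - 1) := by
        rw [Finset.sum_sub_distrib, Finset.sum_neg_distrib, Finset.mul_sum]
        simp
      rw [this, Real.rpow_sum_of_pos ht0, ← Finset.prod_mul_distrib]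
      refine Finset.prod_congr rfl fun e _ => ?_
      rw [Pi.smul_apply, smul_eq_mul, Real.mul_rpow ht0.le (hα e).le]
    have h3 : (t⁻¹ ^ G.intVerts.card * ψ) ^ (-((d : ℝ) / 2)) =
        t ^ ((d : ℝ) / 2 * G.intVerts.card) * ψ ^ (-((d : ℝ) / 2)) := by
      rw [Real.mul_rpow (by positivity) hψ.le, ← Real.rpow_natCast, ← Real.rpow_neg_one,
        ← Real.rpow_mul ht0.le, ← Real.rpow_mul ht0.le]
      congr 2
      ring
    have h4 : t ^ m * (t ^ (-(lam d * ∑ e, G.ν e) - (m + 1)) *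
        t ^ ((d : ℝ) / 2 * G.intVerts.card)) = t ^ (-(G.Mdeg d) - 1) := by
      rw [← Real.rpow_natCast, ← Real.rpow_add ht0, ← Real.rpow_add ht0]
      congr 1
      rw [Mdeg]
      ring
    change ENNReal.ofReal (t ^ m * (_ * ((t⁻¹ ^ G.intVerts.card * ψ) ^ _ *
      Real.exp (-(t⁻¹ ^ (G.intVerts.card + 1) * φ / (t⁻¹ ^ G.intVerts.card * ψ)))))) = _
    rw [h1, h2, h3, ← h4]
    congr 1
    ring
  rw [setLIntegral_congr_fun measurableSet_Ioi hinner,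
    lintegral_const_mul' _ _ ENNReal.ofReal_ne_top,
    lintegral_rpow_mul_exp_neg_div hM (div_pos hφ hψ), ← ENNReal.ofReal_mul (by positivity),
    ← ENNReal.ofReal_mul (Real.Gamma_pos_of_pos hM).le, psiP_eq hα, phiP_eq x hα]
  change _ = ENNReal.ofReal (_ * (_ * (((∏ e, α e) * φ) ^ _ * ((∏ e, α e) * ψ) ^ _)))
  have h5 : ∏ e, α e ^ ((d : ℝ) / 2 - lam d * G.ν e - 1) =
      (∏ e, α e) ^ ((d : ℝ) / 2) * ∏ e, α e ^ (-(lam d * G.ν e) - 1) := by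
    rw [← Real.finsetProd_rpow _ _ fun e _ => (hα e).le, ← Finset.prod_mul_distrib]
    refine Finset.prod_congr rfl fun e _ => ?_
    rw [← Real.rpow_add (hα e)]
    congr 1
    ring
  have h6 : (∏ e, α e) ^ ((d : ℝ) / 2) = (∏ e, α e) ^ (G.Mdeg d) *
      (∏ e, α e) ^ ((d : ℝ) / 2 - G.Mdeg d) := by
    rw [← Real.rpow_add hP]
    congr 1
    ring
  have h7 : ψ ^ (-((d : ℝ) / 2 - G.Mdeg d)) = ψ ^ (-((d : ℝ) / 2)) * ψ ^ (G.Mdeg d) := by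
    rw [← Real.rpow_add hψ]
    congr 1
    ring
  rw [h5, h6, Real.mul_rpow hP.le hφ.le, Real.mul_rpow hP.le hψ.le, h7,
    Real.div_rpow hφ.le hψ.le, Real.rpow_neg hP.le, Real.rpow_neg hP.le,
    Real.rpow_neg hψ.le (Mdeg G d)]
  have := Real.rpow_pos_of_pos hP (G.Mdeg d)
  have := Real.rpow_pos_of_pos hP ((d : ℝ) / 2 - G.Mdeg d)
  have := Real.rpow_pos_of_pos hψ (G.Mdeg d)
  congr 1
  field_simp

namespace FeynmanGraph

variable {nV nE : ℕ} {G : FeynmanGraph nV nE}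

/-- The potentials on the vertices that vanish at the external vertices and are constant along
the edges in `A`. -/
def potentials (G : FeynmanGraph nV nE) (A : Finset (Fin nE)) : Submodule ℝ (Fin nV → ℝ) where
  carrier := {f | (∀ v ∈ G.ext, f v = 0) ∧ ∀ e ∈ A, f (G.ends e).1 = f (G.ends e).2}
  add_mem' := by
    rintro f g ⟨hf, hf'⟩ ⟨hg, hg'⟩
    exact ⟨fun v hv => by simp [hf v hv, hg v hv], fun e he => by simp [hf' e he, hg' e he]⟩
  zero_mem' := ⟨fun _ _ => rfl, fun _ _ => rfl⟩
  smul_mem' := by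
    rintro c f ⟨hf, hf'⟩
    exact ⟨fun v hv => by simp [hf v hv], fun e he => by simp [hf' e he]⟩

theorem mem_potentials {A : Finset (Fin nE)} {f : Fin nV → ℝ} :
    f ∈ G.potentials A ↔
      (∀ v ∈ G.ext, f v = 0) ∧ ∀ e ∈ A, f (G.ends e).1 = f (G.ends e).2 :=
  Iff.rfl

theorem potentials_anti {A B : Finset (Fin nE)} (h : A ⊆ B) : G.potentials B ≤ G.potentials A :=
  fun _ hf => ⟨hf.1, fun e he => hf.2 e (h he)⟩

theorem potentials_insert_eq {A B : Finset (Fin nE)} (h : G.potentials A = G.potentials B)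
    (e : Fin nE) : G.potentials (insert e A) = G.potentials (insert e B) := by
  have aux : ∀ C : Finset (Fin nE), ∀ f, f ∈ G.potentials (insert e C) ↔
      f (G.ends e).1 = f (G.ends e).2 ∧ f ∈ G.potentials C := by
    intro C f
    simp only [mem_potentials, Finset.forall_mem_insert]
    tauto
  ext f
  rw [aux, aux, h]

theorem finrank_potentials_le_insert (A : Finset (Fin nE)) (e : Fin nE) :
    Module.finrank ℝ (G.potentials A) ≤ Module.finrank ℝ (G.potentials (insert e A)) + 1 := by
  let φ : G.potentials A →ₗ[ℝ] ℝ :=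
    (LinearMap.proj (R := ℝ) (φ := fun _ => ℝ) (G.ends e).1 -
      LinearMap.proj (R := ℝ) (φ := fun _ => ℝ) (G.ends e).2) ∘ₗ (G.potentials A).subtype
  have h1 := LinearMap.finrank_range_add_finrank_ker φ
  have h2 : Module.finrank ℝ (LinearMap.range φ) ≤ 1 := by
    simpa using Submodule.finrank_le (LinearMap.range φ)
  have h3 : (LinearMap.ker φ).map (G.potentials A).subtype ≤ G.potentials (insert e A) := by
    rintro _ ⟨f, hf, rfl⟩
    have hf0 : (f : Fin nV → ℝ) (G.ends e).1 - (f : Fin nV → ℝ) (G.ends e).2 = 0 := hf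
    refine ⟨f.2.1, ?_⟩
    rw [Finset.forall_mem_insert]
    exact ⟨sub_eq_zero.1 hf0, f.2.2⟩
  have h4 := Submodule.finrank_mono h3
  rw [Submodule.finrank_map_subtype_eq] at h4
  omega

theorem Spans.potentials_eq_bot {A : Finset (Fin nE)} (hs : G.Spans G.ext A) :
    G.potentials A = ⊥ :=
  (Submodule.eq_bot_iff _).2 fun _ hf => hs.eq_zero hf.2 hf.1

theorem spans_of_potentials_eq_bot {A : Finset (Fin nE)} (h : G.potentials A = ⊥) :
    G.Spans G.ext A := by
  intro v
  by_contra! hv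
  have hf : (fun u => if (G.edgeGraph A).Reachable v u then (1 : ℝ) else 0) ∈
      G.potentials A := by
    refine ⟨fun w hw => if_neg (hv w hw), fun e he => ?_⟩
    have : (G.edgeGraph A).Reachable v (G.ends e).1 ↔ (G.edgeGraph A).Reachable v (G.ends e).2 :=
      ⟨fun h => h.trans (reachable_ends he), fun h => h.trans (reachable_ends he).symm⟩
    simp only [this]
  rw [h, Submodule.mem_bot] at hf
  simpa using congrFun hf v

theorem finrank_potentials_empty : Module.finrank ℝ (G.potentials ∅) = G.intVerts.card := by
  let φ : ({v : Fin nV // v ∉ G.ext} → ℝ) ≃ₗ[ℝ] G.potentials ∅ :=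
    { toFun := fun f => ⟨fun v => if h : v ∉ G.ext then f ⟨v, h⟩ else 0,
        fun v hv => by simp [hv], by simp⟩
      invFun := fun f v => (f : Fin nV → ℝ) v
      map_add' := fun f g => by
        ext v
        by_cases h : v ∈ G.ext <;> simp [h]
      map_smul' := fun c f => by
        ext v
        by_cases h : v ∈ G.ext <;> simp [h]
      left_inv := fun f => by
        ext v
        simp [v.2]
      right_inv := fun f => by
        ext v
        by_cases h : v ∈ G.ext
        · simp [h, f.2.1 v h]
        · simp [h] }
  rw [← φ.finrank_eq, Module.finrank_fintype_fun_eq_card, card_intVerts]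

/-- The vertices of a connected component of `(V, A)`. -/
def compVerts (G : FeynmanGraph nV nE) (A : Finset (Fin nE))
    (c : (G.edgeGraph A).ConnectedComponent) : Finset (Fin nV) :=
  Finset.univ.filter fun v => (G.edgeGraph A).connectedComponentMk v = c

/-- The connected components of `(V, A)` without external vertices. -/
def freeComps (G : FeynmanGraph nV nE) (A : Finset (Fin nE)) :
    Finset (G.edgeGraph A).ConnectedComponent :=
  Finset.univ.filter fun c => ∀ v ∈ G.ext, (G.edgeGraph A).connectedComponentMk v ≠ c

theorem mem_compVerts {A : Finset (Fin nE)} {c : (G.edgeGraph A).ConnectedComponent}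
    {v : Fin nV} : v ∈ G.compVerts A c ↔ (G.edgeGraph A).connectedComponentMk v = c := by
  simp [compVerts]

theorem mem_freeComps {A : Finset (Fin nE)} {c : (G.edgeGraph A).ConnectedComponent} :
    c ∈ G.freeComps A ↔ ∀ v ∈ G.ext, (G.edgeGraph A).connectedComponentMk v ≠ c := by
  simp [freeComps]

theorem connectedComponentMk_ends {A : Finset (Fin nE)} {e : Fin nE} (he : e ∈ A) :
    (G.edgeGraph A).connectedComponentMk (G.ends e).1 =
      (G.edgeGraph A).connectedComponentMk (G.ends e).2 :=
  SimpleGraph.ConnectedComponent.eq.2 (reachable_ends he)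

theorem finrank_potentials_le (A : Finset (Fin nE)) :
    Module.finrank ℝ (G.potentials A) ≤ (G.freeComps A).card := by
  let φ : G.potentials A →ₗ[ℝ] (G.freeComps A → ℝ) :=
    { toFun := fun f c => (f : Fin nV → ℝ) c.1.out
      map_add' := fun f g => rfl
      map_smul' := fun c f => rfl }
  have hφ : Function.Injective φ := by
    rw [← LinearMap.ker_eq_bot, LinearMap.ker_eq_bot']
    intro f hf
    ext v
    by_cases h : (G.edgeGraph A).connectedComponentMk v ∈ G.freeComps A
    · have h1 := congrFun hf ⟨_, h⟩
      have h2 : (G.edgeGraph A).Reachable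
          ((G.edgeGraph A).connectedComponentMk v).out v :=
        SimpleGraph.ConnectedComponent.eq.1 (Quot.out_eq _)
      rw [← eq_of_reachable f.2.2 h2]
      exact h1
    · rw [mem_freeComps] at h
      push Not at h
      obtain ⟨w, hw, hwv⟩ := h
      rw [← eq_of_reachable f.2.2 (SimpleGraph.ConnectedComponent.eq.1 hwv), f.2.1 w hw]
      rfl
  simpa using LinearMap.finrank_le_finrank_of_injective hφ

theorem sum_card_compVerts (A : Finset (Fin nE)) : ∑ c, (G.compVerts A c).card = nV := by
  have := Finset.card_eq_sum_card_fiberwise (s := Finset.univ) (t := Finset.univ)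
    (f := fun v => (G.edgeGraph A).connectedComponentMk v) (by simp)
  simpa [compVerts] using this.symm

theorem compVerts_nonempty (A : Finset (Fin nE)) (c : (G.edgeGraph A).ConnectedComponent) :
    (G.compVerts A c).Nonempty :=
  ⟨c.out, mem_compVerts.2 (Quot.out_eq _)⟩

theorem sum_edgesWithin_le {d : ℕ} (hUV : G.UVConvergent d) {S : Finset (Fin nV)}
    (hS : S.Nonempty) (hext : (S ∩ G.ext).card ≤ 1) :
    lam d * ∑ e ∈ G.edgesWithin S, G.ν e ≤ (d : ℝ) / 2 * ((S.card : ℝ) - 1) := by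
  rcases Nat.lt_or_ge S.card 2 with h | h
  · have h1 : S.card = 1 := by have := hS.card_pos; omega
    obtain ⟨v, rfl⟩ := Finset.card_eq_one.1 h1
    have : G.edgesWithin {v} = ∅ := by
      refine Finset.filter_eq_empty_iff.2 fun e _ he => G.ends_ne e ?_
      rw [Finset.mem_singleton.1 he.1, Finset.mem_singleton.1 he.2]
    simp [this]
  · exact (hUV S h hext).le

theorem sum_edgesWithin_lt {d : ℕ} (hUV : G.UVConvergent d) {S : Finset (Fin nV)}
    (hext : (S ∩ G.ext).card ≤ 1) {e : Fin nE} (he : e ∈ G.edgesWithin S) :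
    lam d * ∑ e ∈ G.edgesWithin S, G.ν e < (d : ℝ) / 2 * ((S.card : ℝ) - 1) := by
  refine hUV S ?_ hext
  obtain ⟨h1, h2⟩ := (Finset.mem_filter.1 he).2
  rw [← Finset.card_pair (G.ends_ne e)]
  exact Finset.card_le_card (by simp [Finset.insert_subset_iff, h1, h2])

theorem filter_subset_edgesWithin (A : Finset (Fin nE))
    (c : (G.edgeGraph A).ConnectedComponent) :
    (A.filter fun e => (G.edgeGraph A).connectedComponentMk (G.ends e).1 = c) ⊆
      G.edgesWithin (G.compVerts A c) := by
  intro e he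
  rw [Finset.mem_filter] at he
  simp only [edgesWithin, Finset.mem_filter, Finset.mem_univ, true_and, mem_compVerts]
  exact ⟨he.2, (connectedComponentMk_ends he.1).symm.trans he.2⟩

theorem sum_lt_of_not_joining {d : ℕ} (hd : 2 < d) (hUV : G.UVConvergent d)
    (hν : ∀ e, 0 < G.ν e) {A : Finset (Fin nE)} (hA : A.Nonempty) (hJ : ¬ G.Joining A) :
    lam d * ∑ e ∈ A, G.ν e < (d : ℝ) / 2 *
      ((G.intVerts.card : ℝ) - (Module.finrank ℝ (G.potentials A) : ℝ)) := by
  have hlam : 0 < lam d := by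
    have : (2 : ℝ) < d := by exact_mod_cast hd
    unfold lam
    linarith
  have hinj : ∀ v ∈ G.ext, ∀ w ∈ G.ext, (G.edgeGraph A).connectedComponentMk v =
      (G.edgeGraph A).connectedComponentMk w → v = w := by
    intro v hv w hw h
    by_contra hne
    exact hJ ⟨v, hv, w, hw, hne, SimpleGraph.ConnectedComponent.eq.1 h⟩
  have hone : ∀ c, (G.compVerts A c ∩ G.ext).card ≤ 1 := by
    intro c
    rw [Finset.card_le_one]
    intro v hv w hw
    rw [Finset.mem_inter, mem_compVerts] at hv hw
    exact hinj v hv.2 w hw.2 (hv.1.trans hw.1.symm)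
  have hfree : (G.freeComps A).card + G.ext.card =
      Fintype.card (G.edgeGraph A).ConnectedComponent := by
    have h1 : G.freeComps A =
        (G.ext.image fun v => (G.edgeGraph A).connectedComponentMk v)ᶜ := by
      ext c
      simp [mem_freeComps]
    rw [h1, Finset.card_compl, Finset.card_image_of_injOn fun v hv w hw h => hinj v hv w hw h]
    refine Nat.sub_add_cancel ?_
    rw [← Finset.card_image_of_injOn fun v hv w hw h => hinj v hv w hw h]
    exact Finset.card_le_univ _
  have hsplit : ∑ e ∈ A, G.ν e = ∑ c, ∑ e ∈ A with
      (G.edgeGraph A).connectedComponentMk (G.ends e).1 = c, G.ν e :=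
    (Finset.sum_fiberwise _ _ _).symm
  have hlt : lam d * ∑ e ∈ A, G.ν e <
      ∑ c, (d : ℝ) / 2 * (((G.compVerts A c).card : ℝ) - 1) := by
    rw [hsplit, Finset.mul_sum]
    have hle : ∀ c, ∑ e ∈ A with (G.edgeGraph A).connectedComponentMk (G.ends e).1 = c, G.ν e ≤
        ∑ e ∈ G.edgesWithin (G.compVerts A c), G.ν e := fun c =>
      Finset.sum_le_sum_of_subset_of_nonneg (filter_subset_edgesWithin A c)
        fun e _ _ => (hν e).le
    obtain ⟨e, he⟩ := hA
    refine Finset.sum_lt_sum (fun c _ => ?_)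
      ⟨(G.edgeGraph A).connectedComponentMk (G.ends e).1, Finset.mem_univ _, ?_⟩
    · exact (mul_le_mul_of_nonneg_left (hle c) hlam.le).trans
        (sum_edgesWithin_le hUV (compVerts_nonempty A c) (hone c))
    · exact (mul_le_mul_of_nonneg_left (hle _) hlam.le).trans_lt
        (sum_edgesWithin_lt hUV (hone _) (filter_subset_edgesWithin A _
          (Finset.mem_filter.2 ⟨he, rfl⟩)))
  refine hlt.trans_le ?_
  rw [← Finset.mul_sum]
  refine mul_le_mul_of_nonneg_left ?_ (by positivity)
  rw [Finset.sum_sub_distrib, Finset.sum_const, nsmul_eq_mul, mul_one, Finset.card_univ,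
    ← Nat.cast_sum, sum_card_compVerts, ← hfree, card_intVerts]
  have h1 : (Module.finrank ℝ (G.potentials A) : ℝ) ≤ (G.freeComps A).card := by
    exact_mod_cast finrank_potentials_le A
  have h2 : (Fintype.card {v : Fin nV // v ∉ G.ext} : ℝ) + G.ext.card = nV := by
    exact_mod_cast G.card_int_add_card_ext
  push_cast
  linarith

theorem finrank_lt_sum_compl {d : ℕ} (hd : 2 < d) (hUV : G.UVConvergent d)
    (hIR : G.IRConvergent d) (hν : ∀ e, 0 < G.ν e) {A : Finset (Fin nE)}
    (hA : A ≠ Finset.univ) :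
    (d : ℝ) / 2 * (Module.finrank ℝ (G.potentials A) : ℝ) < lam d * ∑ e ∈ Aᶜ, G.ν e := by
  have hlam : 0 < lam d := by
    have : (2 : ℝ) < d := by exact_mod_cast hd
    unfold lam
    linarith
  refine (mul_le_mul_of_nonneg_left (Nat.cast_le.2 (finrank_potentials_le A))
    (by positivity)).trans_lt ?_
  rcases (G.freeComps A).eq_empty_or_nonempty with h0 | h0
  · rw [h0, Finset.card_empty, Nat.cast_zero, mul_zero]
    refine mul_pos hlam (Finset.sum_pos (fun e _ => hν e) ?_)
    rwa [Finset.nonempty_iff_ne_empty, Ne, Finset.compl_eq_empty_iff]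
  set mk := (G.edgeGraph A).connectedComponentMk with hmk
  set S : Finset (Fin nV) := Finset.univ.filter fun v => mk v ∈ G.freeComps A with hS
  set X : Finset (Fin nE) := Finset.univ.filter fun e => (G.ends e).1 ∈ S ∨ (G.ends e).2 ∈ S
    with hX
  have hSint : ∀ v ∈ S, G.GInternal Finset.univ X v := by
    intro v hv
    refine ⟨fun hve => ?_, Finset.mem_univ _, fun e he => ?_⟩
    · rw [hS, Finset.mem_filter, mem_freeComps] at hv
      exact hv.2 v hve rfl
    · rw [hX, Finset.mem_filter]
      rcases he with he | he <;> simp [he, hv]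
  have hSsub : S ⊆ G.gInternalSet Finset.univ X := fun v hv =>
    Finset.mem_filter.2 ⟨Finset.mem_univ _, hSint v hv⟩
  have hSne : S.Nonempty := by
    obtain ⟨c, hc⟩ := h0
    exact ⟨c.out, Finset.mem_filter.2 ⟨Finset.mem_univ _, by
      rw [hmk, show (G.edgeGraph A).connectedComponentMk c.out = c from Quot.out_eq _]
      exact hc⟩⟩
  have hir := hIR Finset.univ X (fun _ _ => ⟨Finset.mem_univ _, Finset.mem_univ _⟩)
    (hSne.card_pos.trans_le (Finset.card_le_card hSsub))
    (fun e he => (Finset.mem_filter.1 he).2.imp (hSint _) (hSint _))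
  have hcard : (S.card : ℝ) = ∑ c ∈ G.freeComps A, ((G.compVerts A c).card : ℝ) := by
    rw [← Nat.cast_sum]
    congr 1
    rw [Finset.card_eq_sum_card_fiberwise (s := S) (t := G.freeComps A) (f := mk)
      (fun v hv => (Finset.mem_filter.1 hv).2)]
    refine Finset.sum_congr rfl fun c hc => ?_
    congr 1
    ext v
    rw [Finset.mem_filter, mem_compVerts, hS, Finset.mem_filter]
    constructor
    · exact fun h => h.2
    · exact fun h => ⟨⟨Finset.mem_univ _, by rw [hmk, h]; exact hc⟩, h⟩
  have hXA : ∀ e ∈ X ∩ A, mk (G.ends e).1 ∈ G.freeComps A := by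
    intro e he
    rw [Finset.mem_inter, hX, Finset.mem_filter, hS, Finset.mem_filter, Finset.mem_filter] at he
    rcases he.1.2 with h | h
    · exact h.2
    · rw [hmk, connectedComponentMk_ends he.2]
      exact h.2
  have hXsum : lam d * ∑ e ∈ X, G.ν e ≤ lam d * ∑ e ∈ Aᶜ, G.ν e +
      ∑ c ∈ G.freeComps A, (d : ℝ) / 2 * (((G.compVerts A c).card : ℝ) - 1) := by
    have h1 : ∑ e ∈ X, G.ν e ≤ ∑ e ∈ Aᶜ, G.ν e + ∑ e ∈ X ∩ A, G.ν e := by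
      rw [← Finset.sum_inter_add_sum_sdiff X A, add_comm]
      refine add_le_add_left (Finset.sum_le_sum_of_subset_of_nonneg (fun e he => ?_)
        fun e _ _ => (hν e).le) _
      rw [Finset.mem_compl]
      exact (Finset.mem_sdiff.1 he).2
    have h2 : ∑ e ∈ X ∩ A, G.ν e ≤
        ∑ c ∈ G.freeComps A, ∑ e ∈ G.edgesWithin (G.compVerts A c), G.ν e := by
      rw [← Finset.sum_fiberwise_of_maps_to hXA]
      refine Finset.sum_le_sum fun c _ => Finset.sum_le_sum_of_subset_of_nonneg ?_
        fun e _ _ => (hν e).le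
      refine (Finset.filter_subset_filter _ Finset.inter_subset_right).trans
        (filter_subset_edgesWithin A c)
    refine (mul_le_mul_of_nonneg_left (h1.trans (add_le_add_right h2 _)) hlam.le).trans ?_
    rw [mul_add, Finset.mul_sum (s := G.freeComps A)]
    refine add_le_add_right (Finset.sum_le_sum fun c hc => ?_) _
    refine sum_edgesWithin_le hUV (compVerts_nonempty A c) ?_
    rw [show G.compVerts A c ∩ G.ext = ∅ from ?_]
    · simp
    · refine Finset.eq_empty_of_forall_notMem fun v hv => ?_
      rw [Finset.mem_inter, mem_compVerts] at hv
      exact mem_freeComps.1 hc v hv.2 hv.1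
  have hSc : (d : ℝ) / 2 * (S.card : ℝ) ≤
      (d : ℝ) / 2 * ((G.gInternalSet Finset.univ X).card : ℝ) :=
    mul_le_mul_of_nonneg_left (Nat.cast_le.2 (Finset.card_le_card hSsub)) (by positivity)
  rw [← Finset.mul_sum, Finset.sum_sub_distrib, ← hcard, Finset.sum_const, nsmul_eq_mul,
    mul_one, mul_sub] at hXsum
  linarith

end FeynmanGraph

/-- Summation by parts against an antitone sequence `L`, when the coefficients `g` are at most
`-δ` up to the index `p` and at most `M - δ` afterwards. -/
theorem sum_range_sub_mul_le {g L : ℕ → ℝ} {M δ : ℝ} {p m : ℕ} (hpm : p ≤ m)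
    (hL : ∀ i < m, L (i + 1) ≤ L i) (h0 : g 0 = 0) (hM : g (m + 1) = M)
    (h1 : ∀ i < p, g (i + 1) ≤ -δ) (h2 : ∀ i < m, g (i + 1) ≤ M - δ) :
    ∑ i ∈ Finset.range (m + 1), (g (i + 1) - g i) * L i ≤ M * L p - δ * (L 0 - L m) := by
  have hstep : ∀ j, ∑ i ∈ Finset.range (j + 1), (g (i + 1) - g i) * L i - g (j + 1) * L (j + 1) =
      ∑ i ∈ Finset.range j, (g (i + 1) - g i) * L i - g j * L j +
        g (j + 1) * (L j - L (j + 1)) := by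
    intro j
    rw [Finset.sum_range_succ]
    ring
  have hlow : ∀ j ≤ p, ∑ i ∈ Finset.range j, (g (i + 1) - g i) * L i - g j * L j ≤
      -δ * (L 0 - L j) := by
    intro j
    induction j with
    | zero => simp [h0]
    | succ j ih =>
      intro hj
      have h3 := ih (by omega)
      have h4 := mul_le_mul_of_nonneg_right (h1 j hj) (sub_nonneg.2 (hL j (by omega)))
      rw [hstep]
      linarith
  have hhigh : ∀ k, p + k ≤ m →
      ∑ i ∈ Finset.range (p + k), (g (i + 1) - g i) * L i - g (p + k) * L (p + k) ≤
      -δ * (L 0 - L p) + (M - δ) * (L p - L (p + k)) := by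
    intro k
    induction k with
    | zero => exact fun _ => by simpa using hlow p le_rfl
    | succ k ih =>
      intro hk
      have h3 := ih (by omega)
      have h4 := mul_le_mul_of_nonneg_right (h2 (p + k) (by omega))
        (sub_nonneg.2 (hL (p + k) (by omega)))
      rw [← add_assoc, hstep]
      linarith
  obtain ⟨k, rfl⟩ := Nat.exists_eq_add_of_le hpm
  have h5 := hhigh k le_rfl
  rw [Finset.sum_range_succ, hM]
  linarith

theorem exists_mul_add_mul_abs_sub_exp_le {M δ c : ℝ} (hδM : δ ≤ M) (hc : 0 < c) :
    ∃ C, ∀ t : ℝ, M * t + δ * |t| - c * Real.exp t ≤ C := by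
  refine ⟨(M + δ) ^ 2 / (2 * c), fun t => ?_⟩
  have hC : 0 ≤ (M + δ) ^ 2 / (2 * c) := by positivity
  rcases le_total t 0 with ht | ht
  · rw [abs_of_nonpos ht]
    have h1 : (M - δ) * t ≤ 0 := mul_nonpos_of_nonneg_of_nonpos (by linarith) ht
    have h2 : 0 < c * Real.exp t := by positivity
    linarith
  · rw [abs_of_nonneg ht]
    have h1 := mul_le_mul_of_nonneg_left (Real.quadratic_le_exp_of_nonneg ht) hc.le
    have h2 : 0 ≤ c * (1 + t) := by positivity
    rw [le_div_iff₀ (by positivity)]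
    nlinarith [sq_nonneg (M + δ - c * t)]

namespace FeynmanGraph

variable {nV nE : ℕ} {G : FeynmanGraph nV nE}

/-- The greedy algorithm: along an exhaustion of the edges, the edges at which the space of
potentials shrinks form a spanning forest. -/
theorem exists_forest_of_exhaustion (hs : G.Spans G.ext Finset.univ) {N : ℕ}
    {A : ℕ → Finset (Fin nE)} {e : ℕ → Fin nE} (h0 : A 0 = ∅) (hN : A N = Finset.univ)
    (hsucc : ∀ i < N, A (i + 1) = insert (e i) (A i)) (he : ∀ i < N, e i ∉ A i) :
    ∃ F ∈ G.forests G.singlePart, ∀ L : Fin nE → ℝ, ∑ e ∈ F, L e =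
      ∑ i ∈ Finset.range N, ((Module.finrank ℝ (G.potentials (A i)) : ℝ) -
        Module.finrank ℝ (G.potentials (A (i + 1)))) * L (e i) := by
  have key : ∀ j ≤ N, ∃ F ⊆ A j, G.potentials F = G.potentials (A j) ∧
      ∀ L : Fin nE → ℝ, ∑ e ∈ F, L e =
        ∑ i ∈ Finset.range j, ((Module.finrank ℝ (G.potentials (A i)) : ℝ) -
          Module.finrank ℝ (G.potentials (A (i + 1)))) * L (e i) := by
    intro j
    induction j with
    | zero => exact fun _ => ⟨∅, by simp, by rw [h0], by simp⟩
    | succ j ih =>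
      intro hj
      obtain ⟨F, hFA, hF, hFL⟩ := ih (by omega)
      have hA := hsucc j hj
      have hsub : A j ⊆ A (j + 1) := by
        rw [hA]
        exact Finset.subset_insert _ _
      have hle := Submodule.finrank_mono (G.potentials_anti hsub)
      have hge := G.finrank_potentials_le_insert (A j) (e j)
      rw [← hA] at hge
      by_cases hk : Module.finrank ℝ (G.potentials (A (j + 1))) =
          Module.finrank ℝ (G.potentials (A j))
      · refine ⟨F, hFA.trans hsub, ?_, fun L => ?_⟩
        · rw [hF, Submodule.eq_of_le_of_finrank_eq (G.potentials_anti hsub) hk]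
        · rw [Finset.sum_range_succ, hFL, hk]
          simp
      · have hk' : Module.finrank ℝ (G.potentials (A j)) =
            Module.finrank ℝ (G.potentials (A (j + 1))) + 1 := by omega
        refine ⟨insert (e j) F, ?_, ?_, fun L => ?_⟩
        · rw [hA]
          exact Finset.insert_subset_insert _ hFA
        · rw [potentials_insert_eq hF, hA]
        · rw [Finset.sum_insert fun h => he j hj (hFA h), Finset.sum_range_succ, hFL, hk']
          push_cast
          ring
  obtain ⟨F, -, hF, hFL⟩ := key N le_rfl
  refine ⟨F, ?_, hFL⟩
  have hbot : G.potentials Finset.univ = ⊥ := hs.potentials_eq_bot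
  rw [forests, Finset.mem_filter, isForest_singlePart_iff]
  refine ⟨Finset.mem_univ _, ?_, spans_of_potentials_eq_bot (by rw [hF, hN, hbot])⟩
  have hcard := hFL fun _ => 1
  simp only [mul_one, Finset.sum_const, nsmul_eq_mul] at hcard
  rw [Finset.sum_range_sub' fun i => (Module.finrank ℝ (G.potentials (A i)) : ℝ), h0, hN, hbot,
    finrank_bot, finrank_potentials_empty, Nat.cast_zero, sub_zero, Nat.cast_inj,
    card_intVerts] at hcard
  rw [hcard, card_int_add_card_ext]

theorem prod_le_psiTilde {F : Finset (Fin nE)} (hF : F ∈ G.forests G.singlePart)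
    {a : Fin nE → ℝ} (ha : ∀ e, 0 < a e) : ∏ e ∈ F, a e ≤ G.psiTilde a :=
  Finset.single_le_sum (f := fun F => ∏ e ∈ F, a e)
    (fun _ _ => Finset.prod_nonneg fun e _ => (ha e).le) hF

end FeynmanGraph

theorem exists_antitone_exhaustion {m : ℕ} (a : Fin (m + 1) → ℝ) :
    ∃ (A : ℕ → Finset (Fin (m + 1))) (e : ℕ → Fin (m + 1)), A 0 = ∅ ∧
      A (m + 1) = Finset.univ ∧ (∀ i < m + 1, A (i + 1) = insert (e i) (A i)) ∧
      (∀ i < m + 1, e i ∉ A i) ∧ (∀ i < m + 1, ∀ e' ∈ A (i + 1), a (e i) ≤ a e') ∧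
      (∀ i < m + 1, ∀ j ≤ i, a (e i) ≤ a (e j)) ∧ (∀ f, ∃ i < m + 1, e i = f) ∧
      ∀ h : Fin (m + 1) → ℝ, ∑ f, h f = ∑ i ∈ Finset.range (m + 1), h (e i) := by
  set σ := Tuple.sort fun e => -a e with hσ
  have hmono : Monotone ((fun e => -a e) ∘ σ) := Tuple.monotone_sort _
  have hval : ∀ i < m + 1, ((Fin.ofNat (m + 1) i : Fin (m + 1)) : ℕ) = i := fun i hi =>
    Nat.mod_eq_of_lt hi
  have hle : ∀ i < m + 1, ∀ k : Fin (m + 1), (k : ℕ) ≤ i →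
      a (σ (Fin.ofNat (m + 1) i)) ≤ a (σ k) := by
    intro i hi k hk
    have : k ≤ Fin.ofNat (m + 1) i := by
      rw [Fin.le_def, hval i hi]
      exact hk
    exact neg_le_neg_iff.1 (hmono this)
  refine ⟨fun i => Finset.univ.filter fun f => (σ.symm f : ℕ) < i,
    fun i => σ (Fin.ofNat (m + 1) i), by simp, ?_, fun i hi => ?_, fun i hi => ?_,
    fun i hi f hf => ?_, fun i hi j hj => ?_, fun f => ?_, fun h => ?_⟩
  · ext f
    simp only [Finset.mem_filter, Finset.mem_univ, true_and, iff_true]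
    exact (σ.symm f).2
  · ext f
    simp only [Finset.mem_filter, Finset.mem_univ, true_and, Finset.mem_insert,
      ← Equiv.symm_apply_eq, Fin.ext_iff, hval i hi]
    omega
  · simp only [Finset.mem_filter, Finset.mem_univ, true_and, Equiv.symm_apply_apply, hval i hi]
    omega
  · simp only [Finset.mem_filter, Finset.mem_univ, true_and] at hf
    simpa using hle i hi (σ.symm f) (by omega)
  · exact hle i hi _ (by rw [hval j (by omega)]; exact hj)
  · exact ⟨σ.symm f, (σ.symm f).2, by simp⟩
  · rw [← Equiv.sum_comp σ h, ← Fin.sum_univ_eq_sum_range (fun i => h (σ (Fin.ofNat (m + 1) i)))]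
    simp


namespace FeynmanGraph

variable {d nV m : ℕ} {G : FeynmanGraph nV (m + 1)}

/-- The gap by which the convergence conditions hold. -/
theorem exists_gap (hd : 2 < d) (hUV : G.UVConvergent d) (hIR : G.IRConvergent d)
    (hM : 0 < G.Mdeg d) (hν : ∀ e, 0 < G.ν e) :
    ∃ δ > 0, δ ≤ G.Mdeg d ∧
      (∀ A : Finset (Fin (m + 1)), A.Nonempty → ¬ G.Joining A →
        lam d * ∑ e ∈ A, G.ν e - (d : ℝ) / 2 *
          ((G.intVerts.card : ℝ) - Module.finrank ℝ (G.potentials A)) ≤ -δ) ∧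
      ∀ A : Finset (Fin (m + 1)), A ≠ Finset.univ →
        lam d * ∑ e ∈ A, G.ν e - (d : ℝ) / 2 *
          ((G.intVerts.card : ℝ) - Module.finrank ℝ (G.potentials A)) ≤ G.Mdeg d - δ := by
  obtain ⟨δ₁, hδ₁, h₁⟩ := exists_pos_forall_le
    (fun A : {A : Finset (Fin (m + 1)) // A.Nonempty ∧ ¬ G.Joining A} => (d : ℝ) / 2 *
      ((G.intVerts.card : ℝ) - Module.finrank ℝ (G.potentials A.1)) - lam d * ∑ e ∈ A.1, G.ν e)
    (fun A => sub_pos.2 (sum_lt_of_not_joining hd hUV hν A.2.1 A.2.2))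
  obtain ⟨δ₂, hδ₂, h₂⟩ := exists_pos_forall_le
    (fun A : {A : Finset (Fin (m + 1)) // A ≠ Finset.univ} => lam d * ∑ e ∈ A.1ᶜ, G.ν e -
      (d : ℝ) / 2 * Module.finrank ℝ (G.potentials A.1))
    (fun A => sub_pos.2 (finrank_lt_sum_compl hd hUV hIR hν A.2))
  refine ⟨min (min δ₁ δ₂) (G.Mdeg d), lt_min (lt_min hδ₁ hδ₂) hM, min_le_right _ _,
    fun A hA hJ => ?_, fun A hA => ?_⟩
  · have h := h₁ ⟨A, hA, hJ⟩
    have h' : min (min δ₁ δ₂) (G.Mdeg d) ≤ δ₁ := (min_le_left _ _).trans (min_le_left _ _)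
    simp only at h
    linarith
  · have h := h₂ ⟨A, hA⟩
    have h' : min (min δ₁ δ₂) (G.Mdeg d) ≤ δ₂ := (min_le_left _ _).trans (min_le_right _ _)
    simp only at h
    have hMd : G.Mdeg d = lam d * (∑ e ∈ A, G.ν e + ∑ e ∈ Aᶜ, G.ν e) -
        (d : ℝ) / 2 * G.intVerts.card := by
      rw [Finset.sum_add_sum_compl, Mdeg]
    linarith

theorem exists_integrand_le (hd : 2 < d) (hUV : G.UVConvergent d) (hIR : G.IRConvergent d)
    (hM : 0 < G.Mdeg d) (hν : ∀ e, 0 < G.ν e) (hs : G.Spans G.ext Finset.univ)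
    (hJ : G.Joining Finset.univ) {x : Fin nV → EuclideanSpace ℝ (Fin d)}
    (hx : ∀ v ∈ G.ext, ∀ w ∈ G.ext, v ≠ w → x v ≠ x w) :
    ∃ C, ∃ ε > 0, ∀ a : Fin (m + 1) → ℝ, (∀ e, 0 < a e) →
      (∏ e, a e ^ (lam d * G.ν e)) * (G.psiTilde a ^ (-((d : ℝ) / 2)) *
        Real.exp (-(G.phiTilde x a / G.psiTilde a))) ≤
      Real.exp C * ∏ e, Real.exp (-(ε * |Real.log (a e)|)) := by
  obtain ⟨δ, hδ, hδM, hgap₁, hgap₂⟩ := exists_gap hd hUV hIR hM hν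
  obtain ⟨c, hc, hphi⟩ := exists_mul_psiTilde_le_phiTilde hs hx
  obtain ⟨C, hC⟩ := exists_mul_add_mul_abs_sub_exp_le hδM hc
  refine ⟨C, δ / (m + 1), by positivity, fun a ha => ?_⟩
  obtain ⟨A, e, hA0, hAm, hsucc, hnot, hmin, hanti, hsurj, hsum⟩ := exists_antitone_exhaustion a
  obtain ⟨F, hF, hFL⟩ := G.exists_forest_of_exhaustion hs hA0 hAm hsucc hnot
  set L : Fin (m + 1) → ℝ := fun f => Real.log (a f) with hL
  set g : ℕ → ℝ := fun i => lam d * ∑ e ∈ A i, G.ν e - (d : ℝ) / 2 *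
    ((G.intVerts.card : ℝ) - Module.finrank ℝ (G.potentials (A i))) with hg
  have hex : ∃ p, G.Joining (A (p + 1)) := ⟨m, by rw [hAm]; exact hJ⟩
  set p := Nat.find hex with hp
  have hpJ : G.Joining (A (p + 1)) := Nat.find_spec hex
  have hpm : p ≤ m := Nat.find_min' hex (by rw [hAm]; exact hJ)
  have hpsi := psiTilde_pos hs ha
  have habel : ∑ i ∈ Finset.range (m + 1), (g (i + 1) - g i) * L (e i) ≤
      G.Mdeg d * L (e p) - δ * (L (e 0) - L (e m)) := by
    refine sum_range_sub_mul_le (L := fun i => L (e i)) hpm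
      (fun i hi => Real.log_le_log (ha _) (hanti _ (by omega) _ (by omega))) ?_ ?_
      (fun i hi => ?_) fun i hi => ?_
    · simp only [hg]
      rw [hA0, finrank_potentials_empty]
      simp
    · simp only [hg]
      rw [hAm, hs.potentials_eq_bot, finrank_bot, Mdeg]
      simp
    · refine hgap₁ _ ?_ (Nat.find_min hex hi)
      rw [hsucc i (by omega)]
      exact Finset.insert_nonempty _ _
    · refine hgap₂ _ fun h => ?_
      have hmono : ∀ k, i + 1 + k ≤ m → A (i + 1) ⊆ A (i + 1 + k) := by
        intro k
        induction k with
        | zero => exact fun _ => subset_rfl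
        | succ k ih =>
          intro hk
          refine (ih (by omega)).trans ?_
          rw [← add_assoc, hsucc _ (by omega)]
          exact Finset.subset_insert _ _
      refine hnot m (by omega) ?_
      have := hmono (m - (i + 1)) (by omega)
      rw [show i + 1 + (m - (i + 1)) = m by omega, h] at this
      exact this (Finset.mem_univ _)
  have hlogs : lam d * ∑ f, G.ν f * L f - (d : ℝ) / 2 * ∑ f ∈ F, L f =
      ∑ i ∈ Finset.range (m + 1), (g (i + 1) - g i) * L (e i) := by
    rw [hFL L, hsum fun f => G.ν f * L f, Finset.mul_sum, Finset.mul_sum,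
      ← Finset.sum_sub_distrib]
    refine Finset.sum_congr rfl fun i hi => ?_
    have hi' := Finset.mem_range.1 hi
    have hν' : ∑ f ∈ A (i + 1), G.ν f = G.ν (e i) + ∑ f ∈ A i, G.ν f := by
      rw [hsucc i hi', Finset.sum_insert (hnot i hi')]
    simp only [hg, hν']
    ring
  have hprod : ∏ f, a f ^ (lam d * G.ν f) = Real.exp (lam d * ∑ f, G.ν f * L f) := by
    rw [Finset.mul_sum, Real.exp_sum]
    refine Finset.prod_congr rfl fun f _ => ?_
    rw [Real.rpow_def_of_pos (ha f)]
    congr 1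
    ring
  have hpsile : G.psiTilde a ^ (-((d : ℝ) / 2)) ≤ Real.exp (-((d : ℝ) / 2 * ∑ f ∈ F, L f)) := by
    have h1 : ∏ f ∈ F, a f = Real.exp (∑ f ∈ F, L f) := by
      rw [Real.exp_sum]
      exact Finset.prod_congr rfl fun f _ => (Real.exp_log (ha f)).symm
    refine (Real.rpow_le_rpow_of_nonpos (Finset.prod_pos fun f _ => ha f)
      (prod_le_psiTilde hF ha) (by simp only [Left.neg_nonpos_iff]; positivity)).trans ?_
    rw [h1, ← Real.exp_mul]
    exact le_of_eq (congrArg _ (by ring))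
  have hratio : c * Real.exp (L (e p)) ≤ G.phiTilde x a / G.psiTilde a := by
    rw [le_div_iff₀ hpsi, hL, Real.exp_log (ha _)]
    exact hphi a ha (A (p + 1)) _ (ha _) (hmin p (by omega)) hpJ
  have hbound : ∀ f, |L f| ≤ |L (e p)| + (L (e 0) - L (e m)) := by
    intro f
    obtain ⟨i, hi, rfl⟩ := hsurj f
    have hlog : ∀ i < m + 1, ∀ j ≤ i, L (e i) ≤ L (e j) := fun i hi j hj =>
      Real.log_le_log (ha _) (hanti i hi j hj)
    have b1 := hlog i hi 0 (by omega)
    have b2 := hlog m (by omega) i (by omega)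
    have b3 := hlog p (by omega) 0 (by omega)
    have b4 := hlog m (by omega) p (by omega)
    have b5 := neg_abs_le (L (e p))
    have b6 := le_abs_self (L (e p))
    exact abs_le.2 ⟨by linarith, by linarith⟩
  have hsumabs : δ / (m + 1) * ∑ f, |L f| ≤ δ * (|L (e p)| + (L (e 0) - L (e m))) := by
    have h1 : ∑ f, |L f| ≤ (m + 1) * (|L (e p)| + (L (e 0) - L (e m))) := by
      refine (Finset.sum_le_card_nsmul _ _ _ fun f _ => hbound f).trans (le_of_eq ?_)
      simp [mul_add]
    refine (mul_le_mul_of_nonneg_left h1 (by positivity)).trans (le_of_eq ?_)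
    field_simp
  rw [hprod, ← Real.exp_sum, ← Real.exp_add]
  calc _ ≤ Real.exp (lam d * ∑ f, G.ν f * L f) *
        (Real.exp (-((d : ℝ) / 2 * ∑ f ∈ F, L f)) * Real.exp (-(c * Real.exp (L (e p))))) := by
        gcongr
    _ = Real.exp (lam d * ∑ f, G.ν f * L f - (d : ℝ) / 2 * ∑ f ∈ F, L f -
          c * Real.exp (L (e p))) := by
        rw [← Real.exp_add, ← Real.exp_add]
        congr 1
        ring
    _ ≤ _ := by
        rw [Real.exp_le_exp, hlogs, Finset.sum_neg_distrib, ← Finset.mul_sum]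
        have := hC (L (e p))
        linarith

/-- The Schwinger parametric integral of a convergent graph is finite. -/
theorem setLIntegral_schwingerIntegrand_lt_top (hd : 2 < d) (hUV : G.UVConvergent d)
    (hIR : G.IRConvergent d) (hM : 0 < G.Mdeg d) (hν : ∀ e, 0 < G.ν e)
    (hs : G.Spans G.ext Finset.univ) (hJ : G.Joining Finset.univ)
    {x : Fin nV → EuclideanSpace ℝ (Fin d)}
    (hx : ∀ v ∈ G.ext, ∀ w ∈ G.ext, v ≠ w → x v ≠ x w) :
    ∫⁻ α in {α : Fin (m + 1) → ℝ | ∀ e, 0 < α e},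
      ENNReal.ofReal (G.schwingerIntegrand x α) < ∞ := by
  obtain ⟨C, ε, hε, hle⟩ := exists_integrand_le hd hUV hIR hM hν hs hJ hx
  have hset : {α : Fin (m + 1) → ℝ | ∀ e, 0 < α e} = Set.univ.pi fun _ => Set.Ioi 0 := by
    ext α
    simp
  have hmeas : MeasurableSet {α : Fin (m + 1) → ℝ | ∀ e, 0 < α e} := by
    rw [hset]
    exact MeasurableSet.univ_pi fun _ => measurableSet_Ioi
  have hvol : (volume : Measure (Fin (m + 1) → ℝ)).restrict {α | ∀ e, 0 < α e} =
      Measure.pi fun _ => (volume : Measure ℝ).restrict (Set.Ioi 0) := by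
    rw [hset, volume_pi, Measure.restrict_pi_pi]
  calc ∫⁻ α in {α : Fin (m + 1) → ℝ | ∀ e, 0 < α e},
        ENNReal.ofReal (G.schwingerIntegrand x α)
      ≤ ∫⁻ α in {α : Fin (m + 1) → ℝ | ∀ e, 0 < α e}, ENNReal.ofReal (Real.exp C) *
          ∏ e, ENNReal.ofReal ((α e)⁻¹ * Real.exp (-(ε * |Real.log (α e)|))) := by
        refine setLIntegral_mono' hmeas fun α hα => ?_
        have hα' : ∀ e, 0 < α e := hα
        rw [← ENNReal.ofReal_prod_of_nonneg fun e _ => by have := hα' e; positivity,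
          ← ENNReal.ofReal_mul (Real.exp_pos _).le]
        refine ENNReal.ofReal_le_ofReal ?_
        have h1 := hle α⁻¹ fun e => inv_pos.2 (hα' e)
        have h2 : ∏ e, α e ^ (-(lam d * G.ν e) - 1) =
            (∏ e, (α e)⁻¹) * ∏ e, α⁻¹ e ^ (lam d * G.ν e) := by
          rw [← Finset.prod_mul_distrib]
          refine Finset.prod_congr rfl fun e _ => ?_
          rw [Real.rpow_sub_one (hα' e).ne', Real.rpow_neg (hα' e).le, Pi.inv_apply,
            Real.inv_rpow (hα' e).le]
          ring
        simp only [Pi.inv_apply, Real.log_inv, abs_neg] at h1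
        rw [schwingerIntegrand, h2, Finset.prod_mul_distrib, mul_assoc, mul_left_comm (Real.exp C)]
        exact mul_le_mul_of_nonneg_left h1 (Finset.prod_nonneg fun e _ => (inv_pos.2 (hα' e)).le)
    _ = ENNReal.ofReal (Real.exp C) * ∏ _e : Fin (m + 1), ∫⁻ t in Set.Ioi (0 : ℝ),
          ENNReal.ofReal (t⁻¹ * Real.exp (-(ε * |Real.log t|))) := by
        rw [lintegral_const_mul _ (by fun_prop), hvol]
        congr 1
        exact lintegral_pi_prod_eq_prod (volume.restrict (Set.Ioi (0 : ℝ)))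
          (fun _ t => ENNReal.ofReal (t⁻¹ * Real.exp (-(ε * |Real.log t|))))
          fun _ => by fun_prop
    _ < ∞ := ENNReal.mul_lt_top ENNReal.ofReal_lt_top
        (ENNReal.prod_lt_top fun _ _ => lintegral_inv_mul_exp_neg_abs_log_lt_top hε)

end FeynmanGraph

theorem measurable_paramIntegrand {d nV m : ℕ} (G : FeynmanGraph nV (m + 1))
    (x : Fin nV → EuclideanSpace ℝ (Fin d)) : Measurable (paramIntegrand d G x) := by
  have hc : ∀ e, Measurable fun β : {e : Fin (m + 1) // e ≠ 0} → ℝ => chart β e := fun e =>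
    (measurable_pi_apply e).comp measurable_chart
  unfold paramIntegrand FeynmanGraph.phiP FeynmanGraph.psiP FeynmanGraph.forestPoly
  fun_prop

theorem paramIntegrand_nonneg {d nV m : ℕ} (G : FeynmanGraph nV (m + 1))
    (x : Fin nV → EuclideanSpace ℝ (Fin d)) {β : {e : Fin (m + 1) // e ≠ 0} → ℝ}
    (hβ : ∀ e, 0 < β e) : 0 ≤ paramIntegrand d G x β := by
  have hc : ∀ e, 0 ≤ chart β e := by
    intro e
    unfold chart
    split_ifs
    exacts [zero_le_one, (hβ _).le]
  have hpoly : ∀ p, 0 ≤ G.forestPoly p (chart β) := fun p =>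
    Finset.sum_nonneg fun F _ => Finset.prod_nonneg fun e _ => hc e
  refine mul_nonneg (Finset.prod_nonneg fun e _ => Real.rpow_nonneg (hc e) _)
    (mul_nonneg (Real.rpow_nonneg ?_ _) (Real.rpow_nonneg (hpoly _) _))
  exact Finset.sum_nonneg fun i _ => Finset.sum_nonneg fun j _ =>
    mul_nonneg (sq_nonneg _) (hpoly _)

/-- The parametric representation of position-space Feynman
integrals: for a convergent graph (ultraviolet and infrared convergent, `M_G > 0`,
all edge weights positive, every connected component containing an external vertex,
two external vertices in a common component) and pairwise distinct external
positions `x`, the affine parametric integral converges absolutely and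
`f_G(x) = (Γ(M_G)/∏_e Γ(λν_e)) ∫_{(0,∞)^{E-1}} paramIntegrand`. -/
theorem parametric_representation {d nV m : ℕ} (hd : 2 < d)
    (G : FeynmanGraph nV (m + 1))
    (hUV : G.UVConvergent d) (hIR : G.IRConvergent d)
    (hM : 0 < G.Mdeg d)
    (hν : ∀ e, 0 < G.ν e)
    (hcomp : ∀ v : Fin nV, ∃ w ∈ G.ext, (G.edgeGraph Finset.univ).Reachable v w)
    (hconn : ∃ i ∈ G.ext, ∃ j ∈ G.ext, i ≠ j ∧ (G.edgeGraph Finset.univ).Reachable i j)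
    (x : Fin nV → EuclideanSpace ℝ (Fin d))
    (hx : ∀ v ∈ G.ext, ∀ w ∈ G.ext, v ≠ w → x v ≠ x w) :
    IntegrableOn (paramIntegrand d G x)
      {β : {e : Fin (m + 1) // e ≠ 0} → ℝ | ∀ e, 0 < β e} volume ∧
    G.posIntegral d x =
      ENNReal.ofReal
        ((Real.Gamma (G.Mdeg d) / ∏ e, Real.Gamma (lam d * G.ν e)) *
          ∫ β in {β : {e : Fin (m + 1) // e ≠ 0} → ℝ | ∀ e, 0 < β e},
            paramIntegrand d G x β) := by
  have hkey := (G.posIntegral_mul_prod_Gamma hd hν hcomp hx).trans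
    (setLIntegral_schwingerIntegrand hM hcomp hconn hx)
  have hΓM : 0 < Real.Gamma (G.Mdeg d) := Real.Gamma_pos_of_pos hM
  have hlam : 0 < lam d := by
    have : (2 : ℝ) < d := by exact_mod_cast hd
    unfold lam
    linarith
  have hΓ : 0 < ∏ e, Real.Gamma (lam d * G.ν e) :=
    Finset.prod_pos fun e _ => Real.Gamma_pos_of_pos (mul_pos hlam (hν e))
  have hfin := G.setLIntegral_schwingerIntegrand_lt_top hd hUV hIR hM hν hcomp hconn hx
  rw [setLIntegral_schwingerIntegrand hM hcomp hconn hx] at hfin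
  have hfin' : ∫⁻ β in {β : {e : Fin (m + 1) // e ≠ 0} → ℝ | ∀ e, 0 < β e},
      ENNReal.ofReal (paramIntegrand d G x β) < ∞ :=
    ENNReal.lt_top_of_mul_ne_top_right hfin.ne (by simpa using hΓM)
  have hmeas : MeasurableSet {β : {e : Fin (m + 1) // e ≠ 0} → ℝ | ∀ e, 0 < β e} := by
    measurability
  have hnn : 0 ≤ᵐ[volume.restrict {β : {e : Fin (m + 1) // e ≠ 0} → ℝ | ∀ e, 0 < β e}]
      paramIntegrand d G x :=
    (ae_restrict_iff' hmeas).2 (Filter.Eventually.of_forall fun β hβ =>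
      paramIntegrand_nonneg G x hβ)
  have hInt : IntegrableOn (paramIntegrand d G x)
      {β : {e : Fin (m + 1) // e ≠ 0} → ℝ | ∀ e, 0 < β e} volume :=
    ⟨(measurable_paramIntegrand G x).aestronglyMeasurable,
      (hasFiniteIntegral_iff_ofReal hnn).2 hfin'⟩
  refine ⟨hInt, ?_⟩
  rw [← ofReal_integral_eq_lintegral_ofReal hInt hnn, ← ENNReal.ofReal_mul hΓM.le] at hkey
  rw [div_mul_eq_mul_div, ENNReal.ofReal_div_of_pos hΓ]
  exact (ENNReal.eq_div_iff (by simpa using hΓ) ENNReal.ofReal_ne_top).2 hkey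
end
end

section
/- (Off-diagonal forest-polynomial identity.) Let G be a Feynman graph and let k ≠ ℓ be external vertices. Then in the polynomial ring ℤ[α_e : e ∈ E] one has: Σ_{e, f} α_e · α_f · Ψ̃_G^{q(v,w)} = Ψ̃_G^{p(k,ℓ)} − Ψ̃_G · Σ_{e joining k and ℓ} α_e, where the sum on the left is over ordered pairs of edges (e, f) such that e has endpoints k and an internal vertex v and f has endpoints ℓ and an internal vertex w (the cases v = w included, in which case the part {v,w} is the singleton {v}), and q(v,w) denotes the collection consisting of the part {v,w} together with the singletons {m} for every external vertex m. -/
open scoped Classical ENNReal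
open MeasureTheory

noncomputable section

namespace FeynmanGraph

variable {nV nE : ℕ} (G : FeynmanGraph nV nE)

/-- The dual spanning forest polynomial `Ψ̃_G^p` as a multivariate polynomial over `ℤ`
in the variables `α_e`, `e ∈ E`. -/
def dualPoly (p : Finset (Finset (Fin nV))) : MvPolynomial (Fin nE) ℤ :=
  ∑ F ∈ G.forests p, ∏ e ∈ F, MvPolynomial.X e

/-- The endpoint of the edge `e` other than `k` (for `e` incident to `k`). -/
def other (e : Fin nE) (k : Fin nV) : Fin nV :=
  if (G.ends e).1 = k then (G.ends e).2 else (G.ends e).1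

/-- The collection `q(v,w)` consisting of the part `{v, w}` (a singleton if `v = w`)
together with the singletons of all external vertices. -/
def qPart (v w : Fin nV) : Finset (Finset (Fin nV)) :=
  insert ({v, w} : Finset (Fin nV)) (G.ext.image (fun m => {m}))

end FeynmanGraph

namespace SimpleGraph

variable {V : Type*} {H K : SimpleGraph V} {a b : V}

/-- Reachability after adding a single edge `a b`. -/
theorem reachable_iff_of_adj_iff
    (hK : ∀ x y, K.Adj x y ↔ H.Adj x y ∨ (a ≠ b ∧ (x = a ∧ y = b ∨ x = b ∧ y = a))) (x y : V) :
    K.Reachable x y ↔ H.Reachable x y ∨ (H.Reachable x a ∧ H.Reachable b y) ∨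
      (H.Reachable x b ∧ H.Reachable a y) := by
  have hle : H ≤ K := fun x y h => (hK x y).2 (.inl h)
  have hab : K.Reachable a b := by
    by_cases h : a = b
    · rw [h]
    · exact Adj.reachable ((hK a b).2 (.inr ⟨h, .inl ⟨rfl, rfl⟩⟩))
  constructor
  · rintro ⟨p⟩
    induction p with
    | nil => exact .inl .rfl
    | @cons u v w h p ih =>
      rcases (hK u v).1 h with h | ⟨-, ⟨rfl, rfl⟩ | ⟨rfl, rfl⟩⟩
      · rcases ih with ih | ⟨h1, h2⟩ | ⟨h1, h2⟩
        · exact .inl (h.reachable.trans ih)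
        · exact .inr (.inl ⟨h.reachable.trans h1, h2⟩)
        · exact .inr (.inr ⟨h.reachable.trans h1, h2⟩)
      · rcases ih with ih | ⟨-, h2⟩ | ⟨-, h2⟩
        · exact .inr (.inl ⟨.rfl, ih⟩)
        · exact .inr (.inl ⟨.rfl, h2⟩)
        · exact .inl h2
      · rcases ih with ih | ⟨-, h2⟩ | ⟨-, h2⟩
        · exact .inr (.inr ⟨.rfl, ih⟩)
        · exact .inl h2
        · exact .inr (.inr ⟨.rfl, h2⟩)
  · rintro (h | ⟨h1, h2⟩ | ⟨h1, h2⟩)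
    · exact h.mono hle
    · exact (h1.mono hle).trans (hab.trans (h2.mono hle))
    · exact (h1.mono hle).trans (hab.symm.trans (h2.mono hle))

theorem card_connectedComponent_eq_of_reachable_iff
    (h : ∀ x y, K.Reachable x y ↔ H.Reachable x y) :
    Nat.card K.ConnectedComponent = Nat.card H.ConnectedComponent := by
  have : K.Reachable = H.Reachable := by
    funext x y
    exact propext (h x y)
  unfold ConnectedComponent
  rw [this]

/-- Joining two different components by an edge lowers the number of components by one. -/
theorem card_connectedComponent_add_one [Finite V] (hab : ¬ H.Reachable a b)
    (h : ∀ x y, K.Reachable x y ↔ H.Reachable x y ∨ (H.Reachable x a ∧ H.Reachable b y) ∨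
      (H.Reachable x b ∧ H.Reachable a y)) :
    Nat.card K.ConnectedComponent + 1 = Nat.card H.ConnectedComponent := by
  have e : {c : H.ConnectedComponent // c ≠ H.connectedComponentMk b} ≃ K.ConnectedComponent := by
    refine Equiv.ofBijective
      (fun c => Quot.map id (fun x y hxy => (h x y).2 (.inl hxy)) c.1) ⟨?_, ?_⟩
    · rintro ⟨c, hc⟩ ⟨d, hd⟩ hcd
      induction c using ConnectedComponent.ind with | _ x
      induction d using ConnectedComponent.ind with | _ y
      have hxy : K.Reachable x y := ConnectedComponent.exact hcd
      have hc' : ¬ H.Reachable x b := fun hh => hc (ConnectedComponent.sound hh)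
      have hd' : ¬ H.Reachable y b := fun hh => hd (ConnectedComponent.sound hh)
      rcases (h x y).1 hxy with hh | ⟨-, hh⟩ | ⟨hh, -⟩
      · exact Subtype.ext (ConnectedComponent.sound hh)
      · exact absurd hh.symm hd'
      · exact absurd hh hc'
    · intro c
      induction c using ConnectedComponent.ind with | _ x
      by_cases hx : H.Reachable x b
      · refine ⟨⟨H.connectedComponentMk a, fun hh => hab (ConnectedComponent.exact hh)⟩, ?_⟩
        exact ConnectedComponent.sound (G := K) ((h a x).2 (.inr (.inl ⟨.rfl, hx.symm⟩)))
      · exact ⟨⟨H.connectedComponentMk x, fun hh => hx (ConnectedComponent.exact hh)⟩, rfl⟩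
  rw [← Nat.card_congr e, ← Nat.card_congr (Equiv.optionSubtypeNe (H.connectedComponentMk b)),
    Finite.card_option]

end SimpleGraph

namespace FeynmanGraph

variable {nV nE : ℕ} (G : FeynmanGraph nV nE)

theorem joins_other {e : Fin nE} {a : Fin nV} (h : G.Incident e a) : G.Joins e a (G.other e a) := by
  unfold Incident at h
  unfold Joins other
  split_ifs with h1
  · exact .inl (Prod.ext h1 rfl)
  · exact .inr (Prod.ext rfl (h.resolve_left h1))

variable {G}

theorem Joins.ne {e : Fin nE} {a b : Fin nV} (h : G.Joins e a b) : a ≠ b := by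
  have := G.ends_ne e
  rcases h with h | h <;> rw [h] at this
  · exact this
  · exact this.symm

theorem Joins.incident {e : Fin nE} {a b : Fin nV} (h : G.Joins e a b) : G.Incident e a := by
  rcases h with h | h <;> simp [Incident, h]

theorem Joins.other_eq {e : Fin nE} {a b : Fin nV} (h : G.Joins e a b) : G.other e a = b := by
  have := h.ne
  rcases h with h | h <;> simp [other, h, this.symm]

theorem Joins.eq_or_eq {e : Fin nE} {a b x y : Fin nV} (h : G.Joins e a b) (h' : G.Joins e x y) :
    x = a ∧ y = b ∨ x = b ∧ y = a := by
  rcases h with h | h <;> rcases h' with h' | h' <;> rw [h] at h' <;> simp_all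

theorem edgeGraph_adj {F : Finset (Fin nE)} {x y : Fin nV} :
    (G.edgeGraph F).Adj x y ↔ ∃ e ∈ F, G.Joins e x y := by
  unfold edgeGraph
  rw [SimpleGraph.fromRel_adj]
  constructor
  · rintro ⟨-, ⟨e, he, h⟩ | ⟨e, he, h⟩⟩
    · exact ⟨e, he, h⟩
    · exact ⟨e, he, h.symm⟩
  · rintro ⟨e, he, h⟩
    exact ⟨h.ne, .inl ⟨e, he, h⟩⟩

theorem edgeGraph_mono {F F' : Finset (Fin nE)} (h : F ⊆ F') : G.edgeGraph F ≤ G.edgeGraph F' := by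
  intro x y hxy
  obtain ⟨e, he, hj⟩ := edgeGraph_adj.1 hxy
  exact edgeGraph_adj.2 ⟨e, h he, hj⟩

theorem reachable_insert_iff {F : Finset (Fin nE)} {e : Fin nE} {a b : Fin nV} (h : G.Joins e a b)
    (x y : Fin nV) :
    (G.edgeGraph (insert e F)).Reachable x y ↔ (G.edgeGraph F).Reachable x y ∨
      ((G.edgeGraph F).Reachable x a ∧ (G.edgeGraph F).Reachable b y) ∨
      ((G.edgeGraph F).Reachable x b ∧ (G.edgeGraph F).Reachable a y) := by
  refine SimpleGraph.reachable_iff_of_adj_iff (fun x y => ?_) x y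
  simp only [edgeGraph_adj, Finset.mem_insert]
  constructor
  · rintro ⟨f, rfl | hf, hj⟩
    · exact .inr ⟨h.ne, h.eq_or_eq hj⟩
    · exact .inl ⟨f, hf, hj⟩
  · rintro (⟨f, hf, hj⟩ | ⟨-, ⟨rfl, rfl⟩ | ⟨rfl, rfl⟩⟩)
    · exact ⟨f, .inr hf, hj⟩
    · exact ⟨e, .inl rfl, h⟩
    · exact ⟨e, .inl rfl, h.symm⟩

theorem card_component_insert {F : Finset (Fin nE)} {e : Fin nE} {a b : Fin nV} (h : G.Joins e a b)
    (hab : ¬ (G.edgeGraph F).Reachable a b) :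
    Nat.card (G.edgeGraph (insert e F)).ConnectedComponent + 1 =
      Nat.card (G.edgeGraph F).ConnectedComponent :=
  SimpleGraph.card_connectedComponent_add_one hab (reachable_insert_iff h)

theorem card_component_insert_of_reachable {F : Finset (Fin nE)} {e : Fin nE} {a b : Fin nV}
    (h : G.Joins e a b) (hab : (G.edgeGraph F).Reachable a b) :
    Nat.card (G.edgeGraph (insert e F)).ConnectedComponent =
      Nat.card (G.edgeGraph F).ConnectedComponent := by
  refine SimpleGraph.card_connectedComponent_eq_of_reachable_iff fun x y => ?_
  rw [reachable_insert_iff h]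
  refine ⟨?_, .inl⟩
  rintro (h | ⟨h1, h2⟩ | ⟨h1, h2⟩)
  · exact h
  · exact h1.trans (hab.trans h2)
  · exact h1.trans (hab.symm.trans h2)

theorem le_card_add_card_component (F : Finset (Fin nE)) :
    nV ≤ F.card + Nat.card (G.edgeGraph F).ConnectedComponent := by
  induction F using Finset.induction_on with
  | empty =>
    have hinj : Function.Injective (G.edgeGraph ∅).connectedComponentMk := by
      intro x y hxy
      obtain ⟨p⟩ := SimpleGraph.ConnectedComponent.exact hxy
      cases p with
      | nil => rfl
      | cons h _ => simp [edgeGraph_adj] at h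
    simpa using Nat.card_le_card_of_injective _ hinj
  | insert e F he ih =>
    rw [Finset.card_insert_of_notMem he]
    have hj : G.Joins e (G.ends e).1 (G.ends e).2 := .inl rfl
    by_cases hr : (G.edgeGraph F).Reachable (G.ends e).1 (G.ends e).2
    · rw [card_component_insert_of_reachable hj hr]
      lia
    · have := card_component_insert hj hr
      lia

/-- In an acyclic edge set, removing an edge disconnects its endpoints. -/
theorem not_reachable_of_card_insert {F : Finset (Fin nE)} {e : Fin nE} {a b : Fin nV}
    (he : e ∉ F) (h : G.Joins e a b)
    (hc : (insert e F).card + Nat.card (G.edgeGraph (insert e F)).ConnectedComponent = nV) :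
    ¬ (G.edgeGraph F).Reachable a b := by
  intro hr
  rw [card_component_insert_of_reachable h hr, Finset.card_insert_of_notMem he] at hc
  have := G.le_card_add_card_component F
  lia

/-- The first edge of a path from `a` to `b`. -/
theorem exists_first_edge {F : Finset (Fin nE)} {a b : Fin nV} (hab : a ≠ b)
    (h : (G.edgeGraph F).Reachable a b) :
    ∃ e ∈ F, ∃ v, G.Joins e a v ∧ (G.edgeGraph (F.erase e)).Reachable v b := by
  obtain ⟨p, hp⟩ := h.exists_isPath
  cases p with
  | nil => exact absurd rfl hab
  | @cons _ v _ hadj q =>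
    obtain ⟨e, he, hj⟩ := edgeGraph_adj.1 hadj
    refine ⟨e, he, v, hj, ⟨q.transfer _ fun s hs => ?_⟩⟩
    rw [SimpleGraph.Walk.cons_isPath_iff] at hp
    induction s with | _ x y
    obtain ⟨f, hf, hfj⟩ := edgeGraph_adj.1 (q.adj_of_mem_edges hs)
    refine edgeGraph_adj.2 ⟨f, Finset.mem_erase.2 ⟨?_, hf⟩, hfj⟩
    rintro rfl
    rcases hj.eq_or_eq hfj with ⟨rfl, -⟩ | ⟨-, rfl⟩
    · exact hp.2 (q.fst_mem_support_of_mem_edges hs)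
    · exact hp.2 (q.snd_mem_support_of_mem_edges hs)

theorem isForest_insert_iff {p : Finset (Finset (Fin nV))} {A : Finset (Fin nV)} (hA : A ∉ p)
    {F : Finset (Fin nE)} :
    G.IsForest (insert A p) F ↔ F.card + p.card + 1 = nV ∧
      Nat.card (G.edgeGraph F).ConnectedComponent = p.card + 1 ∧
      (∀ u ∈ A, ∀ v ∈ A, (G.edgeGraph F).Reachable u v) ∧
      (∀ Q ∈ p, ∀ u ∈ A, ∀ v ∈ Q, ¬ (G.edgeGraph F).Reachable u v) ∧
      (∀ P ∈ p, ∀ u ∈ P, ∀ v ∈ P, (G.edgeGraph F).Reachable u v) ∧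
      (∀ P ∈ p, ∀ Q ∈ p, P ≠ Q → ∀ u ∈ P, ∀ v ∈ Q, ¬ (G.edgeGraph F).Reachable u v) := by
  unfold IsForest
  rw [Finset.card_insert_of_notMem hA, ← add_assoc]
  simp only [Finset.mem_insert, forall_eq_or_imp]
  constructor
  · rintro ⟨h1, h2, ⟨h3, h4⟩, ⟨h5, h6⟩, h7⟩
    exact ⟨h1, h2, h3, fun Q hQ => h6 Q hQ (fun h => hA (h ▸ hQ)), h4, fun P hP => (h7 P hP).2⟩
  · rintro ⟨h1, h2, h3, h4, h5, h6⟩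
    refine ⟨h1, h2, ⟨h3, h5⟩, ⟨fun h => absurd rfl h, fun Q hQ _ => h4 Q hQ⟩, fun P hP =>
      ⟨fun _ u hu v hv h => h4 P hP v hv u hu h.symm, h6 P hP⟩⟩

section Expansion

variable {p : Finset (Finset (Fin nV))} {a b v : Fin nV} {e : Fin nE} {F : Finset (Fin nE)}

theorem pair_notMem (hb : ∀ P ∈ p, b ∉ P) (x : Fin nV) : ({x, b} : Finset (Fin nV)) ∉ p :=
  fun h => hb _ h (by simp)

theorem isForest_pair_iff (hb : ∀ P ∈ p, b ∉ P) :
    G.IsForest (insert {a, b} p) F ↔ F.card + p.card + 1 = nV ∧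
      Nat.card (G.edgeGraph F).ConnectedComponent = p.card + 1 ∧
      (G.edgeGraph F).Reachable a b ∧
      (∀ Q ∈ p, ∀ u ∈ Q, ¬ (G.edgeGraph F).Reachable a u) ∧
      (∀ P ∈ p, ∀ u ∈ P, ∀ v ∈ P, (G.edgeGraph F).Reachable u v) ∧
      (∀ P ∈ p, ∀ Q ∈ p, P ≠ Q → ∀ u ∈ P, ∀ v ∈ Q, ¬ (G.edgeGraph F).Reachable u v) := by
  rw [isForest_insert_iff (pair_notMem hb a)]
  refine and_congr_right fun _ => and_congr_right fun _ => ?_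
  constructor
  · rintro ⟨h1, h2, h3⟩
    exact ⟨h1 a (by simp) b (by simp), fun Q hQ u hu => h2 Q hQ a (by simp) u hu, h3⟩
  · rintro ⟨h1, h2, h3⟩
    refine ⟨?_, ?_, h3⟩
    · simp only [Finset.mem_insert, Finset.mem_singleton]
      rintro u (rfl | rfl) w (rfl | rfl)
      exacts [.rfl, h1, h1.symm, .rfl]
    · simp only [Finset.mem_insert, Finset.mem_singleton]
      rintro Q hQ u (rfl | rfl) w hw
      exacts [h2 Q hQ w hw, fun h => h2 Q hQ w hw (h1.trans h)]

theorem isForest_single_pair_iff (hva : v ≠ a) (hab : a ≠ b) (ha : ∀ P ∈ p, a ∉ P)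
    (hb : ∀ P ∈ p, b ∉ P) :
    G.IsForest (insert {a} (insert {v, b} p)) F ↔ F.card + p.card + 2 = nV ∧
      Nat.card (G.edgeGraph F).ConnectedComponent = p.card + 2 ∧
      (G.edgeGraph F).Reachable v b ∧
      ¬ (G.edgeGraph F).Reachable a b ∧
      (∀ Q ∈ p, ∀ u ∈ Q, ¬ (G.edgeGraph F).Reachable a u) ∧
      (∀ Q ∈ p, ∀ u ∈ Q, ¬ (G.edgeGraph F).Reachable b u) ∧
      (∀ P ∈ p, ∀ u ∈ P, ∀ v ∈ P, (G.edgeGraph F).Reachable u v) ∧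
      (∀ P ∈ p, ∀ Q ∈ p, P ≠ Q → ∀ u ∈ P, ∀ v ∈ Q, ¬ (G.edgeGraph F).Reachable u v) := by
  have ha' : ∀ P ∈ insert {v, b} p, a ∉ P := by
    simpa [hva.symm, hab] using ha
  have hpair : ({a} : Finset (Fin nV)) = {a, a} := by simp
  rw [hpair, isForest_pair_iff ha', Finset.card_insert_of_notMem (pair_notMem hb v)]
  simp only [Finset.mem_insert, Finset.mem_singleton, forall_eq_or_imp, forall_eq]
  constructor
  · rintro ⟨h1, h2, -, ⟨h3, h4⟩, ⟨h5, h6⟩, ⟨-, h7⟩, h8⟩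
    refine ⟨by lia, by lia, h5.1.2, h3.2, h4, fun Q hQ => ?_, h6, fun P hP => (h8 P hP).2⟩
    exact (h7 Q hQ (fun h => pair_notMem hb v (h ▸ hQ))).2
  · rintro ⟨h1, h2, h3, h4, h5, h6, h7, h8⟩
    have h9 : ∀ Q ∈ p, ∀ u ∈ Q, ¬ (G.edgeGraph F).Reachable v u :=
      fun Q hQ u hu h => h6 Q hQ u hu (h3.symm.trans h)
    exact ⟨by lia, by lia, .rfl, ⟨⟨fun h => h4 (h.trans h3), h4⟩, h5⟩,
      ⟨⟨⟨.rfl, h3⟩, h3.symm, .rfl⟩, h7⟩,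
      ⟨fun h => absurd rfl h, fun Q hQ _ => ⟨h9 Q hQ, h6 Q hQ⟩⟩,
      fun P hP => ⟨fun _ u hu => ⟨fun h => h9 P hP u hu h.symm, fun h => h6 P hP u hu h.symm⟩,
        h8 P hP⟩⟩

/-- Adding an edge `a v` to a forest separating `a` from `{v, b}` yields a forest connecting
`a` and `b`. -/
theorem IsForest.insert_edge (hj : G.Joins e a v) (hab : a ≠ b) (ha : ∀ P ∈ p, a ∉ P)
    (hb : ∀ P ∈ p, b ∉ P) (hF : G.IsForest (insert {a} (insert {v, b} p)) F) :
    e ∉ F ∧ G.IsForest (insert {a, b} p) (insert e F) := by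
  rw [isForest_single_pair_iff hj.ne.symm hab ha hb] at hF
  obtain ⟨h1, h2, h3, h4, h5, h6, h7, h8⟩ := hF
  have hav : ¬ (G.edgeGraph F).Reachable a v := fun h => h4 (h.trans h3)
  have he : e ∉ F := fun h => hav (edgeGraph_adj.2 ⟨e, h, hj⟩).reachable
  have hc := card_component_insert hj hav
  refine ⟨he, (isForest_pair_iff hb).2 ⟨?_, by lia, ?_, ?_, ?_, ?_⟩⟩
  · rw [Finset.card_insert_of_notMem he]
    lia
  · exact (reachable_insert_iff hj a b).2 (.inr (.inl ⟨.rfl, h3⟩))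
  · intro Q hQ u hu h
    rcases (reachable_insert_iff hj a u).1 h with h | ⟨-, h⟩ | ⟨-, h⟩
    · exact h5 Q hQ u hu h
    · exact h6 Q hQ u hu (h3.symm.trans h)
    · exact h5 Q hQ u hu h
  · exact fun P hP u hu w hw => (reachable_insert_iff hj u w).2 (.inl (h7 P hP u hu w hw))
  · intro P hP Q hQ hPQ u hu w hw h
    rcases (reachable_insert_iff hj u w).1 h with h | ⟨h, -⟩ | ⟨-, h⟩
    · exact h8 P hP Q hQ hPQ u hu w hw h
    · exact h5 P hP u hu h.symm
    · exact h5 Q hQ w hw h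

/-- Removing the first edge `a v` of the path from `a` to `b` in a forest connecting `a` and `b`
yields a forest separating `a` from `{v, b}`. -/
theorem IsForest.of_insert_edge (hj : G.Joins e a v) (hab : a ≠ b) (ha : ∀ P ∈ p, a ∉ P)
    (hb : ∀ P ∈ p, b ∉ P) (he : e ∉ F) (hvb : (G.edgeGraph F).Reachable v b)
    (hF : G.IsForest (insert {a, b} p) (insert e F)) :
    G.IsForest (insert {a} (insert {v, b} p)) F := by
  rw [isForest_pair_iff hb] at hF
  obtain ⟨h1, h2, h3, h4, h5, h6⟩ := hF
  have hmono : ∀ {x y}, (G.edgeGraph F).Reachable x y → (G.edgeGraph (insert e F)).Reachable x y :=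
    fun h => h.mono (edgeGraph_mono (Finset.subset_insert e F))
  have hav : ¬ (G.edgeGraph F).Reachable a v := not_reachable_of_card_insert he hj (by lia)
  have hc := card_component_insert hj hav
  rw [Finset.card_insert_of_notMem he] at h1
  refine (isForest_single_pair_iff hj.ne.symm hab ha hb).2 ⟨by lia, by lia, hvb,
    fun h => hav (h.trans hvb.symm), fun Q hQ u hu h => h4 Q hQ u hu (hmono h),
    fun Q hQ u hu h => h4 Q hQ u hu (h3.trans (hmono h)), ?_,
    fun P hP Q hQ hPQ u hu w hw h => h6 P hP Q hQ hPQ u hu w hw (hmono h)⟩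
  intro P hP u hu w hw
  rcases (reachable_insert_iff hj u w).1 (h5 P hP u hu w hw) with h | ⟨h, -⟩ | ⟨-, h⟩
  · exact h
  · exact absurd (hmono h.symm) (h4 P hP u hu)
  · exact absurd (hmono h) (h4 P hP w hw)

/-- The first edge of the path from `a` to `b` is unique. -/
theorem first_edge_unique {e' : Fin nE} {v' : Fin nV} {F' : Finset (Fin nE)}
    (hj : G.Joins e a v) (hj' : G.Joins e' a v') (heq : insert e F = insert e' F')
    (hvb : (G.edgeGraph F).Reachable v b) (hab : ¬ (G.edgeGraph F).Reachable a b)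
    (hab' : ¬ (G.edgeGraph F').Reachable a b) : e = e' := by
  by_contra hne
  have he'F : e' ∈ F := by
    have : e' ∈ insert e F := heq ▸ Finset.mem_insert_self e' F'
    exact (Finset.mem_insert.1 this).resolve_left (Ne.symm hne)
  have heF' : e ∈ F' := by
    have : e ∈ insert e' F' := heq ▸ Finset.mem_insert_self e F
    exact (Finset.mem_insert.1 this).resolve_left hne
  have hsub : F.erase e' ⊆ F' := by
    intro x hx
    rw [Finset.mem_erase] at hx
    have : x ∈ insert e' F' := heq ▸ Finset.mem_insert_of_mem hx.2
    exact (Finset.mem_insert.1 this).resolve_left hx.1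
  have hmono : ∀ {x y}, (G.edgeGraph (F.erase e')).Reachable x y → (G.edgeGraph F).Reachable x y :=
    fun h => h.mono (edgeGraph_mono (Finset.erase_subset e' F))
  rw [← Finset.insert_erase he'F, reachable_insert_iff hj'] at hvb
  rcases hvb with h | ⟨h, h'⟩ | ⟨-, h⟩
  · exact hab' ((edgeGraph_adj.2 ⟨e, heF', hj⟩).reachable.trans (h.mono (edgeGraph_mono hsub)))
  · exact hab ((edgeGraph_adj.2 ⟨e', he'F, hj'⟩).reachable.trans (hmono h'))
  · exact hab (hmono h)

/-- Expansion of a forest polynomial along the first edge of the path from `a` to `b`. -/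
theorem dualPoly_pair_eq_sum (hab : a ≠ b) (ha : ∀ P ∈ p, a ∉ P) (hb : ∀ P ∈ p, b ∉ P) :
    G.dualPoly (insert {a, b} p) = ∑ e ∈ Finset.univ.filter (fun e => G.Incident e a),
      MvPolynomial.X e * G.dualPoly (insert {a} (insert {G.other e a, b} p)) := by
  unfold dualPoly
  simp_rw [Finset.mul_sum]
  rw [Finset.sum_sigma']
  symm
  refine Finset.sum_bij (fun x _ => insert x.1 x.2) ?_ ?_ ?_ ?_
  · rintro ⟨e, F⟩ hx
    simp only [Finset.mem_sigma, Finset.mem_filter, Finset.mem_univ, true_and, forests] at hx ⊢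
    exact (hx.2.insert_edge (G.joins_other hx.1) hab ha hb).2
  · rintro ⟨e, F⟩ hx ⟨e', F'⟩ hx' heq
    simp only [Finset.mem_sigma, Finset.mem_filter, Finset.mem_univ, true_and, forests] at hx hx' heq
    have hj := G.joins_other hx.1
    have hj' := G.joins_other hx'.1
    have he := (hx.2.insert_edge hj hab ha hb).1
    have he' := (hx'.2.insert_edge hj' hab ha hb).1
    obtain ⟨-, -, hvb, hnab, -⟩ := (isForest_single_pair_iff hj.ne.symm hab ha hb).1 hx.2
    obtain ⟨-, -, -, hnab', -⟩ := (isForest_single_pair_iff hj'.ne.symm hab ha hb).1 hx'.2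
    obtain rfl := first_edge_unique hj hj' heq hvb hnab hnab'
    rw [← Finset.erase_insert he, heq, Finset.erase_insert he']
  · intro F hF
    simp only [Finset.mem_filter, Finset.mem_univ, true_and, forests] at hF
    obtain ⟨e, he, v, hj, hvb⟩ := exists_first_edge hab ((isForest_pair_iff hb).1 hF).2.2.1
    have hF' := hF
    rw [← Finset.insert_erase he] at hF'
    refine ⟨⟨e, F.erase e⟩, ?_, Finset.insert_erase he⟩
    simp only [Finset.mem_sigma, Finset.mem_filter, Finset.mem_univ, true_and, forests]
    rw [hj.other_eq]
    exact ⟨hj.incident, hF'.of_insert_edge hj hab ha hb (Finset.notMem_erase e F) hvb⟩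
  · rintro ⟨e, F⟩ hx
    simp only [Finset.mem_sigma, Finset.mem_filter, Finset.mem_univ, true_and, forests] at hx
    rw [Finset.prod_insert (hx.2.insert_edge (G.joins_other hx.1) hab ha hb).1]

/-- The forest polynomial vanishes if two different parts share a vertex. -/
theorem dualPoly_eq_zero {P Q : Finset (Fin nV)} (hP : P ∈ p) (hQ : Q ∈ p) (hPQ : P ≠ Q)
    (hvP : v ∈ P) (hvQ : v ∈ Q) : G.dualPoly p = 0 := by
  refine Finset.sum_eq_zero fun F hF => ?_
  simp only [Finset.mem_filter, Finset.mem_univ, true_and, forests] at hF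
  exact absurd .rfl (hF.2.2.2 P hP Q hQ hPQ v hvP v hvQ)

end Expansion

theorem insert_singlePart_erase (G : FeynmanGraph nV nE) {k ℓ : Fin nV} (hk : k ∈ G.ext)
    (hl : ℓ ∈ G.ext) (hkl : k ≠ ℓ) :
    insert {ℓ} (insert {k} (((G.ext.erase k).erase ℓ).image (fun v => ({v} : Finset (Fin nV))))) =
      G.singlePart := by
  rw [singlePart, ← Finset.image_insert, ← Finset.image_insert, Finset.insert_comm,
    Finset.insert_erase (Finset.mem_erase.2 ⟨hkl.symm, hl⟩), Finset.insert_erase hk]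

end FeynmanGraph

/-- Off-diagonal forest-polynomial identity.  For external vertices
`k ≠ ℓ`, in `ℤ[α_e : e ∈ E]` one has
`Σ_{e,f} α_e α_f Ψ̃_G^{q(v,w)} = Ψ̃_G^{p(k,ℓ)} - Ψ̃_G · Σ_{e joins k,ℓ} α_e`,
where `e` runs over the edges joining `k` to an internal vertex `v` and `f` over the
edges joining `ℓ` to an internal vertex `w`. -/
theorem offDiagonal_forest_identity {nV nE : ℕ} (G : FeynmanGraph nV nE)
    (k ℓ : Fin nV) (hk : k ∈ G.ext) (hl : ℓ ∈ G.ext) (hkl : k ≠ ℓ) :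
    ∑ e ∈ Finset.univ.filter (fun e => G.Incident e k ∧ G.other e k ∉ G.ext),
      ∑ f ∈ Finset.univ.filter (fun f => G.Incident f ℓ ∧ G.other f ℓ ∉ G.ext),
        MvPolynomial.X e * MvPolynomial.X f *
          G.dualPoly (G.qPart (G.other e k) (G.other f ℓ))
      = G.dualPoly (G.pairPart k ℓ) -
        G.dualPoly G.singlePart *
          ∑ e ∈ Finset.univ.filter (fun e => G.Joins e k ℓ), MvPolynomial.X e := by
  have hsingle := G.insert_singlePart_erase hk hl hkl
  set p₀ := ((G.ext.erase k).erase ℓ).image (fun v => ({v} : Finset (Fin nV)))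
  have hk₀ : ∀ P ∈ p₀, k ∉ P := by
    intro P hP
    obtain ⟨m, hm, rfl⟩ := Finset.mem_image.1 hP
    simp only [Finset.mem_erase] at hm
    simpa using hm.2.1.symm
  have hl₀ : ∀ P ∈ p₀, ℓ ∉ P := by
    intro P hP
    obtain ⟨m, hm, rfl⟩ := Finset.mem_image.1 hP
    simp only [Finset.mem_erase] at hm
    simpa using hm.1.symm
  have hinner : ∀ v ∉ G.ext, G.dualPoly (insert {k} (insert {v, ℓ} p₀)) =
      ∑ f ∈ Finset.univ.filter (fun f => G.Incident f ℓ ∧ G.other f ℓ ∉ G.ext),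
        MvPolynomial.X f * G.dualPoly (G.qPart v (G.other f ℓ)) := by
    intro v hv
    have hlv : ℓ ≠ v := fun h => hv (h ▸ hl)
    have hkv : k ≠ v := fun h => hv (h ▸ hk)
    rw [Finset.insert_comm, Finset.pair_comm, FeynmanGraph.dualPoly_pair_eq_sum hlv,
      ← Finset.filter_filter]
    · rw [Finset.sum_filter (fun f => G.other f ℓ ∉ G.ext)]
      refine Finset.sum_congr rfl fun f _ => ?_
      rw [Finset.insert_comm, hsingle]
      split_ifs with hw
      · have hw' : {G.other f ℓ} ∈ G.singlePart := Finset.mem_image_of_mem _ hw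
        rw [FeynmanGraph.dualPoly_eq_zero (v := G.other f ℓ) (Finset.mem_insert_self _ _)
          (Finset.mem_insert_of_mem hw') _ (by simp) (by simp), mul_zero]
        intro h
        have : v ∈ ({G.other f ℓ} : Finset (Fin nV)) := h ▸ (by simp)
        exact hv (Finset.mem_singleton.1 this ▸ hw)
      · rw [FeynmanGraph.qPart, Finset.pair_comm]
        rfl
    · simpa [hkl.symm] using hl₀
    · simp only [Finset.mem_insert, forall_eq_or_imp, Finset.mem_singleton, hkv.symm,
        not_false_eq_true, true_and]
      intro P hP hvP
      obtain ⟨m, hm, rfl⟩ := Finset.mem_image.1 hP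
      rw [Finset.mem_singleton.1 hvP] at hv
      exact hv (Finset.mem_of_mem_erase (Finset.mem_of_mem_erase hm))
  have hjoins : Finset.univ.filter (fun e => G.Joins e k ℓ) =
      (Finset.univ.filter (fun e => G.Incident e k)).filter (fun e => G.other e k = ℓ) := by
    ext e
    simp only [Finset.mem_filter, Finset.mem_univ, true_and]
    exact ⟨fun h => ⟨h.incident, h.other_eq⟩, fun h => h.2 ▸ G.joins_other h.1⟩
  rw [eq_sub_iff_add_eq, FeynmanGraph.pairPart, FeynmanGraph.dualPoly_pair_eq_sum hkl hk₀ hl₀,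
    hjoins, ← Finset.filter_filter, Finset.sum_filter (fun e => G.other e k ∉ G.ext),
    Finset.sum_filter (fun e => G.other e k = ℓ), Finset.mul_sum, ← Finset.sum_add_distrib]
  refine Finset.sum_congr rfl fun e he => ?_
  have hvk := (G.joins_other (Finset.mem_filter.1 he).2).ne.symm
  by_cases hv : G.other e k ∈ G.ext
  · rw [if_neg (not_not.2 hv), zero_add]
    split_ifs with hvl
    · rw [hvl, Finset.pair_eq_singleton, Finset.insert_comm, hsingle, mul_comm]
    · have hv₀ : {G.other e k} ∈ p₀ := Finset.mem_image_of_mem _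
        (Finset.mem_erase.2 ⟨hvl, Finset.mem_erase.2 ⟨hvk, hv⟩⟩)
      rw [FeynmanGraph.dualPoly_eq_zero (v := G.other e k)
        (Finset.mem_insert_of_mem (Finset.mem_insert_self _ _))
        (Finset.mem_insert_of_mem (Finset.mem_insert_of_mem hv₀)) _ (by simp) (by simp),
        mul_zero, mul_zero]
      intro h
      exact hl₀ _ hv₀ (h ▸ by simp)
  · have hvl : G.other e k ≠ ℓ := fun h => hv (h ▸ hl)
    rw [if_pos hv, if_neg hvl, mul_zero, add_zero, hinner _ hv, Finset.mul_sum]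
    exact Finset.sum_congr rfl fun f _ => mul_assoc _ _ _
end
end
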